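/- Let q be an odd prime power, let ρ be a cuspidal irreducible complex representation of GL_r(𝔽_q), and let π be a ρ-primary irreducible representation of GL_{rn}(𝔽_q), i.e. an irreducible constituent of the n-fold parabolic induction ρ × ρ × ⋯ × ρ. Let A ∈ GL_{rn}(𝔽_q) satisfy A² = I and let H_A be its centralizer. If π has a nonzero H_A-invariant vector, then π is isomorphic to its dual representation π*. -/

import Mathlib

open Matrix

noncomputable section

namespace Paper

/-- nonzero vector invariant under a set of group elements -/
def HasInvVec {G V : Type*} [Group G] [AddCommGroup V] [Module ℂ V]
    (π : Representation ℂ G V) (S : Set G) : Prop :=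
  ∃ v : V, v ≠ 0 ∧ ∀ g ∈ S, π g v = v

/-- nonzero invariant linear functional -/
def HasInvFunctional {G V : Type*} [Group G] [AddCommGroup V] [Module ℂ V]
    (π : Representation ℂ G V) (S : Set G) : Prop :=
  ∃ ℓ : Module.Dual ℂ V, ℓ ≠ 0 ∧ ∀ g ∈ S, ∀ v : V, ℓ (π g v) = ℓ v

/-- isomorphism of representations -/
def RepIso {G V W : Type*} [Group G] [AddCommGroup V] [Module ℂ V] [AddCommGroup W] [Module ℂ W]
    (π : Representation ℂ G V) (π' : Representation ℂ G W) : Prop :=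
  ∃ e : V ≃ₗ[ℂ] W, ∀ (g : G) (v : V), e (π g v) = π' g (e v)

/-- irreducibility -/
def IsIrred {G V : Type*} [Group G] [AddCommGroup V] [Module ℂ V]
    (π : Representation ℂ G V) : Prop :=
  (∃ v : V, v ≠ 0) ∧
    ∀ W : Submodule ℂ V, (∀ (g : G), ∀ v ∈ W, π g v ∈ W) → W = ⊥ ∨ W = ⊤

/-- membership in the "unipotent radical" pattern for the partition function `f`:
the matrix agrees with the identity except at entries `(i,j)` with `f i < f j`. -/
def unipMem {F : Type*} [Field F] {n m : ℕ} (f : Fin n → Fin m)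
    (A : Matrix (Fin n) (Fin n) F) : Prop :=
  ∀ i j, ¬ f i < f j → A i j = (1 : Matrix (Fin n) (Fin n) F) i j

/-- a representation of `GL_n(F)` is cuspidal if for every proper standard parabolic
(given by a monotone surjection onto `Fin m`, `m ≥ 2`), the only vector invariant under the
corresponding unipotent radical is zero. -/
def IsCuspidal {F : Type*} [Field F] {n : ℕ} {V : Type*} [AddCommGroup V] [Module ℂ V]
    (π : Representation ℂ (GL (Fin n) F) V) : Prop :=
  ∀ (m : ℕ) (f : Fin n → Fin m), 2 ≤ m → Monotone f → Function.Surjective f →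
    ∀ v : V, (∀ A : GL (Fin n) F, unipMem f (A : Matrix (Fin n) (Fin n) F) → π A v = v) → v = 0

/-- the standard parabolic subgroup attached to a partition function `f` (block
upper-triangular invertible matrices). -/
def parabolic {F : Type*} [Field F] {n m : ℕ} (f : Fin n → Fin m) : Subgroup (GL (Fin n) F) where
  carrier := {A | BlockTriangular (A : Matrix (Fin n) (Fin n) F) f}
  one_mem' := by simpa using blockTriangular_one
  mul_mem' := fun ha hb => by simpa using Matrix.BlockTriangular.mul ha hb
  inv_mem' := by
    intro A hA
    have h : ((A⁻¹ : GL (Fin n) F) : Matrix (Fin n) (Fin n) F)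
        = ((A : Matrix (Fin n) (Fin n) F))⁻¹ := by
      simp [Matrix.coe_units_inv]
    simp only [Set.mem_setOf_eq] at hA ⊢
    rw [h]
    haveI : Invertible (A : Matrix (Fin n) (Fin n) F) := A.invertible
    exact blockTriangular_inv_of_blockTriangular hA


variable {F : Type*} [Field F] {n m k : ℕ}

def leviMem {α : Type*} (f : Fin n → α) (A : Matrix (Fin n) (Fin n) F) : Prop :=
  ∀ i j, f i ≠ f j → A i j = 0

/-- the standard Levi subgroup attached to a partition function `f`
(block-diagonal invertible matrices). -/
def levi (f : Fin n → Fin m) : Subgroup (GL (Fin n) F) where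
  carrier := {A | leviMem f (A : Matrix (Fin n) (Fin n) F)}
  one_mem' := by
    intro i j hij
    have : i ≠ j := fun h => hij (by rw [h])
    simp [Matrix.one_apply, this]
  mul_mem' := by
    intro A B hA hB
    intro i j hij
    show (((A : Matrix (Fin n) (Fin n) F)) * B) i j = 0
    rw [Matrix.mul_apply]
    apply Finset.sum_eq_zero
    intro x _
    by_cases h : f i = f x
    · rw [hB x j (by rw [← h]; exact hij), mul_zero]
    · rw [hA i x h, zero_mul]
  inv_mem' := by
    intro A hA
    simp only [Set.mem_setOf_eq] at hA ⊢
    haveI : Invertible (A : Matrix (Fin n) (Fin n) F) := A.invertible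
    have h1 : BlockTriangular (A : Matrix (Fin n) (Fin n) F) f := fun i j h => hA i j (ne_of_gt h)
    have h2 : BlockTriangular ((A : Matrix (Fin n) (Fin n) F))ᵀ f :=
      fun i j h => hA j i (ne_of_lt h)
    have h1' := blockTriangular_inv_of_blockTriangular h1
    haveI : Invertible ((A : Matrix (Fin n) (Fin n) F))ᵀ := Matrix.invertibleTranspose _
    have h2' := blockTriangular_inv_of_blockTriangular h2
    have hcoe : ((A⁻¹ : GL (Fin n) F) : Matrix (Fin n) (Fin n) F)
        = ((A : Matrix (Fin n) (Fin n) F))⁻¹ := by simp [Matrix.coe_units_inv]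
    rw [hcoe]
    intro i j hij
    rcases lt_or_gt_of_ne hij with h | h
    · have := h2' h
      rw [← Matrix.transpose_nonsing_inv] at this
      simpa using this
    · exact h1' h

theorem submatrix_mul_block (f : Fin n → Fin m) (a : Fin m) (e : Fin k → Fin n)
    (he : Function.Injective e) (hmem : ∀ i, f (e i) = a)
    (hsurj : ∀ j, f j = a → ∃ i, e i = j)
    {A B : Matrix (Fin n) (Fin n) F} (hA : BlockTriangular A f) (hB : BlockTriangular B f) :
    (A * B).submatrix e e = A.submatrix e e * B.submatrix e e := by
  ext i j
  rw [Matrix.submatrix_apply, Matrix.mul_apply, Matrix.mul_apply]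
  rw [show (∑ x : Fin n, A (e i) x * B x (e j))
      = ∑ x ∈ Finset.univ.image e, A (e i) x * B x (e j) from ?_]
  · rw [Finset.sum_image (fun x _ y _ h => he h)]
    simp
  · symm
    apply Finset.sum_subset (Finset.subset_univ _)
    intro x _ hx
    have hxa : f x ≠ a := by
      intro hfa
      obtain ⟨i', hi'⟩ := hsurj x hfa
      exact hx (Finset.mem_image.mpr ⟨i', Finset.mem_univ _, hi'⟩)
    rcases lt_or_gt_of_ne hxa with h | h
    · rw [hA (show f x < f (e i) by rw [hmem]; exact h), zero_mul]
    · rw [hB (show f (e j) < f x by rw [hmem]; exact h), mul_zero]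


theorem parabolic_mem' {F : Type*} [Field F] {n m : ℕ} {f : Fin n → Fin m} {A : GL (Fin n) F} :
    A ∈ parabolic f ↔ BlockTriangular (A : Matrix (Fin n) (Fin n) F) f := Iff.rfl

theorem levi_mem' {F : Type*} [Field F] {n m : ℕ} {f : Fin n → Fin m} {A : GL (Fin n) F} :
    A ∈ levi f ↔ leviMem f (A : Matrix (Fin n) (Fin n) F) := Iff.rfl

/-- extraction of the `a`-th diagonal block, as a group homomorphism from the parabolic
subgroup to a general linear group, along an enumeration `e` of the `a`-th block. -/
def leviProj (f : Fin n → Fin m) (a : Fin m) (e : Fin k → Fin n)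
    (he : Function.Injective e) (hmem : ∀ i, f (e i) = a)
    (hsurj : ∀ j, f j = a → ∃ i, e i = j) :
    (parabolic (F := F) f) →* GL (Fin k) F where
  toFun A :=
    { val := ((A : GL (Fin n) F) : Matrix (Fin n) (Fin n) F).submatrix e e
      inv := (((A : GL (Fin n) F)⁻¹ : GL (Fin n) F) : Matrix (Fin n) (Fin n) F).submatrix e e
      val_inv := by
        rw [← submatrix_mul_block f a e he hmem hsurj (parabolic_mem'.mp A.2)
          (parabolic_mem'.mp ((parabolic f).inv_mem A.2))]
        rw [show ((A : GL (Fin n) F) : Matrix (Fin n) (Fin n) F) *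
            (((A : GL (Fin n) F)⁻¹ : GL (Fin n) F) : Matrix (Fin n) (Fin n) F) = 1 by
          rw [← Units.val_mul, mul_inv_cancel, Units.val_one]]
        exact Matrix.submatrix_one e he
      inv_val := by
        rw [← submatrix_mul_block f a e he hmem hsurj
          (parabolic_mem'.mp ((parabolic f).inv_mem A.2)) (parabolic_mem'.mp A.2)]
        rw [show (((A : GL (Fin n) F)⁻¹ : GL (Fin n) F) : Matrix (Fin n) (Fin n) F) *
            ((A : GL (Fin n) F) : Matrix (Fin n) (Fin n) F) = 1 by
          rw [← Units.val_mul, inv_mul_cancel, Units.val_one]]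
        exact Matrix.submatrix_one e he }
  map_one' := by
    ext i j
    show ((1 : Matrix (Fin n) (Fin n) F).submatrix e e) i j = _
    rw [Matrix.submatrix_one e he]
    rfl
  map_mul' A B := by
    ext i j
    show ((((A * B : (parabolic f)) : GL (Fin n) F) : Matrix (Fin n) (Fin n) F).submatrix e e) i j
      = _
    rw [show (((A * B : (parabolic f)) : GL (Fin n) F) : Matrix (Fin n) (Fin n) F)
        = ((A : GL (Fin n) F) : Matrix (Fin n) (Fin n) F) *
          ((B : GL (Fin n) F) : Matrix (Fin n) (Fin n) F) from rfl]
    rw [submatrix_mul_block f a e he hmem hsurj (parabolic_mem'.mp A.2) (parabolic_mem'.mp B.2)]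
    rfl


open scoped TensorProduct

/-- exterior tensor product of representations: the product group `∀ a, G a` acts on
`⨂[ℂ] a, V a` factorwise. -/
def piTensorRep {ι : Type*} [Fintype ι] {G : ι → Type*} [∀ a, Group (G a)]
    {V : ι → Type*} [∀ a, AddCommGroup (V a)] [∀ a, Module ℂ (V a)]
    (π : ∀ a, Representation ℂ (G a) (V a)) :
    Representation ℂ (∀ a, G a) (⨂[ℂ] a, V a) :=
  PiTensorProduct.mapMonoidHom.comp
    { toFun := fun g => fun a => π a (g a)
      map_one' := by funext a; simp
      map_mul' := fun g h => by funext a; simp }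

variable {G : Type*} [Group G] {W : Type*} [AddCommGroup W] [Module ℂ W]

/-- the space of the induced representation (function model): functions `φ : G → W`
with `φ (p * g) = x p (φ g)`. -/
def IndCarrier (P : Subgroup G) (x : Representation ℂ P W) : Submodule ℂ (G → W) where
  carrier := {φ | ∀ (p : P) (g : G), φ (↑p * g) = x p (φ g)}
  add_mem' := by
    intro φ ψ hφ hψ p g
    simp only [Pi.add_apply, hφ p g, hψ p g, map_add]
  zero_mem' := by
    intro p g
    simp
  smul_mem' := by
    intro c φ hφ p g
    simp only [Pi.smul_apply, hφ p g, _root_.map_smul]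

/-- the induced representation `Ind_P^G x` in the function model, `(g • φ) y = φ (y * g)`. -/
def IndRep (P : Subgroup G) (x : Representation ℂ P W) :
    Representation ℂ G (IndCarrier P x) where
  toFun g :=
    { toFun := fun φ => ⟨fun y => (φ : G → W) (y * g), by
        intro p y
        show (φ : G → W) (↑p * y * g) = _
        rw [mul_assoc]
        exact φ.2 p (y * g)⟩
      map_add' := fun φ ψ => by ext y; rfl
      map_smul' := fun c φ => by ext y; rfl }
  map_one' := by
    apply LinearMap.ext
    intro φ
    apply Subtype.ext
    funext y
    show (φ : G → W) (y * 1) = (φ : G → W) y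
    rw [mul_one]
  map_mul' g h := by
    apply LinearMap.ext
    intro φ
    apply Subtype.ext
    funext y
    show (φ : G → W) (y * (g * h)) = (φ : G → W) (y * g * h)
    rw [mul_assoc]


theorem unip_conj {f : Fin n → Fin m} {l A : GL (Fin n) F}
    (hl : l ∈ levi f) (hA : unipMem f (A : Matrix (Fin n) (Fin n) F)) :
    unipMem f ((l⁻¹ * A * l : GL (Fin n) F) : Matrix (Fin n) (Fin n) F) := by
  have hli : leviMem f ((l⁻¹ : GL (Fin n) F) : Matrix (Fin n) (Fin n) F) :=
    levi_mem'.mp ((levi f).inv_mem hl)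
  have hlm : leviMem f ((l : GL (Fin n) F) : Matrix (Fin n) (Fin n) F) := levi_mem'.mp hl
  set li := ((l⁻¹ : GL (Fin n) F) : Matrix (Fin n) (Fin n) F) with hli_def
  set lm := ((l : GL (Fin n) F) : Matrix (Fin n) (Fin n) F) with hlm_def
  set Am := ((A : GL (Fin n) F) : Matrix (Fin n) (Fin n) F) with hAm_def
  have hval : ((l⁻¹ * A * l : GL (Fin n) F) : Matrix (Fin n) (Fin n) F) = li * Am * lm := by
    rw [Units.val_mul, Units.val_mul]
  have hN : li * Am * lm = 1 + li * (Am - 1) * lm := by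
    have h1 : li * lm = 1 := by
      rw [hli_def, hlm_def, ← Units.val_mul, inv_mul_cancel, Units.val_one]
    rw [Matrix.mul_sub, Matrix.mul_one, Matrix.sub_mul, h1]
    abel
  intro i j hij
  rw [hval, hN, Matrix.add_apply]
  have hzero : (li * (Am - 1) * lm) i j = 0 := by
    rw [Matrix.mul_apply]
    apply Finset.sum_eq_zero
    intro t _
    by_cases ht : f t = f j
    · rw [Matrix.mul_apply]
      have : ∀ s ∈ Finset.univ, li i s * (Am - 1) s t = 0 := by
        intro s _
        by_cases hs : f i = f s
        · have hN0 : (Am - 1) s t = 0 := by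
            have : ¬ f s < f t := by rw [← hs, ht]; exact hij
            rw [Matrix.sub_apply, hA s t this, sub_self]
          rw [hN0, mul_zero]
        · rw [hli i s (fun h => hs h), zero_mul]
      rw [Finset.sum_eq_zero this, zero_mul]
    · rw [hlm t j ht, mul_zero]
  rw [hzero, add_zero]

variable {V : Type*} [AddCommGroup V] [Module ℂ V]

/-- the Jacquet restriction: the space of vectors invariant under the unipotent radical. -/
def jacquetModule (π : Representation ℂ (GL (Fin n) F) V) (f : Fin n → Fin m) :
    Submodule ℂ V where
  carrier := {v | ∀ A : GL (Fin n) F, unipMem f (A : Matrix (Fin n) (Fin n) F) → π A v = v}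
  add_mem' := fun hv hw A hA => by rw [map_add, hv A hA, hw A hA]
  zero_mem' := fun A hA => by simp
  smul_mem' := fun c v hv A hA => by rw [_root_.map_smul, hv A hA]

theorem jacquet_stable (π : Representation ℂ (GL (Fin n) F) V) (f : Fin n → Fin m)
    {l : GL (Fin n) F} (hl : l ∈ levi f) {v : V} (hv : v ∈ jacquetModule π f) :
    π l v ∈ jacquetModule π f := by
  intro A hA
  have key : A * l = l * (l⁻¹ * A * l) := by group
  have : π A (π l v) = π (A * l) v := by rw [_root_.map_mul]; rfl
  rw [this, key, _root_.map_mul]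
  have : π (l⁻¹ * A * l) v = v := hv _ (unip_conj hl hA)
  show π l (π (l⁻¹ * A * l) v) = π l v
  rw [this]

/-- the Jacquet restriction of `π` as a representation of the Levi subgroup. -/
def jacquetRep (π : Representation ℂ (GL (Fin n) F) V) (f : Fin n → Fin m) :
    Representation ℂ (levi (F := F) f) (jacquetModule π f) where
  toFun l := (π (l : GL (Fin n) F)).restrict (fun v hv => jacquet_stable π f l.2 hv)
  map_one' := by
    apply LinearMap.ext
    intro v
    apply Subtype.ext
    show π ((1 : levi (F := F) f) : GL (Fin n) F) (v : V) = (v : V)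
    rw [Subgroup.coe_one, _root_.map_one]
    rfl
  map_mul' l l' := by
    apply LinearMap.ext
    intro v
    apply Subtype.ext
    show π (((l * l' : levi (F := F) f)) : GL (Fin n) F) (v : V) = _
    rw [Subgroup.coe_mul, _root_.map_mul]
    rfl



section ParabolicInduction

variable {F : Type*} [Field F]

/-- the group homomorphism from a parabolic subgroup onto the product of the general linear
groups of its diagonal blocks. -/
def leviProjPi {N m : ℕ} (f : Fin N → Fin m) {k : Fin m → ℕ} (e : ∀ a, Fin (k a) → Fin N)
    (he : ∀ a, Function.Injective (e a)) (hmem : ∀ a i, f (e a i) = a)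
    (hsurj : ∀ a j, f j = a → ∃ i, e a i = j) :
    (parabolic (F := F) f) →* (∀ a, GL (Fin (k a)) F) :=
  Pi.monoidHom (fun a => leviProj f a (e a) (he a) (hmem a) (hsurj a))

/-- parabolic induction: the representation of `GL_N(F)` induced from the inflation to the
parabolic subgroup attached to `f` of the exterior tensor product of the `π a`. -/
def parabolicInd {N m : ℕ} (f : Fin N → Fin m) {k : Fin m → ℕ} (e : ∀ a, Fin (k a) → Fin N)
    (he : ∀ a, Function.Injective (e a)) (hmem : ∀ a i, f (e a i) = a)
    (hsurj : ∀ a j, f j = a → ∃ i, e a i = j)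
    {V : Fin m → Type*} [∀ a, AddCommGroup (V a)] [∀ a, Module ℂ (V a)]
    (π : ∀ a, Representation ℂ (GL (Fin (k a)) F) (V a)) :
    Representation ℂ (GL (Fin N) F)
      (IndCarrier (parabolic f) ((piTensorRep π).comp (leviProjPi f e he hmem hsurj))) :=
  IndRep (parabolic f) ((piTensorRep π).comp (leviProjPi f e he hmem hsurj))

end ParabolicInduction

/-- `A` is a monomial matrix (normalizes the diagonal torus) with underlying
permutation `σ`. -/
def IsMonomialWith {F : Type*} [Field F] {n : ℕ} (A : GL (Fin n) F)
    (σ : Equiv.Perm (Fin n)) : Prop :=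
  ∀ i j, i ≠ σ j → (A : Matrix (Fin n) (Fin n) F) i j = 0

/-- the space of equivariant linear maps between two representations. -/
def equivariantMaps {G V W : Type*} [Group G] [AddCommGroup V] [Module ℂ V]
    [AddCommGroup W] [Module ℂ W]
    (π : Representation ℂ G V) (π' : Representation ℂ G W) : Submodule ℂ (V →ₗ[ℂ] W) where
  carrier := {T | ∀ (g : G) (v : V), T (π g v) = π' g (T v)}
  add_mem' := by
    intro T S hT hS g v
    simp [hT g v, hS g v]
  zero_mem' := by intro g v; simp
  smul_mem' := by
    intro c T hT g v
    simp [hT g v]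

/-- a representation is self-dual -/
def SelfDual {G V : Type*} [Group G] [AddCommGroup V] [Module ℂ V]
    (π : Representation ℂ G V) : Prop :=
  RepIso π π.dual

/-- `π` occurs as a subrepresentation of `ξ`. -/
def OccursIn {G V W : Type*} [Group G] [AddCommGroup V] [Module ℂ V]
    [AddCommGroup W] [Module ℂ W]
    (π : Representation ℂ G V) (ξ : Representation ℂ G W) : Prop :=
  ∃ ι : V →ₗ[ℂ] W, Function.Injective ι ∧ ∀ (g : G) (v : V), ι (π g v) = ξ g (ι v)

/-- the canonical identification `GL_a(F) ≅ GL_b(F)` for `a = b`. -/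
def castGL {F : Type*} [Field F] {a b : ℕ} (h : a = b) : GL (Fin a) F ≃* GL (Fin b) F :=
  Units.mapEquiv (Matrix.reindexAlgEquiv F F (finCongr h)).toRingEquiv.toMulEquiv

/-- `π` is a `ρ`-primary representation: it occurs in the `c`-fold parabolic
induction `ρ × ρ × ⋯ × ρ`. -/
def IsPrimary {F : Type*} [Field F] {r c : ℕ} {V W : Type*}
    [AddCommGroup V] [Module ℂ V] [AddCommGroup W] [Module ℂ W]
    (ρ : Representation ℂ (GL (Fin r) F) V)
    (π : Representation ℂ (GL (Fin (r * c)) F) W) : Prop :=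
  ∃ (f : Fin (r * c) → Fin c) (e : ∀ _ : Fin c, Fin r → Fin (r * c))
    (_ : Monotone f) (he : ∀ a, StrictMono (e a))
    (hmem : ∀ a i, f (e a i) = a) (hsurj : ∀ a j, f j = a → ∃ i, e a i = j),
    OccursIn π (parabolicInd f e (fun a => (he a).injective) hmem hsurj (fun _ => ρ))

section HeckeAlgebra

/-- A family `t` in a ring satisfying quadratic, commutation and braid relations relative to an
idempotent `e`. -/
structure HeckeFamily {A : Type*} [Ring A] [Algebra ℂ A] (e : A) (t : ℕ → A) : Prop where
  idem : e * e = e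
  left_id : ∀ i, e * t i = t i
  right_id : ∀ i, t i * e = t i
  quad : ∀ i, t i * t i ∈ Submodule.span ℂ {e, t i}
  comm : ∀ i j, i + 2 ≤ j → t i * t j = t j * t i
  braid : ∀ i, t i * t (i + 1) * t i = t (i + 1) * t i * t (i + 1)

/-- The span of the words in the generators with index less than `k`. -/
def wordSpan {A : Type*} [Ring A] [Algebra ℂ A] (e : A) (t : ℕ → A) (k : ℕ) : Submodule ℂ A :=
  Submodule.span ℂ {x | ∃ l : List ℕ, (∀ i ∈ l, i < k) ∧ x = (l.map t).prod * e}

namespace HeckeFamily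

variable {A : Type*} [Ring A] [Algebra ℂ A] {e : A} {t : ℕ → A}

theorem e_mem (k : ℕ) : e ∈ wordSpan e t k :=
  Submodule.subset_span ⟨[], by simp, by simp⟩

theorem wordSpan_mono {k l : ℕ} (h : k ≤ l) : wordSpan e t k ≤ wordSpan e t l :=
  Submodule.span_mono fun _ ⟨w, hw, hx⟩ => ⟨w, fun i hi => (hw i hi).trans_le h, hx⟩

theorem gen_mul_mem {k i : ℕ} (hi : i < k) {x : A} (hx : x ∈ wordSpan e t k) :
    t i * x ∈ wordSpan e t k := by
  refine Submodule.span_induction ?_ ?_ ?_ ?_ hx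
  · rintro _ ⟨l, hl, rfl⟩
    refine Submodule.subset_span ⟨i :: l, ?_, by simp [mul_assoc]⟩
    simpa using ⟨hi, hl⟩
  · simp
  · intro x y _ _ hx hy
    rw [mul_add]; exact add_mem hx hy
  · intro c x _ hx
    rw [mul_smul_comm]; exact Submodule.smul_mem _ _ hx

/-- Induction principle: a submodule containing `e` and stable under the generators contains the
word span. -/
theorem wordSpan_le {k : ℕ} {M : Submodule ℂ A} (he : e ∈ M)
    (ht : ∀ i < k, ∀ x ∈ M, t i * x ∈ M) : wordSpan e t k ≤ M := by
  refine Submodule.span_le.mpr ?_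
  rintro _ ⟨l, hl, rfl⟩
  induction l with
  | nil => simpa using he
  | cons a l ih =>
    simp only [List.map_cons, List.prod_cons, mul_assoc]
    exact ht a (hl a (by simp)) _ (ih fun i hi => hl i (by simp [hi]))


theorem gen_mem (h : HeckeFamily e t) {k i : ℕ} (hi : i < k) : t i ∈ wordSpan e t k := by
  have := gen_mul_mem (t := t) hi (e_mem (e := e) k)
  rwa [h.right_id] at this

theorem e_mul (h : HeckeFamily e t) {k : ℕ} {x : A} (hx : x ∈ wordSpan e t k) : e * x = x := by
  have : wordSpan e t k ≤ LinearMap.eqLocus (LinearMap.mulLeft ℂ e) LinearMap.id :=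
    wordSpan_le (by simp [h.idem]) fun i _ x _ => by simp [← mul_assoc, h.left_id]
  simpa using this hx

theorem mul_e (h : HeckeFamily e t) {k : ℕ} {x : A} (hx : x ∈ wordSpan e t k) : x * e = x := by
  have : wordSpan e t k ≤ LinearMap.eqLocus (LinearMap.mulRight ℂ e) LinearMap.id :=
    wordSpan_le (by simp [h.idem]) fun i _ x hx => by
      simp only [LinearMap.mem_eqLocus, LinearMap.mulRight_apply, LinearMap.id_apply] at hx ⊢
      rw [mul_assoc, hx]
  simpa using this hx

theorem mul_mem (h : HeckeFamily e t) {k : ℕ} {x y : A} (hx : x ∈ wordSpan e t k) (hy : y ∈ wordSpan e t k) :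
    x * y ∈ wordSpan e t k := by
  have : wordSpan e t k ≤ (wordSpan e t k).comap (LinearMap.mulRight ℂ y) :=
    wordSpan_le (by simpa [h.e_mul hy] using hy) fun i hi x hx => by
      simp only [Submodule.mem_comap, LinearMap.mulRight_apply] at hx ⊢
      rw [mul_assoc]; exact gen_mul_mem hi hx
  exact this hx

theorem commute_of_gen {k : ℕ} {z : A} (hez : e * z = z * e) (hz : ∀ i < k, t i * z = z * t i)
    {x : A} (hx : x ∈ wordSpan e t k) : x * z = z * x := by
  have : wordSpan e t k ≤ LinearMap.eqLocus (LinearMap.mulRight ℂ z) (LinearMap.mulLeft ℂ z) :=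
    wordSpan_le (by simpa using hez) fun i hi x hx => by
      simp only [LinearMap.mem_eqLocus, LinearMap.mulRight_apply, LinearMap.mulLeft_apply] at hx ⊢
      rw [mul_assoc, hx, ← mul_assoc, hz i hi, mul_assoc]
  simpa using this hx

theorem sandwich (h : HeckeFamily e t) (k : ℕ) (hstep : ∀ b ∈ wordSpan e t k, t k * b * t k ∈
      wordSpan e t k ⊔ Submodule.span ℂ
        {x | ∃ b ∈ wordSpan e t k, ∃ c ∈ wordSpan e t k, x = b * t k * c}) :
    wordSpan e t (k + 1) ≤ wordSpan e t k ⊔ Submodule.span ℂ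
        {x | ∃ b ∈ wordSpan e t k, ∃ c ∈ wordSpan e t k, x = b * t k * c} := by
  set M := wordSpan e t k ⊔ Submodule.span ℂ
        {x | ∃ b ∈ wordSpan e t k, ∃ c ∈ wordSpan e t k, x = b * t k * c} with hM
  have hbc : ∀ b ∈ wordSpan e t k, ∀ c ∈ wordSpan e t k, b * t k * c ∈ M := fun b hb c hc =>
    Submodule.mem_sup_right (Submodule.subset_span ⟨b, hb, c, hc, rfl⟩)
  have hright : ∀ x ∈ M, ∀ c ∈ wordSpan e t k, x * c ∈ M := by
    intro x hx c hc
    suffices M ≤ M.comap (LinearMap.mulRight ℂ c) from this hx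
    refine sup_le (fun y hy => ?_) (Submodule.span_le.mpr ?_)
    · exact Submodule.mem_sup_left (h.mul_mem hy hc)
    · rintro _ ⟨b, hb, d, hd, rfl⟩
      show b * t k * d * c ∈ M
      rw [mul_assoc]; exact hbc _ hb _ (h.mul_mem hd hc)
  refine wordSpan_le (Submodule.mem_sup_left (e_mem k)) fun i hi x hx => ?_
  suffices M ≤ M.comap (LinearMap.mulLeft ℂ (t i)) from this hx
  rcases Nat.lt_succ_iff_lt_or_eq.mp hi with hi | rfl
  · refine sup_le (fun y hy => ?_) (Submodule.span_le.mpr ?_)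
    · exact Submodule.mem_sup_left (gen_mul_mem hi hy)
    · rintro _ ⟨b, hb, d, hd, rfl⟩
      show t i * (b * t k * d) ∈ M
      rw [← mul_assoc, ← mul_assoc]; exact hbc _ (gen_mul_mem hi hb) _ hd
  · refine sup_le (fun y hy => ?_) (Submodule.span_le.mpr ?_)
    · show t i * y ∈ M
      have := hbc e (e_mem _) y hy
      rwa [h.left_id] at this
    · rintro _ ⟨b, hb, d, hd, rfl⟩
      show t i * (b * t i * d) ∈ M
      rw [← mul_assoc, ← mul_assoc]
      exact hright _ (hstep b hb) _ hd

theorem quad_mem (h : HeckeFamily e t) (k : ℕ) {b c : A} (hb : b ∈ wordSpan e t k) (hc : c ∈ wordSpan e t k) :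
    b * (t k * t k) * c ∈ wordSpan e t k ⊔ Submodule.span ℂ
        {x | ∃ b ∈ wordSpan e t k, ∃ c ∈ wordSpan e t k, x = b * t k * c} := by
  obtain ⟨α, β, hαβ⟩ := Submodule.mem_span_pair.mp (h.quad k)
  rw [← hαβ, mul_add, add_mul, mul_smul_comm, mul_smul_comm, smul_mul_assoc, smul_mul_assoc,
    h.mul_e hb]
  exact add_mem (Submodule.mem_sup_left (Submodule.smul_mem _ _ (h.mul_mem hb hc)))
    (Submodule.mem_sup_right (Submodule.smul_mem _ _
      (Submodule.subset_span ⟨b, hb, c, hc, rfl⟩)))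

theorem wordSpan_succ (h : HeckeFamily e t) (k : ℕ) :
    wordSpan e t (k + 1) ≤ wordSpan e t k ⊔ Submodule.span ℂ
        {x | ∃ b ∈ wordSpan e t k, ∃ c ∈ wordSpan e t k, x = b * t k * c} := by
  induction k with
  | zero =>
    refine h.sandwich 0 fun b hb => ?_
    have hb0 : wordSpan e t 0 ≤ Submodule.span ℂ {e} :=
      wordSpan_le (Submodule.mem_span_singleton_self e) fun i hi => absurd hi (Nat.not_lt_zero i)
    obtain ⟨α, rfl⟩ := Submodule.mem_span_singleton.mp (hb0 hb)
    rw [mul_smul_comm, smul_mul_assoc, h.right_id]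
    refine Submodule.smul_mem _ _ ?_
    have := h.quad_mem 0 (e_mem 0) (e_mem 0)
    rwa [← mul_assoc, h.left_id, mul_assoc, h.right_id] at this
  | succ k ih =>
    refine h.sandwich (k + 1) fun b hb => ?_
    have hcomm : ∀ b ∈ wordSpan e t k, b * t (k + 1) = t (k + 1) * b := fun b hb =>
      commute_of_gen (by rw [h.left_id, h.right_id])
        (fun i hi => h.comm i (k + 1) (by omega)) hb
    set M := wordSpan e t (k + 1) ⊔ Submodule.span ℂ
        {x | ∃ b ∈ wordSpan e t (k + 1), ∃ c ∈ wordSpan e t (k + 1), x = b * t (k + 1) * c} with hM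
    suffices wordSpan e t k ⊔ Submodule.span ℂ
        {x | ∃ b ∈ wordSpan e t k, ∃ c ∈ wordSpan e t k, x = b * t k * c} ≤
        M.comap ((LinearMap.mulRight ℂ (t (k + 1))).comp (LinearMap.mulLeft ℂ (t (k + 1)))) from
      this (ih hb)
    have hm := wordSpan_mono (e := e) (t := t) (Nat.le_succ k)
    refine sup_le (fun y hy => ?_) (Submodule.span_le.mpr ?_)
    · show t (k + 1) * y * t (k + 1) ∈ M
      rw [← hcomm y hy, mul_assoc]
      have := h.quad_mem (k + 1) (hm hy) (e_mem _)
      rwa [← mul_assoc, mul_assoc _ _ e, h.right_id, mul_assoc] at this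
    · rintro _ ⟨b, hb, d, hd, rfl⟩
      show t (k + 1) * (b * t k * d) * t (k + 1) ∈ M
      have : t (k + 1) * (b * t k * d) * t (k + 1) =
          (b * t k) * t (k + 1) * (t k * d) := by
        calc _ = (t (k + 1) * b) * t k * (d * t (k + 1)) := by simp only [mul_assoc]
          _ = b * (t (k + 1) * t k * t (k + 1)) * d := by
            rw [hcomm d hd, ← hcomm b hb]; simp only [mul_assoc]
          _ = _ := by rw [← h.braid]; simp only [mul_assoc]
      rw [this]
      exact Submodule.mem_sup_right (Submodule.subset_span
        ⟨_, h.mul_mem (hm hb) (h.gen_mem (Nat.lt_succ_self k)), _,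
          gen_mul_mem (Nat.lt_succ_self k) (hm hd), rfl⟩)

theorem trace_sharp_mul (h : HeckeFamily e t) (S : A →ₗ[ℂ] A) (hSmul : ∀ a b, S (a * b) = S b * S a) (hSe : S e = e)
    (hSt : ∀ i, S (t i) = t i) (τ : A →ₗ[ℂ] ℂ) (hτ : ∀ a b, τ (a * b) = τ (b * a)) (k : ℕ) :
    ∀ z : A, e * z = z * e → (∀ i, i + 1 < k → t i * z = z * t i) →
      ∀ a ∈ wordSpan e t k, τ (S a * z) = τ (a * z) := by
  have hSmem : ∀ k, ∀ a ∈ wordSpan e t k, S a ∈ wordSpan e t k := by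
    intro k a ha
    suffices wordSpan e t k ≤ (wordSpan e t k).comap S from this ha
    refine wordSpan_le (by rw [Submodule.mem_comap, hSe]; exact e_mem k) fun i hi x hx => ?_
    show S (t i * x) ∈ wordSpan e t k
    rw [hSmul, hSt]
    exact h.mul_mem hx (h.gen_mem hi)
  induction k with
  | zero =>
    intro z _ _ a ha
    have hb0 : wordSpan e t 0 ≤ Submodule.span ℂ {e} :=
      wordSpan_le (Submodule.mem_span_singleton_self e) fun i hi => absurd hi (Nat.not_lt_zero i)
    obtain ⟨α, rfl⟩ := Submodule.mem_span_singleton.mp (hb0 ha)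
    rw [_root_.map_smul, hSe]
  | succ k ih =>
    intro z hez hz a ha
    have hcomm : ∀ b ∈ wordSpan e t k, b * z = z * b := fun b hb =>
      commute_of_gen hez (fun i hi => hz i (by omega)) hb
    have key : wordSpan e t k ⊔ Submodule.span ℂ
        {x | ∃ b ∈ wordSpan e t k, ∃ c ∈ wordSpan e t k, x = b * t k * c} ≤
        LinearMap.eqLocus (τ.comp ((LinearMap.mulRight ℂ z).comp S))
          (τ.comp (LinearMap.mulRight ℂ z)) := by
      refine sup_le (fun y hy => ?_) (Submodule.span_le.mpr ?_)
      · exact ih z hez (fun i hi => hz i (by omega)) y hy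
      · rintro _ ⟨b, hb, d, hd, rfl⟩
        show τ (S (b * t k * d) * z) = τ (b * t k * d * z)
        have h1 : τ (b * t k * d * z) = τ ((d * b) * (t k * z)) := by
          rw [mul_assoc _ d z, hcomm d hd, ← mul_assoc, hτ]
          simp only [mul_assoc]
        have h2 : τ (S (b * t k * d) * z) = τ (S (d * b) * (t k * z)) := by
          rw [hSmul, hSmul, hSmul, hSt]
          calc _ = τ (S d * t k * (S b * z)) := by simp only [mul_assoc]
            _ = τ ((S d * t k * z) * S b) := by
              rw [hcomm _ (hSmem k b hb)]; simp only [mul_assoc]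
            _ = _ := by rw [hτ]; simp only [mul_assoc]
        rw [h1, h2]
        refine ih (t k * z) ?_ ?_ _ (h.mul_mem hd hb)
        · rw [← mul_assoc, h.left_id, mul_assoc, ← hez, ← mul_assoc, h.right_id]
        · intro i hi
          rw [← mul_assoc, h.comm i k (by omega), mul_assoc, hz i (by omega), mul_assoc]
    exact key (h.wordSpan_succ k ha)

/-- A trace takes the same value on an element and on its image under an anti-involution fixing
the generators. -/
theorem trace_sharp (h : HeckeFamily e t) (S : A →ₗ[ℂ] A) (hSmul : ∀ a b, S (a * b) = S b * S a) (hSe : S e = e)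
    (hSt : ∀ i, S (t i) = t i) (τ : A →ₗ[ℂ] ℂ) (hτ : ∀ a b, τ (a * b) = τ (b * a)) {k : ℕ}
    {a : A} (ha : a ∈ wordSpan e t k) : τ (S a) = τ a := by
  simpa using h.trace_sharp_mul S hSmul hSe hSt τ hτ k 1 (by simp) (by simp) a ha

end HeckeFamily

end HeckeAlgebra

section Schur

theorem RepIso.trans {Γ X Y Z : Type*} [Group Γ] [AddCommGroup X] [Module ℂ X] [AddCommGroup Y]
    [Module ℂ Y] [AddCommGroup Z] [Module ℂ Z] {σ : Representation ℂ Γ X}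
    {τ : Representation ℂ Γ Y} {υ : Representation ℂ Γ Z} (h : RepIso σ τ) (h' : RepIso τ υ) :
    RepIso σ υ := by
  obtain ⟨e, he⟩ := h
  obtain ⟨e', he'⟩ := h'
  exact ⟨e.trans e', fun g v => by simp [he, he']⟩

variable {Γ X Y : Type*} [Group Γ] [AddCommGroup X] [Module ℂ X] [AddCommGroup Y]
    [Module ℂ Y] {σ : Representation ℂ Γ X} {τ : Representation ℂ Γ Y}

theorem IsIrred.injective_of_ne_zero (hσ : IsIrred σ) {T : X →ₗ[ℂ] Y}
    (hT : ∀ g v, T (σ g v) = τ g (T v)) (h0 : T ≠ 0) : Function.Injective T := by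
  rcases hσ.2 (LinearMap.ker T) (fun g v hv => by
    rw [LinearMap.mem_ker] at hv ⊢; rw [hT, hv, map_zero]) with h | h
  · exact LinearMap.ker_eq_bot.mp h
  · exact absurd (LinearMap.ker_eq_top.mp h) h0

theorem IsIrred.schur [FiniteDimensional ℂ X] (hσ : IsIrred σ) {T : X →ₗ[ℂ] X}
    (hT : ∀ g v, T (σ g v) = σ g (T v)) : ∃ c : ℂ, T = c • LinearMap.id := by
  obtain ⟨v, hv⟩ := hσ.1
  have : Nontrivial X := ⟨⟨v, 0, hv⟩⟩
  obtain ⟨c, hc⟩ := Module.End.exists_eigenvalue T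
  refine ⟨c, ?_⟩
  by_contra hne
  have hinj := hσ.injective_of_ne_zero (τ := σ) (T := T - c • LinearMap.id)
    (fun g v => by simp [hT]) (sub_ne_zero.mpr hne)
  obtain ⟨w, hw⟩ := hc.exists_hasEigenvector
  refine hw.2 (hinj ?_)
  simp [hw.apply_eq_smul]

variable [Fintype Γ]

theorem IsIrred.orthogonality [FiniteDimensional ℂ X] (hσ : IsIrred σ) (l l' : Module.Dual ℂ X)
    (w w' : X) : ∑ g, l (σ g⁻¹ w) * l' (σ g w') =
      ((Fintype.card Γ : ℂ) / (Module.finrank ℂ X : ℂ)) * (l w' * l' w) := by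
  let T : X →ₗ[ℂ] X := ∑ g, (l.comp (σ g⁻¹)).smulRight (σ g w')
  have hTv : ∀ v, T v = ∑ g, l (σ g⁻¹ v) • σ g w' := fun v => by
    simp [T, LinearMap.sum_apply]
  have hT : ∀ g v, T (σ g v) = σ g (T v) := by
    intro h v
    rw [hTv, hTv, map_sum]
    refine (Fintype.sum_equiv (Equiv.mulLeft h) _ _ fun g => ?_).symm
    simp only [Equiv.coe_mulLeft, _root_.map_smul, _root_.mul_inv_rev, _root_.map_mul,
      Module.End.mul_apply]
    congr 2
    rw [← Module.End.mul_apply (σ h⁻¹), ← _root_.map_mul, inv_mul_cancel, _root_.map_one,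
      Module.End.one_apply]
  obtain ⟨c, hc⟩ := hσ.schur hT
  have hd : (Module.finrank ℂ X : ℂ) ≠ 0 := by
    obtain ⟨v, hv⟩ := hσ.1
    have : Nontrivial X := ⟨⟨v, 0, hv⟩⟩
    exact Nat.cast_ne_zero.mpr Module.finrank_pos.ne'
  have htr : LinearMap.trace ℂ X T = Fintype.card Γ * l w' := by
    have : ∀ g : Γ, LinearMap.trace ℂ X ((l.comp (σ g⁻¹)).smulRight (σ g w')) = l w' := by
      intro g
      rw [LinearMap.trace_smulRight, LinearMap.comp_apply,
        ← Module.End.mul_apply, ← _root_.map_mul, inv_mul_cancel, _root_.map_one,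
        Module.End.one_apply]
    simp [T, map_sum, this]
  rw [hc, _root_.map_smul, LinearMap.trace_id, smul_eq_mul] at htr
  have hcv : c = Fintype.card Γ * l w' / Module.finrank ℂ X := by
    rw [eq_div_iff hd, htr]
  have := congrArg l' (hTv w)
  rw [hc, map_sum] at this
  simp only [_root_.map_smul, LinearMap.smul_apply, LinearMap.id_apply, smul_eq_mul] at this
  rw [← this, hcv]
  ring

theorem IsIrred.sum_character_inv [FiniteDimensional ℂ X] (hσ : IsIrred σ) :
    ∑ g, LinearMap.trace ℂ X (σ g⁻¹) • σ g =
      ((Fintype.card Γ : ℂ) / (Module.finrank ℂ X : ℂ)) • LinearMap.id := by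
  let b := Module.finBasis ℂ X
  ext w'
  refine b.ext_elem fun i => ?_
  have htr : ∀ g, LinearMap.trace ℂ X (σ g) = ∑ j, b.coord j (σ g (b j)) := fun g => by
    rw [LinearMap.trace_eq_matrix_trace ℂ b]
    simp [Matrix.trace, LinearMap.toMatrix_apply]
  simp only [LinearMap.sum_apply, LinearMap.smul_apply, LinearMap.id_apply, map_sum,
    _root_.map_smul, Finsupp.coe_finsetSum, Finset.sum_apply, Finsupp.smul_apply, htr]
  simp only [Finset.sum_mul, smul_eq_mul]
  rw [Finset.sum_comm]
  have := fun j => hσ.orthogonality (b.coord j) (b.coord i) (b j) w'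
  simp only [Module.Basis.coord_apply] at this ⊢
  simp only [this]
  simp [Finsupp.single_apply]

theorem IsIrred.orthogonality_dual [FiniteDimensional ℂ X] (hσ : IsIrred σ)
    (hne : ¬ RepIso σ σ.dual) (l l' : Module.Dual ℂ X) (w w' : X) :
    ∑ g, l (σ g w) * l' (σ g w') = 0 := by
  let T : X →ₗ[ℂ] Module.Dual ℂ X := ∑ g, (l'.comp (σ g)).smulRight (l.comp (σ g))
  have hTv : ∀ v, T v = ∑ g, l' (σ g v) • l.comp (σ g) := fun v => by
    simp [T, LinearMap.sum_apply]
  have hT : ∀ g v, T (σ g v) = σ.dual g (T v) := by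
    intro h v
    rw [hTv, hTv, map_sum]
    refine Fintype.sum_equiv (Equiv.mulRight h) _ _ fun g => ?_
    ext x
    simp only [Equiv.coe_mulRight, _root_.map_smul, _root_.map_mul, Representation.dual_apply,
      Module.End.mul_apply, LinearMap.smul_apply, LinearMap.comp_apply, Module.Dual.transpose_apply]
    congr 2
    rw [← Module.End.mul_apply (σ h), ← _root_.map_mul, mul_inv_cancel, _root_.map_one,
      Module.End.one_apply]
  have h0 : T = 0 := by
    by_contra h0
    have hinj := hσ.injective_of_ne_zero hT h0
    exact hne ⟨LinearEquiv.ofInjectiveOfFinrankEq T hinj Subspace.dual_finrank_eq.symm,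
      fun g v => hT g v⟩
  have := congrArg (fun S => S w' w) h0
  simp only [hTv, LinearMap.sum_apply, LinearMap.smul_apply, LinearMap.comp_apply, smul_eq_mul,
    LinearMap.zero_apply] at this
  rw [← this]
  exact Finset.sum_congr rfl fun g _ => mul_comm _ _

theorem IsIrred.sum_character [FiniteDimensional ℂ X] (hσ : IsIrred σ)
    (hne : ¬ RepIso σ σ.dual) : ∑ g, LinearMap.trace ℂ X (σ g) • σ g = 0 := by
  let b := Module.finBasis ℂ X
  ext w'
  refine b.ext_elem fun i => ?_
  have htr : ∀ g, LinearMap.trace ℂ X (σ g) = ∑ j, b.coord j (σ g (b j)) := fun g => by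
    rw [LinearMap.trace_eq_matrix_trace ℂ b]
    simp [Matrix.trace, LinearMap.toMatrix_apply]
  simp only [LinearMap.sum_apply, LinearMap.smul_apply, map_sum,
    _root_.map_smul, Finsupp.coe_finsetSum, Finset.sum_apply, Finsupp.smul_apply, htr]
  simp only [Finset.sum_mul, smul_eq_mul]
  rw [Finset.sum_comm]
  have := fun j => hσ.orthogonality_dual hne (b.coord j) (b.coord i) (b j) w'
  simp only [Module.Basis.coord_apply] at this ⊢
  simp [this]

/-- An irreducible representation is isomorphic to any representation of the same dimension
sharing a nonzero matrix coefficient. -/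
theorem IsIrred.repIso_of_coeff [FiniteDimensional ℂ X] [FiniteDimensional ℂ Y] (hσ : IsIrred σ)
    (hXY : Module.finrank ℂ X = Module.finrank ℂ Y)
    {l : Module.Dual ℂ X} {l' : Module.Dual ℂ Y} {v : X} {v' : Y}
    (h : ∀ g, l (σ g v) = l' (τ g v')) (h0 : l v ≠ 0) : RepIso σ τ := by
  let T : X →ₗ[ℂ] Y := ∑ g, (l.comp (σ g⁻¹)).smulRight (τ g v')
  have hTv : ∀ v, T v = ∑ g, l (σ g⁻¹ v) • τ g v' := fun v => by
    simp [T, LinearMap.sum_apply]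
  have hT : ∀ g v, T (σ g v) = τ g (T v) := by
    intro h v
    rw [hTv, hTv, map_sum]
    refine (Fintype.sum_equiv (Equiv.mulLeft h) _ _ fun g => ?_).symm
    simp only [Equiv.coe_mulLeft, _root_.map_smul, _root_.mul_inv_rev, _root_.map_mul,
      Module.End.mul_apply]
    congr 2
    rw [← Module.End.mul_apply (σ h⁻¹), ← _root_.map_mul, inv_mul_cancel, _root_.map_one,
      Module.End.one_apply]
  suffices hT0 : T ≠ 0 from
    ⟨LinearEquiv.ofInjectiveOfFinrankEq T (hσ.injective_of_ne_zero hT hT0) hXY, fun g v => hT g v⟩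
  intro hT0
  have h1 : l' (T v) = 0 := by rw [hT0]; simp
  rw [hTv, map_sum] at h1
  simp only [_root_.map_smul, smul_eq_mul, ← h] at h1
  rw [hσ.orthogonality] at h1
  have hd : (Module.finrank ℂ X : ℂ) ≠ 0 := by
    have : Nontrivial X := ⟨⟨v, 0, fun h => h0 (by rw [h, map_zero])⟩⟩
    exact Nat.cast_ne_zero.mpr Module.finrank_pos.ne'
  have hc : (Fintype.card Γ : ℂ) ≠ 0 := Nat.cast_ne_zero.mpr Fintype.card_ne_zero
  simp [hd, h0] at h1

end Schur

section BlockGroups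

variable {I K α : Type*} [Fintype I] [DecidableEq I] [Field K] [LinearOrder α]

/-- Strictly block upper triangular matrices. -/
def StrictBlock (h : I → α) (M : Matrix I I K) : Prop := ∀ i j, ¬ h i < h j → M i j = 0

theorem StrictBlock.mul_left {h : I → α} {M N : Matrix I I K} (hM : BlockTriangular M h)
    (hN : StrictBlock h N) : StrictBlock h (M * N) := by
  intro i j hij
  rw [Matrix.mul_apply]
  refine Finset.sum_eq_zero fun k _ => ?_
  by_cases hk : h k < h i
  · rw [hM hk, zero_mul]
  · rw [hN k j fun hkj => hij (lt_of_le_of_lt (not_lt.mp hk) hkj), mul_zero]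

theorem StrictBlock.mul_right {h : I → α} {M N : Matrix I I K} (hM : StrictBlock h M)
    (hN : BlockTriangular N h) : StrictBlock h (M * N) := by
  intro i j hij
  rw [Matrix.mul_apply]
  refine Finset.sum_eq_zero fun k _ => ?_
  by_cases hk : h j < h k
  · rw [hN hk, mul_zero]
  · rw [hM i k fun hik => hij (lt_of_lt_of_le hik (not_lt.mp hk)), zero_mul]

theorem StrictBlock.blockTriangular {h : I → α} {M : Matrix I I K} (hM : StrictBlock h M) :
    BlockTriangular M h := fun i j hij => hM i j (not_lt.mpr hij.le)

theorem StrictBlock.add {h : I → α} {M N : Matrix I I K} (hM : StrictBlock h M)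
    (hN : StrictBlock h N) : StrictBlock h (M + N) := fun i j hij => by
  rw [Matrix.add_apply, hM i j hij, hN i j hij, add_zero]

theorem StrictBlock.neg {h : I → α} {M : Matrix I I K} (hM : StrictBlock h M) :
    StrictBlock h (-M) := fun i j hij => by
  rw [Matrix.neg_apply, hM i j hij, neg_zero]

theorem StrictBlock.pow_eq_zero {c : ℕ} {h : I → Fin c} {M : Matrix I I K}
    (hM : StrictBlock h M) : M ^ c = 0 := by
  have key : ∀ k : ℕ, ∀ i j, (M ^ k) i j ≠ 0 → (h i : ℕ) + k ≤ h j := by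
    intro k
    induction k with
    | zero =>
      intro i j hij
      rw [pow_zero, Matrix.one_apply] at hij
      have : i = j := by by_contra hne; simp [hne] at hij
      simp [this]
    | succ k ih =>
      intro i j hij
      rw [pow_succ, Matrix.mul_apply] at hij
      obtain ⟨l, -, hl⟩ := Finset.exists_ne_zero_of_sum_ne_zero hij
      have h1 := ih i l (left_ne_zero_of_mul hl)
      have h2 : h l < h j := by
        by_contra hlt
        exact right_ne_zero_of_mul hl (hM l j hlt)
      have : (h l : ℕ) < h j := h2
      omega
  ext i j
  by_contra hne
  have := key c i j hne
  have := (h j).2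
  omega

/-- The group of invertible block upper triangular matrices. -/
def bpar (K : Type*) [Field K] (h : I → α) : Subgroup (GL I K) where
  carrier := {g | BlockTriangular (g : Matrix I I K) h}
  one_mem' := by simpa using blockTriangular_one
  mul_mem' := fun ha hb => by simpa using Matrix.BlockTriangular.mul ha hb
  inv_mem' := by
    intro g hg
    show BlockTriangular ((g⁻¹ : GL I K) : Matrix I I K) h
    rw [Matrix.coe_units_inv]
    have : Invertible (g : Matrix I I K) := g.invertible
    exact blockTriangular_inv_of_blockTriangular hg

theorem mem_bpar {h : I → α} {g : GL I K} :
    g ∈ bpar K h ↔ BlockTriangular (g : Matrix I I K) h := Iff.rfl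

/-- The group of block upper unipotent matrices. -/
def bunip (K : Type*) [Field K] (h : I → α) : Subgroup (GL I K) where
  carrier := {g | StrictBlock h ((g : Matrix I I K) - 1)}
  one_mem' := fun i j _ => by simp
  mul_mem' := by
    intro a b ha hb
    have hb' : BlockTriangular (b : Matrix I I K) h := by
      simpa using (StrictBlock.blockTriangular hb).add blockTriangular_one
    have : ((a * b : GL I K) : Matrix I I K) - 1 =
        ((a : Matrix I I K) - 1) * (b : Matrix I I K) + ((b : Matrix I I K) - 1) := by
      rw [Units.val_mul]; noncomm_ring
    show StrictBlock h _
    rw [this]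
    exact (StrictBlock.mul_right ha hb').add hb
  inv_mem' := by
    intro a ha
    have ha' : a ∈ bpar K h := by
      rw [mem_bpar]; simpa using (StrictBlock.blockTriangular ha).add blockTriangular_one
    have : ((a⁻¹ : GL I K) : Matrix I I K) - 1 =
        -(((a⁻¹ : GL I K) : Matrix I I K) * ((a : Matrix I I K) - 1)) := by
      rw [Matrix.mul_sub, ← Units.val_mul, inv_mul_cancel]; simp
    show StrictBlock h _
    rw [this]
    exact (StrictBlock.mul_left (mem_bpar.mp (inv_mem ha')) ha).neg

theorem mem_bunip {h : I → α} {g : GL I K} :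
    g ∈ bunip K h ↔ StrictBlock h ((g : Matrix I I K) - 1) := Iff.rfl

theorem mem_bunip_iff {h : I → α} {g : GL I K} :
    g ∈ bunip K h ↔ ∀ i j, ¬ h i < h j → (g : Matrix I I K) i j = (1 : Matrix I I K) i j := by
  simp only [mem_bunip, StrictBlock, Matrix.sub_apply, sub_eq_zero]

theorem bunip_le_bpar (h : I → α) : bunip K h ≤ bpar K h := fun g hg => by
  rw [mem_bpar]; simpa using (StrictBlock.blockTriangular (mem_bunip.mp hg)).add blockTriangular_one

theorem conj_mem_bunip {h : I → α} {p u : GL I K} (hp : p ∈ bpar K h) (hu : u ∈ bunip K h) :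
    p * u * p⁻¹ ∈ bunip K h := by
  have : ((p * u * p⁻¹ : GL I K) : Matrix I I K) - 1 =
      (p : Matrix I I K) * ((u : Matrix I I K) - 1) * ((p⁻¹ : GL I K) : Matrix I I K) := by
    rw [Matrix.mul_sub, Matrix.sub_mul, Matrix.mul_one, ← Units.val_mul, ← Units.val_mul,
      ← Units.val_mul, mul_inv_cancel, Units.val_one]
  rw [mem_bunip, this]
  exact (StrictBlock.mul_left hp hu).mul_right (mem_bpar.mp (inv_mem hp))

/-- Block unipotent groups over a finite field of odd cardinality have odd exponent. -/
theorem exists_odd_pow_bunip [Finite K] (hodd : Odd (Nat.card K)) (c : ℕ) :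
    ∃ k : ℕ, ∀ {J : Type} [Fintype J] [DecidableEq J] (h : J → Fin c), ∀ u ∈ bunip K h,
      u ^ (2 * k + 1) = 1 := by
  obtain ⟨p, hp⟩ := CharP.exists K
  have : Fintype K := Fintype.ofFinite K
  obtain ⟨n, hprime, hn⟩ := FiniteField.card K p
  have hpodd : Odd p := by
    rw [Nat.card_eq_fintype_card, hn] at hodd
    exact (Nat.odd_pow_iff n.pos.ne').mp hodd
  obtain ⟨k, hk⟩ := hpodd.pow (n := c)
  refine ⟨k, fun {J} _ _ h u hu => ?_⟩
  rw [← hk]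
  ext1
  rw [Units.val_pow_eq_pow_val, Units.val_one]
  have : Fact p.Prime := ⟨hprime⟩
  rcases isEmpty_or_nonempty J with hJ | hJ
  · exact Subsingleton.elim _ _
  have : CharP (Matrix J J K) p := inferInstance
  have h1 := add_pow_char_pow_of_commute p c (Commute.one_right ((u : Matrix J J K) - 1))
  rw [sub_add_cancel, one_pow] at h1
  rw [h1]
  have h2 : c ≤ p ^ c := (Nat.lt_pow_self hprime.one_lt).le
  rw [pow_eq_zero_of_le h2 (StrictBlock.pow_eq_zero (mem_bunip.mp hu)), zero_add]

end BlockGroups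

section PermMatrices

variable {I K : Type*} [Fintype I] [DecidableEq I] [Field K]

/-- Permutation matrices as a homomorphism into the general linear group. -/
def permGL (K : Type*) [Field K] : Equiv.Perm I →* GL I K :=
  MonoidHom.toHomUnits (M := Matrix I I K)
    { toFun := fun w => Matrix.of fun i j => if i = w j then (1 : K) else 0
      map_one' := by
        ext i j
        simp only [Matrix.of_apply, Equiv.Perm.one_apply, Matrix.one_apply]
        rfl
      map_mul' := fun w w' => by
        ext i j
        simp only [Matrix.mul_apply, Matrix.of_apply, Equiv.Perm.mul_apply, mul_ite, mul_one,
          mul_zero, Finset.sum_ite_eq', Finset.mem_univ, if_true]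
        rfl }

theorem permGL_apply (w : Equiv.Perm I) (i j : I) :
    (permGL K w : Matrix I I K) i j = if i = w j then 1 else 0 := rfl

theorem permGL_mul_apply (w : Equiv.Perm I) (M : Matrix I I K) (i j : I) :
    ((permGL K w : Matrix I I K) * M) i j = M (w⁻¹ i) j := by
  rw [Matrix.mul_apply, Finset.sum_eq_single (w⁻¹ i)]
  · simp [permGL_apply]
  · intro b _ hb
    rw [permGL_apply, if_neg, zero_mul]
    rintro rfl
    exact hb (by simp)
  · simp

theorem mul_permGL_apply (w : Equiv.Perm I) (M : Matrix I I K) (i j : I) :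
    (M * (permGL K w : Matrix I I K)) i j = M i (w j) := by
  rw [Matrix.mul_apply, Finset.sum_eq_single (w j)]
  · simp [permGL_apply]
  · intro b _ hb
    rw [permGL_apply, if_neg hb, mul_zero]
  · simp

theorem permGL_conj_apply (w : Equiv.Perm I) (g : GL I K) (i j : I) :
    ((permGL K w * g * (permGL K w)⁻¹ : GL I K) : Matrix I I K) i j =
      (g : Matrix I I K) (w⁻¹ i) (w⁻¹ j) := by
  rw [← _root_.map_inv, Units.val_mul, mul_permGL_apply, Units.val_mul, permGL_mul_apply]

end PermMatrices

section Bruhat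

variable {K : Type*} [Field K]

/-- `1 + N` for a strictly triangular `N` is unipotent. -/
theorem strictBlock_transvection_mem {n : ℕ} {N : Matrix (Fin n) (Fin n) K}
    (hN : StrictBlock id N) : ∃ u ∈ bunip K (id : Fin n → Fin n), (u : Matrix (Fin n) (Fin n) K) = 1 + N := by
  have hnil : IsNilpotent N := ⟨n, hN.pow_eq_zero⟩
  obtain ⟨u, hu⟩ := hnil.isUnit_one_add
  exact ⟨u, by rw [mem_bunip, hu, add_sub_cancel_left]; exact hN, hu⟩

theorem bruhat_aux {n : ℕ} (g : GL (Fin n) K) (k : ℕ) (hk : k ≤ n) :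
    ∃ u ∈ bunip K (id : Fin n → Fin n), ∃ u' ∈ bunip K (id : Fin n → Fin n),
      ∃ w : Fin n → Fin n, ∀ j : Fin n, (j : ℕ) < k →
        ((u * g * u' : GL (Fin n) K) : Matrix (Fin n) (Fin n) K) (w j) j ≠ 0 ∧
        (∀ i, i ≠ w j → ((u * g * u' : GL (Fin n) K) : Matrix (Fin n) (Fin n) K) i j = 0) ∧
        (∀ j', j' ≠ j → ((u * g * u' : GL (Fin n) K) : Matrix (Fin n) (Fin n) K) (w j) j' = 0) := by
  induction k with
  | zero => exact ⟨1, one_mem _, 1, one_mem _, id, fun j hj => absurd hj (Nat.not_lt_zero _)⟩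
  | succ k ih =>
    obtain ⟨u, hu, u', hu', w, hw⟩ := ih (by omega)
    set m := u * g * u' with hm
    let jk : Fin n := ⟨k, hk⟩
    classical
    have hex : (Finset.univ.filter fun i : Fin n => (m : Matrix (Fin n) (Fin n) K) i jk ≠ 0).Nonempty := by
      by_contra hemp
      rw [Finset.not_nonempty_iff_eq_empty, Finset.filter_eq_empty_iff] at hemp
      have hcol : ∀ i, (m : Matrix (Fin n) (Fin n) K) i jk = 0 := fun i => by simpa using hemp (Finset.mem_univ i)
      have h1 : ((m⁻¹ * m : GL (Fin n) K) : Matrix (Fin n) (Fin n) K) jk jk = 1 := by simp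
      rw [Units.val_mul, Matrix.mul_apply] at h1
      simp [hcol] at h1
    let i0 := (Finset.univ.filter fun i : Fin n => (m : Matrix (Fin n) (Fin n) K) i jk ≠ 0).max' hex
    have hi0 : (m : Matrix (Fin n) (Fin n) K) i0 jk ≠ 0 := by
      simpa using Finset.max'_mem _ hex
    have hmax : ∀ i, i0 < i → (m : Matrix (Fin n) (Fin n) K) i jk = 0 := by
      intro i hi
      by_contra hne
      exact absurd (Finset.le_max' (Finset.univ.filter fun i : Fin n => (m : Matrix (Fin n) (Fin n) K) i jk ≠ 0) i
        (by simpa using hne)) (not_le.mpr hi)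
    have hwi0 : ∀ j : Fin n, (j : ℕ) < k → w j ≠ i0 := fun j hj heq => by
      refine hi0 ?_
      rw [← heq]
      exact (hw j hj).2.2 jk (fun h => by rw [← h] at hj; exact lt_irrefl _ hj)
    have hrow : ∀ j : Fin n, (j : ℕ) < k → (m : Matrix (Fin n) (Fin n) K) i0 j = 0 := fun j hj =>
      (hw j hj).2.1 i0 (hwi0 j hj).symm
    obtain ⟨a, ha, haN⟩ := strictBlock_transvection_mem (K := K) (n := n)
      (N := Matrix.of fun i j => if j = i0 ∧ i < i0 then
        -((m : Matrix (Fin n) (Fin n) K) i jk / (m : Matrix (Fin n) (Fin n) K) i0 jk) else 0)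
      (fun i j hij => by
        simp only [Matrix.of_apply]
        rw [if_neg]
        rintro ⟨rfl, h⟩
        exact hij h)
    have hm1 : ∀ i j, ((a * m : GL (Fin n) K) : Matrix (Fin n) (Fin n) K) i j = (m : Matrix (Fin n) (Fin n) K) i j +
        if i < i0 then -((m : Matrix (Fin n) (Fin n) K) i jk / (m : Matrix (Fin n) (Fin n) K) i0 jk) *
          (m : Matrix (Fin n) (Fin n) K) i0 j else 0 := by
      intro i j
      rw [Units.val_mul, haN, Matrix.add_mul, Matrix.one_mul, Matrix.add_apply, Matrix.mul_apply,
        Finset.sum_eq_single i0]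
      · simp only [Matrix.of_apply, true_and, ite_mul, zero_mul]
      · intro b _ hb
        simp [hb]
      · simp
    set m1 := a * m with hm1def
    have hc1 : ∀ i, i ≠ i0 → (m1 : Matrix (Fin n) (Fin n) K) i jk = 0 := by
      intro i hi
      rw [hm1]
      rcases lt_or_gt_of_ne hi with h | h
      · rw [if_pos h]; field_simp; ring
      · rw [if_neg (not_lt.mpr h.le), hmax i h, add_zero]
    have hc2 : (m1 : Matrix (Fin n) (Fin n) K) i0 jk ≠ 0 := by
      rw [hm1, if_neg (lt_irrefl _), add_zero]; exact hi0
    have hc3 : ∀ i, ∀ j : Fin n, (j : ℕ) < k → (m1 : Matrix (Fin n) (Fin n) K) i j = (m : Matrix (Fin n) (Fin n) K) i j := by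
      intro i j hj
      rw [hm1, hrow j hj, mul_zero, ite_self, add_zero]
    have hc4 : ∀ j : Fin n, (j : ℕ) < k → ∀ j', (m1 : Matrix (Fin n) (Fin n) K) (w j) j' =
        (m : Matrix (Fin n) (Fin n) K) (w j) j' := by
      intro j hj j'
      rw [hm1, (hw j hj).2.2 jk (fun h => by rw [← h] at hj; exact lt_irrefl _ hj)]
      simp
    obtain ⟨b, hb, hbN⟩ := strictBlock_transvection_mem (K := K) (n := n)
      (N := Matrix.of fun i j => if i = jk ∧ jk < j then
        -((m1 : Matrix (Fin n) (Fin n) K) i0 j / (m1 : Matrix (Fin n) (Fin n) K) i0 jk) else 0)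
      (fun i j hij => by
        simp only [Matrix.of_apply]
        rw [if_neg]
        rintro ⟨rfl, h⟩
        exact hij h)
    have hm2 : ∀ i j, ((m1 * b : GL (Fin n) K) : Matrix (Fin n) (Fin n) K) i j = (m1 : Matrix (Fin n) (Fin n) K) i j +
        if jk < j then (m1 : Matrix (Fin n) (Fin n) K) i jk *
          -((m1 : Matrix (Fin n) (Fin n) K) i0 j / (m1 : Matrix (Fin n) (Fin n) K) i0 jk) else 0 := by
      intro i j
      rw [Units.val_mul, hbN, Matrix.mul_add, Matrix.mul_one, Matrix.add_apply, Matrix.mul_apply,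
        Finset.sum_eq_single jk]
      · simp only [Matrix.of_apply, true_and, mul_ite, mul_zero]
      · intro b _ hb
        simp [hb]
      · simp
    refine ⟨a * u, mul_mem ha hu, u' * b, mul_mem hu' hb, fun j => if (j : ℕ) < k then w j else i0,
      fun j hj => ?_⟩
    have hfin : a * u * g * (u' * b) = m1 * b := by
      rw [hm1def, hm]; group
    rw [hfin]
    rcases Nat.lt_succ_iff_lt_or_eq.mp hj with hj | hj
    · simp only [if_pos hj]
      have hjk : ¬ jk < j := fun h => by
        have : k < (j : ℕ) := h
        omega
      refine ⟨?_, fun i hi => ?_, fun j' hj' => ?_⟩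
      · rw [hm2, if_neg hjk, add_zero, hc3 _ j hj]; exact (hw j hj).1
      · rw [hm2, if_neg hjk, add_zero, hc3 _ j hj]; exact (hw j hj).2.1 i hi
      · rw [hm2, hc4 j hj, hc4 j hj, (hw j hj).2.2 j' hj',
          (hw j hj).2.2 jk (fun h => by rw [← h] at hj; exact lt_irrefl _ hj)]
        simp
    · have hjj : j = jk := Fin.ext hj
      subst hjj
      simp only [show ¬ ((jk : ℕ) < k) from lt_irrefl _, if_false]
      refine ⟨?_, fun i hi => ?_, fun j' hj' => ?_⟩
      · rw [hm2, if_neg (lt_irrefl _), add_zero]; exact hc2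
      · rw [hm2, if_neg (lt_irrefl _), add_zero]; exact hc1 i hi
      · rw [hm2]
        rcases lt_or_gt_of_ne hj' with h | h
        · rw [if_neg (not_lt.mpr h.le), hc3 _ j' h, hrow j' h, add_zero]
        · rw [if_pos h]; field_simp; ring

/-- Bruhat decomposition with unipotent factors and an explicit monomial matrix. -/
theorem bruhat {n : ℕ} (g : GL (Fin n) K) :
    ∃ u ∈ bunip K (id : Fin n → Fin n), ∃ u' ∈ bunip K (id : Fin n → Fin n),
      ∃ (m : GL (Fin n) K) (w : Equiv.Perm (Fin n)) (t : Fin n → K), (∀ j, t j ≠ 0) ∧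
        (∀ i j, (m : Matrix (Fin n) (Fin n) K) i j = if i = w j then t j else 0) ∧ g = u * m * u' := by
  obtain ⟨u, hu, u', hu', w, hw⟩ := bruhat_aux g n le_rfl
  have hinj : Function.Injective w := by
    intro j j' hjj
    by_contra hne
    refine (hw j j.2).1 ?_
    rw [hjj]
    exact (hw j' j'.2).2.2 j hne
  refine ⟨u⁻¹, inv_mem hu, u'⁻¹, inv_mem hu', u * g * u',
    Equiv.ofBijective w (Finite.injective_iff_bijective.mp hinj),
    fun j => ((u * g * u' : GL (Fin n) K) : Matrix (Fin n) (Fin n) K) (w j) j, fun j => (hw j j.2).1,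
    fun i j => ?_, by group⟩
  split_ifs with h
  · rw [h]; rfl
  · exact (hw j j.2).2.1 i h

end Bruhat

section Blocks

variable {c r : ℕ} {K : Type*} [Field K]

/-- The block upper triangular group for the block structure on `Fin c × Fin r`. -/
abbrev pblk (c r : ℕ) (K : Type*) [Field K] : Subgroup (GL (Fin c × Fin r) K) :=
  bpar K (Prod.fst : Fin c × Fin r → Fin c)

/-- The block unipotent group for the block structure on `Fin c × Fin r`. -/
abbrev ublk (c r : ℕ) (K : Type*) [Field K] : Subgroup (GL (Fin c × Fin r) K) :=
  bunip K (Prod.fst : Fin c × Fin r → Fin c)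

/-- The diagonal blocks of a block triangular matrix. -/
def dblk (a : Fin c) : pblk c r K →* GL (Fin r) K :=
  MonoidHom.toHomUnits (M := Matrix (Fin r) (Fin r) K)
    { toFun := fun p => ((p : GL (Fin c × Fin r) K) : Matrix (Fin c × Fin r) (Fin c × Fin r) K).submatrix (Prod.mk a) (Prod.mk a)
      map_one' := by
        ext i j
        simp [Matrix.one_apply]
      map_mul' := fun p p' => by
        ext i j
        rw [Matrix.submatrix_apply, Subgroup.coe_mul, Units.val_mul, Matrix.mul_apply,
          Fintype.sum_prod_type, Finset.sum_eq_single a]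
        · rw [Matrix.mul_apply]; rfl
        · intro b _ hb
          refine Finset.sum_eq_zero fun k _ => ?_
          rcases lt_or_gt_of_ne hb with h | h
          · rw [mem_bpar.mp p.2 (show ((b, k) : Fin c × Fin r).1 < (a, i).1 from h), zero_mul]
          · rw [mem_bpar.mp p'.2 (show ((a, j) : Fin c × Fin r).1 < (b, k).1 from h), mul_zero]
        · simp }

theorem dblk_apply (a : Fin c) (p : pblk c r K) (i j : Fin r) :
    (dblk a p : Matrix (Fin r) (Fin r) K) i j = ((p : GL (Fin c × Fin r) K) : Matrix (Fin c × Fin r) (Fin c × Fin r) K) (a, i) (a, j) := rfl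

theorem mem_ublk_iff {p : pblk c r K} :
    (p : GL (Fin c × Fin r) K) ∈ ublk c r K ↔ ∀ a, dblk a p = 1 := by
  rw [mem_bunip_iff]
  constructor
  · intro h a
    ext i j
    rw [dblk_apply, h (a, i) (a, j) (lt_irrefl _)]
    simp [Matrix.one_apply]
  · rintro h ⟨a, i⟩ ⟨b, j⟩ hab
    rcases (not_lt.mp hab).lt_or_eq with hlt | heq
    · rw [mem_bpar.mp p.2 hlt, Matrix.one_apply_ne]
      rintro h
      exact hlt.ne (congrArg Prod.fst h).symm
    · simp only at heq
      subst heq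
      rw [← dblk_apply, h]
      simp [Matrix.one_apply]

theorem dblk_of_mem_ublk {p : pblk c r K} (hp : (p : GL (Fin c × Fin r) K) ∈ ublk c r K)
    (a : Fin c) : dblk a p = 1 := mem_ublk_iff.mp hp a

/-- Block diagonal matrices. -/
def diagGL : (Fin c → GL (Fin r) K) →* GL (Fin c × Fin r) K :=
  MonoidHom.toHomUnits (M := Matrix (Fin c × Fin r) (Fin c × Fin r) K)
    { toFun := fun l => Matrix.of fun x y =>
        if x.1 = y.1 then (l x.1 : Matrix (Fin r) (Fin r) K) x.2 y.2 else 0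
      map_one' := by
        ext ⟨a, i⟩ ⟨b, j⟩
        by_cases h : a = b <;> simp [Matrix.one_apply, h]
      map_mul' := fun l l' => by
        ext ⟨a, i⟩ ⟨b, j⟩
        rw [Matrix.mul_apply, Fintype.sum_prod_type, Finset.sum_eq_single a]
        · by_cases h : a = b
          · subst h; simp [Matrix.mul_apply]
          · simp [h]
        · intro d _ hd
          simp [hd.symm]
        · simp }

theorem diagGL_apply (l : Fin c → GL (Fin r) K) (x y : Fin c × Fin r) :
    (diagGL l : Matrix (Fin c × Fin r) (Fin c × Fin r) K) x y = if x.1 = y.1 then (l x.1 : Matrix (Fin r) (Fin r) K) x.2 y.2 else 0 := rfl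

theorem diagGL_mem (l : Fin c → GL (Fin r) K) : diagGL l ∈ pblk c r K := fun x y hxy => by
  rw [diagGL_apply, if_neg (ne_of_gt hxy)]

theorem dblk_diagGL (l : Fin c → GL (Fin r) K) (a : Fin c) :
    dblk a ⟨diagGL l, diagGL_mem l⟩ = l a := by
  ext i j
  rw [dblk_apply, diagGL_apply, if_pos rfl]

/-- Block permutations. -/
def blockPerm (c r : ℕ) : Equiv.Perm (Fin c) →* Equiv.Perm (Fin c × Fin r) where
  toFun w := w.prodCongr (Equiv.refl _)
  map_one' := by ext x <;> rfl
  map_mul' w w' := by ext x <;> rfl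

theorem blockPerm_apply (w : Equiv.Perm (Fin c)) (x : Fin c × Fin r) :
    blockPerm c r w x = (w x.1, x.2) := rfl

/-- Block permutation matrices. -/
def bpermGL (c r : ℕ) (K : Type*) [Field K] : Equiv.Perm (Fin c) →* GL (Fin c × Fin r) K :=
  (permGL K).comp (blockPerm c r)

theorem bpermGL_conj_apply (w : Equiv.Perm (Fin c)) (g : GL (Fin c × Fin r) K)
    (x y : Fin c × Fin r) :
    ((bpermGL c r K w * g * (bpermGL c r K w)⁻¹ : GL (Fin c × Fin r) K) : Matrix (Fin c × Fin r) (Fin c × Fin r) K) x y =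
      (g : Matrix (Fin c × Fin r) (Fin c × Fin r) K) (w⁻¹ x.1, x.2) (w⁻¹ y.1, y.2) := by
  rw [bpermGL, MonoidHom.comp_apply, permGL_conj_apply, ← _root_.map_inv]
  rfl

theorem bpermGL_mul_apply (w : Equiv.Perm (Fin c)) (g : Matrix (Fin c × Fin r) (Fin c × Fin r) K)
    (x y : Fin c × Fin r) :
    ((bpermGL c r K w : Matrix (Fin c × Fin r) (Fin c × Fin r) K) * g) x y = g (w⁻¹ x.1, x.2) y := by
  rw [bpermGL, MonoidHom.comp_apply, permGL_mul_apply, ← _root_.map_inv]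
  rfl

theorem mul_bpermGL_apply (w : Equiv.Perm (Fin c)) (g : Matrix (Fin c × Fin r) (Fin c × Fin r) K)
    (x y : Fin c × Fin r) :
    (g * (bpermGL c r K w : Matrix (Fin c × Fin r) (Fin c × Fin r) K)) x y = g x (w y.1, y.2) := by
  rw [bpermGL, MonoidHom.comp_apply, mul_permGL_apply]
  rfl

theorem dblk_bperm_conj (w : Equiv.Perm (Fin c)) (p p' : pblk c r K)
    (h : bpermGL c r K w * (p : GL (Fin c × Fin r) K) = p' * bpermGL c r K w) (a : Fin c) :
    dblk a p' = dblk (w⁻¹ a) p := by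
  have hp' : (p' : GL (Fin c × Fin r) K) = bpermGL c r K w * p * (bpermGL c r K w)⁻¹ := by
    rw [h, mul_inv_cancel_right]
  ext i j
  rw [dblk_apply, dblk_apply, hp', bpermGL_conj_apply]

theorem diagGL_bperm (w : Equiv.Perm (Fin c)) (l : Fin c → GL (Fin r) K) :
    bpermGL c r K w * diagGL l = diagGL (l ∘ w.symm) * bpermGL c r K w := by
  rw [← mul_inv_eq_iff_eq_mul]
  ext x y
  rw [bpermGL_conj_apply, diagGL_apply, diagGL_apply]
  simp

end Blocks

section Tensor

variable {c : ℕ} {ι : Type*} [Fintype ι] [DecidableEq ι]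

/-- The Kronecker product of a family of matrices. -/
def tens (A : Fin c → Matrix ι ι ℂ) : Matrix (Fin c → ι) (Fin c → ι) ℂ :=
  Matrix.of fun x y => ∏ a, A a (x a) (y a)

theorem tens_apply (A : Fin c → Matrix ι ι ℂ) (x y : Fin c → ι) :
    tens A x y = ∏ a, A a (x a) (y a) := rfl

theorem tens_mul (A B : Fin c → Matrix ι ι ℂ) : tens (A * B) = tens A * tens B := by
  ext x y
  simp only [Matrix.mul_apply, tens_apply, Pi.mul_apply, ← Finset.prod_mul_distrib]
  exact Fintype.prod_sum fun a k => A a (x a) k * B a k (y a)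

theorem tens_one : tens (1 : Fin c → Matrix ι ι ℂ) = 1 := by
  ext x y
  rw [tens_apply, Matrix.one_apply]
  split_ifs with h
  · subst h; simp
  · obtain ⟨a, ha⟩ := Function.ne_iff.mp h
    exact Finset.prod_eq_zero (Finset.mem_univ a) (by simp [ha])

theorem tens_transpose (A : Fin c → Matrix ι ι ℂ) : (tens A)ᵀ = tens fun a => (A a)ᵀ := rfl

theorem tens_mulSingle_mulVec (a : Fin c) (M : Matrix ι ι ℂ) (v : (Fin c → ι) → ℂ)
    (x : Fin c → ι) : (tens (Pi.mulSingle a M) *ᵥ v) x =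
      (M *ᵥ fun t => v (Function.update x a t)) (x a) := by
  simp only [Matrix.mulVec, dotProduct]
  rw [← Finset.sum_subset (Finset.subset_univ
    ((Finset.univ : Finset ι).map ⟨Function.update x a, Function.update_injective x a⟩))]
  · rw [Finset.sum_map]
    refine Finset.sum_congr rfl fun t _ => ?_
    simp only [Function.Embedding.coeFn_mk]
    rw [tens_apply, Finset.prod_eq_single a]
    · simp
    · intro b _ hb
      simp [hb]
    · simp
  · intro y _ hy
    rw [tens_apply]
    have : ∃ b, b ≠ a ∧ x b ≠ y b := by
      by_contra! hall
      refine hy (Finset.mem_map.mpr ⟨y a, Finset.mem_univ _, ?_⟩)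
      ext b
      by_cases hb : b = a
      · subst hb; simp
      · simp [hb, hall b hb]
    obtain ⟨b, hb, hxy⟩ := this
    rw [Finset.prod_eq_zero (Finset.mem_univ b), zero_mul]
    simp [hb, hxy]

/-- Permutation of tensor factors. -/
def permTens (ι : Type*) [Fintype ι] [DecidableEq ι] :
    Equiv.Perm (Fin c) →* Matrix (Fin c → ι) (Fin c → ι) ℂ where
  toFun w := Matrix.of fun x y => if x ∘ w = y then 1 else 0
  map_one' := by
    ext x y
    simp [Matrix.one_apply]
  map_mul' w w' := by
    ext x y
    rw [Matrix.mul_apply, Finset.sum_eq_single (x ∘ w)]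
    · simp only [Matrix.of_apply, if_true, one_mul, Function.comp_assoc, Equiv.Perm.coe_mul]
      rfl
    · intro z _ hz
      simp [Ne.symm hz]
    · simp

theorem permTens_apply (w : Equiv.Perm (Fin c)) (x y : Fin c → ι) :
    permTens ι w x y = if x ∘ w = y then 1 else 0 := rfl

theorem permTens_transpose (w : Equiv.Perm (Fin c)) :
    (permTens ι w)ᵀ = permTens ι w⁻¹ := by
  ext x y
  rw [Matrix.transpose_apply, permTens_apply, permTens_apply]
  congr 1
  rw [eq_iff_iff]
  constructor <;> rintro rfl <;> ext <;> simp

theorem permTens_mul_tens (w : Equiv.Perm (Fin c)) (A : Fin c → Matrix ι ι ℂ) :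
    permTens ι w * tens A = tens (A ∘ w.symm) * permTens ι w := by
  ext x y
  rw [Matrix.mul_apply, Matrix.mul_apply, Finset.sum_eq_single (x ∘ w),
    Finset.sum_eq_single (y ∘ w.symm)]
  · rw [permTens_apply, permTens_apply, if_pos rfl, if_pos (by ext; simp), one_mul, mul_one,
      tens_apply, tens_apply]
    refine Fintype.prod_equiv w _ _ fun a => ?_
    simp
  · intro z _ hz
    rw [permTens_apply, if_neg, mul_zero]
    rintro rfl
    exact hz (by ext; simp)
  · simp
  · intro z _ hz
    rw [permTens_apply, if_neg (Ne.symm hz), zero_mul]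
  · simp

end Tensor

section Sigma

variable {c r : ℕ} {K : Type*} [Field K] {ι : Type*} [Fintype ι] [DecidableEq ι]

/-- The inflation to the block triangular group of the tensor power of a matrix representation. -/
def sig (R : GL (Fin r) K →* Matrix ι ι ℂ) :
    pblk c r K →* Matrix (Fin c → ι) (Fin c → ι) ℂ where
  toFun p := tens fun a => R (dblk a p)
  map_one' := by
    simp only [_root_.map_one]
    exact tens_one
  map_mul' p p' := by
    simp only [_root_.map_mul]
    exact tens_mul _ _

theorem sig_apply (R : GL (Fin r) K →* Matrix ι ι ℂ) (p : pblk c r K) :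
    sig R p = tens fun a => R (dblk a p) := rfl

theorem sig_of_mem_ublk (R : GL (Fin r) K →* Matrix ι ι ℂ) {p : pblk c r K}
    (hp : (p : GL (Fin c × Fin r) K) ∈ ublk c r K) : sig R p = 1 := by
  rw [sig_apply]
  simp only [dblk_of_mem_ublk hp, _root_.map_one]
  exact tens_one

theorem permTens_sig (R : GL (Fin r) K →* Matrix ι ι ℂ) (w : Equiv.Perm (Fin c))
    (p p' : pblk c r K) (h : bpermGL c r K w * (p : GL (Fin c × Fin r) K) = p' * bpermGL c r K w) :
    permTens ι w * sig R p = sig R p' * permTens ι w := by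
  rw [sig_apply, permTens_mul_tens, sig_apply]
  congr 2
  ext1 a
  rw [dblk_bperm_conj w p p' h]
  rfl

theorem sig_mulSingle (R : GL (Fin r) K →* Matrix ι ι ℂ) (a : Fin c) (A : GL (Fin r) K) :
    sig R ⟨diagGL (Pi.mulSingle a A), diagGL_mem _⟩ = tens (Pi.mulSingle a (R A)) := by
  rw [sig_apply]
  congr 1
  ext1 b
  rw [dblk_diagGL]
  by_cases hb : b = a
  · subst hb; simp
  · simp [hb]

end Sigma

section CellVanishing

variable {c r : ℕ} {K : Type*} [Field K] {ι : Type*} [Fintype ι] [DecidableEq ι]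

theorem fst_finProdFinEquiv_symm_monotone :
    Monotone fun x : Fin (c * r) => (finProdFinEquiv.symm x : Fin c × Fin r).1 := by
  intro x y hxy
  simp only [finProdFinEquiv_symm_apply, Fin.le_def, Fin.coe_divNat]
  exact Nat.div_le_div_right hxy

theorem exists_perm_double_coset (g : GL (Fin c × Fin r) K) :
    ∃ p ∈ pblk c r K, ∃ p' ∈ pblk c r K, ∃ w : Equiv.Perm (Fin c × Fin r),
      g = p * permGL K w * p' := by
  let E : Matrix (Fin c × Fin r) (Fin c × Fin r) K ≃* Matrix (Fin (c * r)) (Fin (c * r)) K :=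
    (Matrix.reindexAlgEquiv K K finProdFinEquiv).toRingEquiv.toMulEquiv
  let Φ := Units.mapEquiv E
  have hΦ : ∀ (g : GL (Fin (c * r)) K) x y, ((Φ.symm g : GL (Fin c × Fin r) K) :
      Matrix (Fin c × Fin r) (Fin c × Fin r) K) x y =
      (g : Matrix (Fin (c * r)) (Fin (c * r)) K) (finProdFinEquiv x) (finProdFinEquiv y) := fun g x y => rfl
  obtain ⟨u, hu, u', hu', m, w, t, ht, hm, hg⟩ := bruhat (Φ g)
  have hmem : ∀ u ∈ bunip K (id : Fin (c * r) → Fin (c * r)), Φ.symm u ∈ pblk c r K := by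
    intro u hu x y hxy
    rw [hΦ]
    refine mem_bpar.mp (bunip_le_bpar _ hu) ?_
    by_contra hle
    have := fst_finProdFinEquiv_symm_monotone (c := c) (r := r) (not_lt.mp hle)
    simp only [id, Equiv.symm_apply_apply] at this
    exact absurd hxy (not_lt.mpr this)
  let w' : Equiv.Perm (Fin c × Fin r) := (finProdFinEquiv.trans w).trans finProdFinEquiv.symm
  let d : GL (Fin c × Fin r) K := Φ.symm m * (permGL K w')⁻¹
  have hd : ∀ x y, (d : Matrix (Fin c × Fin r) (Fin c × Fin r) K) x y = if x = y then t (finProdFinEquiv (w'⁻¹ y)) else 0 := by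
    intro x y
    rw [show d = Φ.symm m * permGL K w'⁻¹ by rw [_root_.map_inv], Units.val_mul,
      mul_permGL_apply, hΦ, hm]
    refine if_congr ?_ rfl rfl
    have hw' : ∀ z, finProdFinEquiv (w' z) = w (finProdFinEquiv z) := fun z =>
      finProdFinEquiv.apply_symm_apply _
    rw [← hw', show w' (w'⁻¹ y) = y from w'.apply_symm_apply y, EmbeddingLike.apply_eq_iff_eq]
  refine ⟨Φ.symm u * d, mul_mem (hmem u hu) ?_, Φ.symm u', hmem u' hu', w', ?_⟩
  · intro x y hxy
    rw [hd, if_neg]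
    rintro rfl
    exact lt_irrefl _ hxy
  · apply Φ.injective
    rw [hg]
    simp [d, mul_assoc]

/-- Cuspidality of a matrix representation, with respect to maximal parabolics. -/
def MatCuspidal (R : GL (Fin r) K →* Matrix ι ι ℂ) : Prop :=
  ∀ f : Fin r → Fin 2, Monotone f → Function.Surjective f →
    ∀ v : ι → ℂ, (∀ A ∈ bunip K f, R A *ᵥ v = v) → v = 0

theorem permGL_mem_pblk {w : Equiv.Perm (Fin c × Fin r)} (hw : ∀ x, (w x).1 = x.1) :
    permGL K w ∈ pblk c r K := fun x y hxy => by
  rw [permGL_apply, if_neg]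
  rintro rfl
  rw [hw] at hxy
  exact lt_irrefl _ hxy

theorem cell_vanishing_sorted {R : GL (Fin r) K →* Matrix ι ι ℂ} (hR : MatCuspidal R)
    (w : Equiv.Perm (Fin c × Fin r)) (hmono : ∀ a, Monotone fun i => (w⁻¹ (a, i)).1) :
    (∃ p ∈ pblk c r K, ∃ u : Equiv.Perm (Fin c), permGL K w = p * bpermGL c r K u) ∨
    ∀ v : (Fin c → ι) → ℂ, (∀ n : pblk c r K,
      (permGL K w)⁻¹ * n * permGL K w ∈ ublk c r K → sig R n *ᵥ v = v) → v = 0 := by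
  by_cases hconst : ∀ a i j, (w⁻¹ (a, i)).1 = (w⁻¹ (a, j)).1
  · left
    rcases isEmpty_or_nonempty (Fin r) with hr | ⟨⟨i0⟩⟩
    · exact ⟨1, one_mem _, 1, Units.ext (Subsingleton.elim _ _)⟩
    let u : Fin c → Fin c := fun a => (w⁻¹ (a, i0)).1
    have hu : Function.Surjective u := fun d => ⟨(w (d, i0)).1, by
      simp only [u]
      rw [hconst _ i0 (w (d, i0)).2]
      simp⟩
    let e : Equiv.Perm (Fin c) := Equiv.ofBijective u (Finite.surjective_iff_bijective.mp hu)
    refine ⟨permGL K (w * blockPerm c r e), permGL_mem_pblk ?_, e⁻¹, ?_⟩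
    · rintro ⟨a, i⟩
      rw [Equiv.Perm.mul_apply, blockPerm_apply]
      apply (Finite.injective_iff_surjective.mpr hu)
      show (w⁻¹ ((w (e a, i)).1, i0)).1 = e a
      rw [hconst _ i0 (w (e a, i)).2]
      simp
    · rw [bpermGL, MonoidHom.comp_apply, ← _root_.map_mul, mul_assoc, ← _root_.map_mul,
        mul_inv_cancel, _root_.map_one, mul_one]
  · right
    intro v hv
    push Not at hconst
    obtain ⟨a, i0, i1, hlt⟩ : ∃ a i0 i1, (w⁻¹ (a, i0)).1 < (w⁻¹ (a, i1)).1 := by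
      obtain ⟨a, i, j, hij⟩ := hconst
      rcases lt_or_gt_of_ne hij with h | h
      · exact ⟨a, i, j, h⟩
      · exact ⟨a, j, i, h⟩
    let f : Fin r → Fin 2 := fun i => if (w⁻¹ (a, i0)).1 < (w⁻¹ (a, i)).1 then 1 else 0
    have hfmono : Monotone f := by
      intro i j hij
      simp only [f]
      split_ifs with h1 h2
      · exact le_rfl
      · exact absurd (h1.trans_le (hmono a hij)) h2
      · exact Fin.zero_le _
      · exact le_rfl
    have hfsurj : Function.Surjective f := by
      intro b
      fin_cases b
      · exact ⟨i0, by simp [f]⟩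
      · exact ⟨i1, if_pos hlt⟩
    funext x
    have hslice := hR f hfmono hfsurj (fun t => v (Function.update x a t)) fun A hA => by
      have h1 := hv ⟨diagGL (Pi.mulSingle a A), diagGL_mem _⟩ (by
        rw [mem_bunip_iff]
        intro x y hxy
        have := permGL_conj_apply w⁻¹ (diagGL (Pi.mulSingle a A)) x y
        rw [_root_.map_inv, inv_inv, inv_inv] at this
        rw [this, diagGL_apply]
        have hwx : ∀ z, (w⁻¹ ((w z).1, (w z).2)) = z := fun z => by simp
        have hone : (1 : Matrix (Fin c × Fin r) (Fin c × Fin r) K) x y =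
            (1 : Matrix (Fin c × Fin r) (Fin c × Fin r) K) (w x) (w y) := by
          simp [Matrix.one_apply]
        rw [hone]
        split_ifs with hxy1
        · by_cases hxa : (w x).1 = a
          · have hya : (w y).1 = a := hxy1 ▸ hxa
            rw [hxa, Pi.mulSingle_eq_same, mem_bunip_iff.mp hA]
            · simp only [Matrix.one_apply, Prod.ext_iff, hxa, hya, true_and]
            · intro hlt'
              refine hxy ?_
              have hfx : ¬ (w⁻¹ (a, i0)).1 < (w⁻¹ (a, (w x).2)).1 := by
                intro h
                simp only [f, if_pos h] at hlt'
                split_ifs at hlt' <;> revert hlt' <;> decide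
              have hfy : (w⁻¹ (a, i0)).1 < (w⁻¹ (a, (w y).2)).1 := by
                by_contra h
                simp only [f, if_neg h] at hlt'
                split_ifs at hlt' <;> revert hlt' <;> decide
              have := (not_lt.mp hfx).trans_lt hfy
              rwa [← hxa, hwx, hxa, ← hya, hwx] at this
          · rw [Pi.mulSingle_eq_of_ne hxa]
            simp only [Units.val_one, Matrix.one_apply, Prod.ext_iff, hxy1, true_and]
        · rw [Matrix.one_apply_ne fun h => hxy1 (congrArg Prod.fst h)])
      funext t
      have h2 := congrFun h1 (Function.update x a t)
      rw [sig_mulSingle, tens_mulSingle_mulVec] at h2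
      simpa using h2
    have := congrFun hslice (x a)
    simpa using this

/-- Outside the cells of block permutations, vectors fixed by the relevant subgroup vanish. -/
theorem cell_vanishing {R : GL (Fin r) K →* Matrix ι ι ℂ} (hR : MatCuspidal R)
    (g : GL (Fin c × Fin r) K) :
    (∃ p ∈ pblk c r K, ∃ p' ∈ pblk c r K, ∃ u : Equiv.Perm (Fin c),
      g = p * bpermGL c r K u * p') ∨
    ∀ v : (Fin c → ι) → ℂ, (∀ n : pblk c r K,
      g⁻¹ * n * g ∈ ublk c r K → sig R n *ᵥ v = v) → v = 0 := by
  obtain ⟨p, hp, p', hp', w, hg⟩ := exists_perm_double_coset g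
  let s : Equiv.Perm (Fin c × Fin r) :=
    Equiv.sigmaEquivProd (Fin c) (Fin r) |>.permCongr
      (Equiv.sigmaCongrRight fun a => Tuple.sort fun i => (w⁻¹ (a, i)).1)
  have hs : ∀ a i, s (a, i) = (a, Tuple.sort (fun i => (w⁻¹ (a, i)).1) i) := fun a i => rfl
  have hsmem : permGL K s ∈ pblk c r K := permGL_mem_pblk fun x => by
    obtain ⟨a, i⟩ := x
    rw [hs]
  set p1 := p * permGL K s with hp1
  have hp1m : p1 ∈ pblk c r K := mul_mem hp hsmem
  have hg1 : g = p1 * permGL K (s⁻¹ * w) * p' := by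
    rw [hg, hp1, _root_.map_mul, _root_.map_inv]; group
  rcases cell_vanishing_sorted hR (s⁻¹ * w) (fun a => by
    have := Tuple.monotone_sort fun i => (w⁻¹ (a, i)).1
    intro i j hij
    simp only [_root_.mul_inv_rev, inv_inv, Equiv.Perm.mul_apply, hs]
    exact this hij) with ⟨p2, hp2, u, hu⟩ | hvan
  · left
    exact ⟨p1 * p2, mul_mem hp1m hp2, p', hp', u, by rw [hg1, hu]; group⟩
  · right
    intro v hv
    have h1 := hvan (sig R ⟨p1, hp1m⟩⁻¹ *ᵥ v) fun n hn => by
      have h2 := hv (⟨p1, hp1m⟩ * n * ⟨p1, hp1m⟩⁻¹) (by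
        have := conj_mem_bunip (inv_mem hp') hn
        rw [hg1]
        convert this using 1
        simp only [Subgroup.coe_mul, Subgroup.coe_inv]
        group)
      calc sig R n *ᵥ sig R ⟨p1, hp1m⟩⁻¹ *ᵥ v
          = sig R ⟨p1, hp1m⟩⁻¹ *ᵥ (sig R (⟨p1, hp1m⟩ * n * ⟨p1, hp1m⟩⁻¹) *ᵥ v) := by
            rw [Matrix.mulVec_mulVec, Matrix.mulVec_mulVec, ← _root_.map_mul, ← _root_.map_mul]
            congr 2; group
        _ = _ := by rw [h2]
    have h3 : v = sig R ⟨p1, hp1m⟩ *ᵥ sig R ⟨p1, hp1m⟩⁻¹ *ᵥ v := by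
      rw [Matrix.mulVec_mulVec, ← _root_.map_mul, mul_inv_cancel, _root_.map_one, Matrix.one_mulVec]
    rw [h3, h1, Matrix.mulVec_zero]

end CellVanishing

section TensorSchur

variable {c : ℕ} {ι : Type*} [Fintype ι] [DecidableEq ι]

theorem tens_mulSingle_mul_apply (a : Fin c) (A : Matrix ι ι ℂ)
    (M : Matrix (Fin c → ι) (Fin c → ι) ℂ) (x y : Fin c → ι) :
    (tens (Pi.mulSingle a A) * M) x y = ∑ t, A (x a) t * M (Function.update x a t) y :=
  tens_mulSingle_mulVec a A (fun z => M z y) x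

theorem mul_tens_mulSingle_apply (a : Fin c) (A : Matrix ι ι ℂ)
    (M : Matrix (Fin c → ι) (Fin c → ι) ℂ) (x y : Fin c → ι) :
    (M * tens (Pi.mulSingle a A)) x y = ∑ t, M x (Function.update y a t) * A t (y a) := by
  have h : (tens (Pi.mulSingle a A))ᵀ = tens (Pi.mulSingle a Aᵀ) := by
    rw [tens_transpose]
    congr 1
    ext1 b
    by_cases hb : b = a
    · subst hb; simp
    · simp [hb]
  have := tens_mulSingle_mul_apply a Aᵀ Mᵀ y x
  rw [← h, ← Matrix.transpose_mul, Matrix.transpose_apply] at this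
  rw [this]
  exact Finset.sum_congr rfl fun t _ => mul_comm _ _

/-- Schur's lemma for tensor powers: a matrix commuting with every group element acting in any
single slot is scalar. -/
theorem scalar_of_commute_tens {Γ : Type*} {R : Γ → Matrix ι ι ℂ}
    (hR : ∀ N : Matrix ι ι ℂ, (∀ g, R g * N = N * R g) → ∃ z : ℂ, N = z • (1 : Matrix ι ι ℂ))
    {M : Matrix (Fin c → ι) (Fin c → ι) ℂ}
    (hM : ∀ a g, tens (Pi.mulSingle a (R g)) * M = M * tens (Pi.mulSingle a (R g))) :
    ∃ z : ℂ, M = z • (1 : Matrix (Fin c → ι) (Fin c → ι) ℂ) := by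
  have slot : ∀ (a : Fin c) (x y : Fin c → ι), ∃ z : ℂ, ∀ s t,
      M (Function.update x a s) (Function.update y a t) = if s = t then z else 0 := by
    intro a x y
    obtain ⟨z, hz⟩ := hR (Matrix.of fun s t => M (Function.update x a s) (Function.update y a t))
      (fun g => by
        ext s t
        have := congrFun (congrFun (hM a g) (Function.update x a s)) (Function.update y a t)
        rw [tens_mulSingle_mul_apply, mul_tens_mulSingle_apply] at this
        simpa [Matrix.mul_apply] using this)
    refine ⟨z, fun s t => ?_⟩
    have := congrFun (congrFun hz s) t
    simpa [Matrix.one_apply] using this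
  have off : ∀ x y, x ≠ y → M x y = 0 := by
    intro x y hxy
    obtain ⟨a, ha⟩ := Function.ne_iff.mp hxy
    obtain ⟨z, hz⟩ := slot a x y
    have := hz (x a) (y a)
    simpa [ha] using this
  have upd : ∀ x a s, M (Function.update x a s) (Function.update x a s) = M x x := by
    intro x a s
    obtain ⟨z, hz⟩ := slot a x x
    have h1 := hz s s
    have h2 := hz (x a) (x a)
    simp only [Function.update_eq_self, if_true] at h1 h2
    rw [h1, h2]
  have const : ∀ x y, M x x = M y y := by
    intro x y
    have : ∀ s : Finset (Fin c), M (s.piecewise x y) (s.piecewise x y) = M y y := by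
      intro s
      induction s using Finset.induction_on with
      | empty => simp
      | insert a s _ ih => rw [Finset.piecewise_insert, upd, ih]
    simpa using this Finset.univ
  by_cases hne : Nonempty (Fin c → ι)
  · obtain ⟨x0⟩ := hne
    refine ⟨M x0 x0, ?_⟩
    ext x y
    by_cases h : x = y
    · subst h; simp [const x x0]
    · simp [h, off x y h]
  · refine ⟨0, ?_⟩
    ext x
    exact absurd ⟨x⟩ hne

theorem permTens_mul_tens_const (w : Equiv.Perm (Fin c)) (B : Matrix ι ι ℂ) :
    permTens ι w * tens (fun _ => B) = tens (fun _ => B) * permTens ι w :=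
  permTens_mul_tens w _

end TensorSchur

section Hecke

open MonoidAlgebra

variable {c r : ℕ} {K : Type*} [Field K] [Fintype K] [DecidableEq K] {ι : Type*} [Fintype ι]
  [DecidableEq ι] (R : GL (Fin r) K →* Matrix ι ι ℂ)

instance : Fintype (pblk c r K) := Fintype.ofFinite _

/-- The group algebra of the general linear group with matrix coefficients. -/
abbrev MatGA (c r : ℕ) (K : Type*) [Field K] (ι : Type*) [Fintype ι] [DecidableEq ι] : Type _ :=
  MonoidAlgebra (Matrix (Fin c → ι) (Fin c → ι) ℂ) (GL (Fin c × Fin r) K)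

/-- Block triangular elements, twisted by the inflated representation. -/
def parEl : pblk c r K →* MatGA c r K ι where
  toFun p := single (p : GL (Fin c × Fin r) K) (sig R p)
  map_one' := by simp [one_def]
  map_mul' p p' := by simp [single_mul_single]

/-- Block permutations, twisted by permutation of tensor factors. -/
def permEl (c r : ℕ) (K : Type*) [Field K] (ι : Type*) [Fintype ι] [DecidableEq ι] :
    Equiv.Perm (Fin c) →* MatGA c r K ι where
  toFun w := single (bpermGL c r K w) (permTens ι w)
  map_one' := by simp [one_def]
  map_mul' w w' := by simp [single_mul_single]

theorem permEl_mul_parEl (w : Equiv.Perm (Fin c)) (p p' : pblk c r K)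
    (h : bpermGL c r K w * (p : GL (Fin c × Fin r) K) = p' * bpermGL c r K w) :
    permEl c r K ι w * parEl R p = parEl R p' * permEl c r K ι w := by
  simp only [permEl, parEl, MonoidHom.coe_mk, OneHom.coe_mk, single_mul_single, h,
    permTens_sig R w p p' h]

/-- The idempotent of the inflated representation. -/
def parIdem : MatGA c r K ι := ((Nat.card (pblk c r K) : ℂ)⁻¹) • ∑ p : pblk c r K, parEl R p

theorem parEl_mul_parIdem (p : pblk c r K) : parEl R p * parIdem R = parIdem R := by
  rw [parIdem, mul_smul_comm, Finset.mul_sum]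
  congr 1
  simp only [← _root_.map_mul]
  exact Fintype.sum_equiv (Equiv.mulLeft p) _ _ fun _ => rfl

theorem parIdem_mul_parEl (p : pblk c r K) : parIdem R * parEl R p = parIdem R := by
  rw [parIdem, smul_mul_assoc, Finset.sum_mul]
  congr 1
  simp only [← _root_.map_mul]
  exact Fintype.sum_equiv (Equiv.mulRight p) _ _ fun _ => rfl

theorem parIdem_mul_eq {a : MatGA c r K ι} (ha : ∀ p, parEl R p * a = a) :
    parIdem R * a = a := by
  have : (Nat.card (pblk c r K) : ℂ) ≠ 0 := Nat.cast_ne_zero.mpr Nat.card_pos.ne'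
  rw [parIdem, smul_mul_assoc, Finset.sum_mul, Finset.sum_congr rfl fun p _ => ha p,
    Finset.sum_const, Finset.card_univ, ← Nat.card_eq_fintype_card, ← Nat.cast_smul_eq_nsmul ℂ,
    smul_smul, inv_mul_cancel₀ this, one_smul]

theorem mul_parIdem_eq {a : MatGA c r K ι} (ha : ∀ p, a * parEl R p = a) :
    a * parIdem R = a := by
  have : (Nat.card (pblk c r K) : ℂ) ≠ 0 := Nat.cast_ne_zero.mpr Nat.card_pos.ne'
  rw [parIdem, mul_smul_comm, Finset.mul_sum, Finset.sum_congr rfl fun p _ => ha p,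
    Finset.sum_const, Finset.card_univ, ← Nat.card_eq_fintype_card, ← Nat.cast_smul_eq_nsmul ℂ,
    smul_smul, inv_mul_cancel₀ this, one_smul]

theorem parIdem_mul_self : parIdem R * parIdem R = (parIdem R : MatGA c r K ι) :=
  parIdem_mul_eq R (parEl_mul_parIdem R)

/-- Sandwiching absorbs a factor which is expressed through block triangular elements. -/
theorem parIdem_sandwich {x y : MatGA c r K ι}
    (h : ∀ p, parIdem R * x * parEl R p * y * parIdem R = parIdem R * (x * y) * parIdem R) :
    (parIdem R * x * parIdem R) * (parIdem R * y * parIdem R) =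
      parIdem R * (x * y) * parIdem R := by
  have h0 : (Nat.card (pblk c r K) : ℂ) ≠ 0 := Nat.cast_ne_zero.mpr Nat.card_pos.ne'
  calc (parIdem R * x * parIdem R) * (parIdem R * y * parIdem R)
      = parIdem R * x * (parIdem R * parIdem R) * y * parIdem R := by simp only [mul_assoc]
    _ = parIdem R * x * parIdem R * y * parIdem R := by rw [parIdem_mul_self]
    _ = ((Nat.card (pblk c r K) : ℂ)⁻¹) • ∑ p, parIdem R * x * parEl R p * y * parIdem R := by
        conv_lhs => rw [show (parIdem R * x * parIdem R : MatGA c r K ι) =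
          parIdem R * x * (((Nat.card (pblk c r K) : ℂ)⁻¹) • ∑ p : pblk c r K, parEl R p) from rfl]
        simp only [mul_smul_comm, smul_mul_assoc, Finset.mul_sum, Finset.sum_mul]
    _ = _ := by
        rw [Finset.sum_congr rfl fun p _ => h p, Finset.sum_const, Finset.card_univ,
          ← Nat.card_eq_fintype_card, ← Nat.cast_smul_eq_nsmul ℂ, smul_smul, inv_mul_cancel₀ h0,
          one_smul]

/-- The Hecke algebra element of a permutation. -/
def heckeEl (w : Equiv.Perm (Fin c)) : MatGA c r K ι :=
  parIdem R * permEl c r K ι w * parIdem R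

theorem heckeEl_one : heckeEl R (1 : Equiv.Perm (Fin c)) = (parIdem R : MatGA c r K ι) := by
  rw [heckeEl, _root_.map_one, mul_one, parIdem_mul_self]

theorem parIdem_mul_heckeEl (w : Equiv.Perm (Fin c)) :
    parIdem R * heckeEl R w = (heckeEl R w : MatGA c r K ι) := by
  rw [heckeEl, ← mul_assoc, ← mul_assoc, parIdem_mul_self]

theorem heckeEl_mul_parIdem (w : Equiv.Perm (Fin c)) :
    heckeEl R w * parIdem R = (heckeEl R w : MatGA c r K ι) := by
  rw [heckeEl, mul_assoc, parIdem_mul_self]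

theorem swap_lt_swap {a b : Fin c} (hab : (b : ℕ) = a + 1) {x y : Fin c} (hxy : y < x)
    (hne : ¬ (y = a ∧ x = b)) : Equiv.swap a b y < Equiv.swap a b x := by
  simp only [Fin.lt_def, Equiv.swap_apply_def, Fin.ext_iff] at *
  split_ifs <;> omega

/-- A block triangular matrix factors as one which stays block triangular after conjugation by an
adjacent block transposition, times a unipotent supported on a single block. -/
theorem exists_factor_swap {a b : Fin c} (hab : (b : ℕ) = a + 1) (p : pblk c r K)
    {w : Equiv.Perm (Fin c)} (hw : w⁻¹ a < w⁻¹ b) :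
    ∃ p1 p1' x x' : pblk c r K, p = p1 * x ∧
      bpermGL c r K (Equiv.swap a b) * (p1 : GL (Fin c × Fin r) K) =
        p1' * bpermGL c r K (Equiv.swap a b) ∧
      bpermGL c r K w * (x' : GL (Fin c × Fin r) K) = x * bpermGL c r K w := by
  have hlt : a < b := by rw [Fin.lt_def]; omega
  let N : Matrix (Fin c × Fin r) (Fin c × Fin r) K := Matrix.of fun i j =>
    if i.1 = a ∧ j.1 = b then ∑ k, ((dblk a p)⁻¹ : GL (Fin r) K).1 i.2 k *
      ((p : GL (Fin c × Fin r) K) : Matrix (Fin c × Fin r) (Fin c × Fin r) K) (a, k) (b, j.2) else 0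
  have hN : ∀ i j, ¬ (i.1 = a ∧ j.1 = b) → N i j = 0 := fun i j h => if_neg h
  have hNN : N * N = 0 := by
    ext i j
    rw [Matrix.mul_apply]
    refine Finset.sum_eq_zero fun k _ => ?_
    by_cases hk : k.1 = a
    · rw [hN i k fun h => hlt.ne (hk.symm.trans h.2), zero_mul]
    · rw [hN k j fun h => hk h.1, mul_zero]
  let x : GL (Fin c × Fin r) K := ⟨1 + N, 1 - N,
    by rw [Matrix.add_mul, Matrix.mul_sub N, hNN]; simp,
    by rw [Matrix.sub_mul, Matrix.mul_add N, hNN]; simp⟩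
  have hx1 : (x : Matrix (Fin c × Fin r) (Fin c × Fin r) K) = 1 + N := rfl
  have hx2 : ((x⁻¹ : GL (Fin c × Fin r) K) : Matrix (Fin c × Fin r) (Fin c × Fin r) K) = 1 - N := rfl
  have hxp : x ∈ pblk c r K := by
    intro i j hij
    rw [hx1, Matrix.add_apply, hN i j fun h => by rw [h.1, h.2] at hij; exact lt_asymm hlt hij,
      Matrix.one_apply_ne fun h => by rw [h] at hij; exact lt_irrefl _ hij, add_zero]
  have hxw : (bpermGL c r K w)⁻¹ * x * bpermGL c r K w ∈ pblk c r K := by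
    intro i j hij
    have := bpermGL_conj_apply w⁻¹ x i j
    rw [_root_.map_inv, inv_inv, inv_inv] at this
    rw [this, hx1, Matrix.add_apply, hN _ _ fun h => by
      have h1 : w⁻¹ a = i.1 := by rw [← h.1]; exact w.symm_apply_apply _
      have h2 : w⁻¹ b = j.1 := by rw [← h.2]; exact w.symm_apply_apply _
      rw [h1, h2] at hw; exact lt_asymm hw hij, add_zero, Matrix.one_apply_ne fun h => by
        have := w.injective (congrArg Prod.fst h)
        rw [this] at hij
        exact lt_irrefl _ hij]
  have hp1 : bpermGL c r K (Equiv.swap a b) * (p * x⁻¹) * (bpermGL c r K (Equiv.swap a b))⁻¹ ∈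
      pblk c r K := by
    have hmem : (p : GL (Fin c × Fin r) K) * x⁻¹ ∈ pblk c r K := mul_mem p.2 (inv_mem hxp)
    intro i j hij
    rw [bpermGL_conj_apply, Equiv.swap_inv]
    by_cases hcase : j.1 = a ∧ i.1 = b
    · rw [hcase.1, hcase.2, Equiv.swap_apply_left, Equiv.swap_apply_right, Units.val_mul, hx2,
        Matrix.mul_sub, Matrix.mul_one, Matrix.sub_apply, Matrix.mul_apply, Fintype.sum_prod_type,
        Finset.sum_eq_single a]
      · simp only [N, Matrix.of_apply, and_self, if_true]
        have h1 : ∀ M : Matrix (Fin r) (Fin r) K, ((dblk a p : Matrix (Fin r) (Fin r) K) *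
            (((dblk a p)⁻¹ : GL (Fin r) K) : Matrix (Fin r) (Fin r) K)) * M = M := by
          intro M
          rw [← Units.val_mul, mul_inv_cancel, Units.val_one, Matrix.one_mul]
        have h2 := congrFun (congrFun (h1 (Matrix.of fun k l =>
          ((p : GL (Fin c × Fin r) K) : Matrix (Fin c × Fin r) (Fin c × Fin r) K) (a, k) (b, l)))
          i.2) j.2
        rw [Matrix.mul_assoc, Matrix.mul_apply] at h2
        rw [sub_eq_zero]
        exact h2.symm
      · intro d _ hd
        refine Finset.sum_eq_zero fun k _ => ?_
        rw [hN _ _ fun h => hd h.1, mul_zero]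
      · simp
    · exact hmem (swap_lt_swap hab hij hcase)
  refine ⟨⟨_, mul_mem p.2 (inv_mem hxp)⟩, ⟨_, hp1⟩, ⟨x, hxp⟩, ⟨_, hxw⟩, ?_, ?_, ?_⟩
  · ext1; simp
  · simp
  · simp [mul_assoc]

theorem heckeEl_swap_mul {a b : Fin c} (hab : (b : ℕ) = a + 1)
    {w : Equiv.Perm (Fin c)} (hw : w⁻¹ a < w⁻¹ b) :
    heckeEl R (Equiv.swap a b) * heckeEl R w =
      (heckeEl R (Equiv.swap a b * w) : MatGA c r K ι) := by
  rw [heckeEl, heckeEl, parIdem_sandwich, heckeEl, _root_.map_mul]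
  intro p
  obtain ⟨p1, p1', x, x', rfl, h1, h2⟩ := exists_factor_swap hab p hw
  calc parIdem R * permEl c r K ι (Equiv.swap a b) * parEl R (p1 * x) * permEl c r K ι w * parIdem R
      = parIdem R * (permEl c r K ι (Equiv.swap a b) * parEl R p1) *
          (parEl R x * permEl c r K ι w) * parIdem R := by
        rw [_root_.map_mul]; simp only [mul_assoc]
    _ = parIdem R * parEl R p1' * (permEl c r K ι (Equiv.swap a b) * permEl c r K ι w) *
          (parEl R x' * parIdem R) := by
        rw [permEl_mul_parEl R _ _ _ h1, ← permEl_mul_parEl R _ _ _ h2]; simp only [mul_assoc]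
    _ = _ := by rw [parIdem_mul_parEl, parEl_mul_parIdem]

end Hecke

section Hecke

open MonoidAlgebra

variable {c r : ℕ} {K : Type*} [Field K] [Fintype K] [DecidableEq K] {ι : Type*} [Fintype ι]
  [DecidableEq ι] (R : GL (Fin r) K →* Matrix ι ι ℂ)

/-- Schur's lemma as a property of a matrix representation. -/
def MatSchur {Γ : Type*} [Group Γ] (R : Γ →* Matrix ι ι ℂ) : Prop :=
  ∀ N : Matrix ι ι ℂ, (∀ g, R g * N = N * R g) → ∃ z : ℂ, N = z • (1 : Matrix ι ι ℂ)

variable {R}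

theorem coeff_parEl_mul (p : pblk c r K) (a : MatGA c r K ι) (g : GL (Fin c × Fin r) K) :
    (parEl R p * a).coeff g = sig R p * a.coeff ((p : GL (Fin c × Fin r) K)⁻¹ * g) :=
  coeff_single_mul_apply _ _ _ _

theorem coeff_mul_parEl (p : pblk c r K) (a : MatGA c r K ι) (g : GL (Fin c × Fin r) K) :
    (a * parEl R p).coeff g = a.coeff (g * (p : GL (Fin c × Fin r) K)⁻¹) * sig R p :=
  coeff_mul_single_apply _ _ _ _

/-- The bi-equivariant elements are spanned by the elements attached to block permutations in their
support. -/
theorem mem_span_heckeEl (hc : MatCuspidal R) (hs : MatSchur R) {a : MatGA c r K ι}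
    (hl : ∀ p, parEl R p * a = a) (hr : ∀ p, a * parEl R p = a) :
    a ∈ Submodule.span ℂ {x | ∃ w, a.coeff (bpermGL c r K w) ≠ 0 ∧ x = heckeEl R w} := by
  have hl' : ∀ (p : pblk c r K) g, a.coeff (p * g) = sig R p * a.coeff g := by
    intro p g
    conv_lhs => rw [← hl p, coeff_parEl_mul, inv_mul_cancel_left]
  have hr' : ∀ (p : pblk c r K) g, a.coeff (g * p) = a.coeff g * sig R p := by
    intro p g
    conv_lhs => rw [← hr p, coeff_mul_parEl, mul_inv_cancel_right]
  have hsum : a = ∑ g ∈ a.coeff.support, parIdem R * single g (a.coeff g) * parIdem R := by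
    have h1 : a = ∑ g ∈ a.coeff.support, single g (a.coeff g) := (sum_coeff_single a).symm
    rw [← Finset.sum_mul, ← Finset.mul_sum, ← h1, parIdem_mul_eq R hl, mul_parIdem_eq R hr]
  have hcell : ∀ w, ∃ z : ℂ, a.coeff (bpermGL c r K w) = z • permTens ι w := by
    intro w
    obtain ⟨z, hz⟩ := scalar_of_commute_tens (c := c) hs
      (M := permTens ι w⁻¹ * a.coeff (bpermGL c r K w)) (fun b g => by
        let p : pblk c r K := ⟨diagGL (Pi.mulSingle b g), diagGL_mem _⟩
        let p' : pblk c r K := ⟨diagGL (Pi.mulSingle b g ∘ w.symm), diagGL_mem _⟩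
        have hpp : bpermGL c r K w * (p : GL (Fin c × Fin r) K) = p' * bpermGL c r K w := by
          rw [← mul_inv_eq_iff_eq_mul]
          ext x y
          rw [bpermGL_conj_apply, diagGL_apply, diagGL_apply]
          simp only [EmbeddingLike.apply_eq_iff_eq]
          rfl
        have hpp' : bpermGL c r K w⁻¹ * (p' : GL (Fin c × Fin r) K) = p * bpermGL c r K w⁻¹ := by
          rw [_root_.map_inv, inv_mul_eq_iff_eq_mul, ← mul_assoc, hpp, mul_inv_cancel_right]
        rw [← sig_mulSingle, ← mul_assoc, ← permTens_sig R _ _ _ hpp', mul_assoc, ← hl', ← hpp,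
          hr', mul_assoc])
    refine ⟨z, ?_⟩
    rw [← one_mul (a.coeff _), ← _root_.map_one (permTens ι), ← mul_inv_cancel w, _root_.map_mul,
      mul_assoc, hz, mul_smul_comm, mul_one]
  suffices h : (∑ g ∈ a.coeff.support, parIdem R * single g (a.coeff g) * parIdem R) ∈
      Submodule.span ℂ {x | ∃ w, a.coeff (bpermGL c r K w) ≠ 0 ∧ x = heckeEl R w} by
    rwa [← hsum] at h
  refine Submodule.sum_mem _ fun g hg => ?_
  have hg0 : a.coeff g ≠ 0 := Finsupp.mem_support_iff.mp hg
  rcases cell_vanishing hc g with ⟨p, hp, p', hp', w, rfl⟩ | hvan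
  · obtain ⟨z, hz⟩ := hcell w
    have hval : a.coeff (p * bpermGL c r K w * p') =
        sig R ⟨p, hp⟩ * (z • permTens ι w) * sig R ⟨p', hp'⟩ := by
      rw [← hz, ← hl', ← hr']
    have hw0 : a.coeff (bpermGL c r K w) ≠ 0 := by
      intro h0
      rw [hval, ← hz, h0] at hg0
      simp at hg0
    have hfac : (single (p * bpermGL c r K w * p') (a.coeff (p * bpermGL c r K w * p')) :
        MatGA c r K ι) = parEl R ⟨p, hp⟩ * (z • permEl c r K ι w) * parEl R ⟨p', hp'⟩ := by
      rw [hval]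
      simp only [parEl, permEl, MonoidHom.coe_mk, OneHom.coe_mk, MonoidAlgebra.smul_single, single_mul_single]
    rw [hfac]
    have : parIdem R * (parEl R ⟨p, hp⟩ * (z • permEl c r K ι w) * parEl R ⟨p', hp'⟩) * parIdem R =
        z • heckeEl R w := by
      calc _ = (parIdem R * parEl R ⟨p, hp⟩) * (z • permEl c r K ι w) *
              (parEl R ⟨p', hp'⟩ * parIdem R) := by simp only [mul_assoc]
        _ = _ := by
          rw [parIdem_mul_parEl, parEl_mul_parIdem, heckeEl, mul_smul_comm, smul_mul_assoc]
    rw [this]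
    exact Submodule.smul_mem _ _ (Submodule.subset_span ⟨w, hw0, rfl⟩)
  · exfalso
    refine hg0 ?_
    ext x y
    refine congrFun (hvan (fun x => a.coeff g x y) fun n hn => ?_) x
    have h1 := hl' n g
    have hU := bunip_le_bpar _ hn
    have h2 := hr' ⟨g⁻¹ * n * g, hU⟩ g
    rw [sig_of_mem_ublk R hn, mul_one] at h2
    have h3 : g * ((⟨g⁻¹ * n * g, hU⟩ : pblk c r K) : GL (Fin c × Fin r) K) = n * g := by
      simp only; group
    rw [h3, h1] at h2
    ext x'
    exact congrFun (congrFun h2 x') y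

/-- Elements supported in a subgroup. -/
def suppIn (c r : ℕ) (K : Type*) [Field K] (ι : Type*) [Fintype ι] [DecidableEq ι]
    (Q : Subgroup (GL (Fin c × Fin r) K)) : Subalgebra ℂ (MatGA c r K ι) where
  carrier := {a | ∀ g, a.coeff g ≠ 0 → g ∈ Q}
  add_mem' := by
    intro a b ha hb g hg
    by_contra hgQ
    have h1 := not_imp_comm.mp (ha g) hgQ
    have h2 := not_imp_comm.mp (hb g) hgQ
    simp [h1, h2] at hg
  mul_mem' := by
    intro a b ha hb g hg
    by_contra hgQ
    rw [coeff_mul_apply_left] at hg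
    refine hg (Finset.sum_eq_zero fun h hh => ?_)
    have hhQ := ha h (Finsupp.mem_support_iff.mp hh)
    have : b.coeff (h⁻¹ * g) = 0 := by
      by_contra h0
      exact hgQ (by simpa using mul_mem hhQ (hb _ h0))
    simp [this]
  algebraMap_mem' := by
    intro z g hg
    by_contra hgQ
    refine hg ?_
    have : (1 : GL (Fin c × Fin r) K) ≠ g := fun h => hgQ (h ▸ one_mem Q)
    rw [Algebra.algebraMap_eq_smul_one, coeff_smul_apply, one_def, coeff_single,
      Finsupp.single_eq_of_ne this.symm, smul_zero]

theorem single_mem_suppIn {Q : Subgroup (GL (Fin c × Fin r) K)} {g : GL (Fin c × Fin r) K}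
    (hg : g ∈ Q) (M : Matrix (Fin c → ι) (Fin c → ι) ℂ) :
    (single g M : MatGA c r K ι) ∈ suppIn c r K ι Q := by
  intro h hh
  by_contra hQ
  have : h ≠ g := fun e => hQ (e ▸ hg)
  rw [coeff_single, Finsupp.single_eq_of_ne this] at hh
  exact hh rfl

theorem heckeEl_mem_suppIn {Q : Subgroup (GL (Fin c × Fin r) K)} (hP : pblk c r K ≤ Q)
    {w : Equiv.Perm (Fin c)} (hw : bpermGL c r K w ∈ Q) :
    heckeEl R w ∈ suppIn c r K ι Q := by
  have he : parIdem R ∈ suppIn c r K ι Q :=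
    Subalgebra.smul_mem _ (Subalgebra.sum_mem _ fun p _ => single_mem_suppIn (hP p.2) _) _
  exact mul_mem (mul_mem he (single_mem_suppIn hw _)) he

theorem parEl_mul_heckeEl (p : pblk c r K) (w : Equiv.Perm (Fin c)) :
    parEl R p * heckeEl R w = (heckeEl R w : MatGA c r K ι) := by
  rw [heckeEl, ← mul_assoc, ← mul_assoc, parEl_mul_parIdem]

theorem heckeEl_mul_parEl (p : pblk c r K) (w : Equiv.Perm (Fin c)) :
    heckeEl R w * parEl R p = (heckeEl R w : MatGA c r K ι) := by
  rw [heckeEl, mul_assoc, parIdem_mul_parEl]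

/-- The map merging two adjacent blocks. -/
def mergeBlock (a : Fin c) (i : Fin c) : ℕ := if (i : ℕ) ≤ a then i else i - 1

theorem mergeBlock_mono (a : Fin c) : Monotone (mergeBlock a) := by
  intro i j hij
  simp only [mergeBlock, Fin.le_def] at *
  split_ifs <;> omega

theorem eq_one_or_swap_of_mergeBlock_le {a b : Fin c} (hab : (b : ℕ) = a + 1)
    {w : Equiv.Perm (Fin c)} (hw : ∀ i, mergeBlock a (w i) ≤ mergeBlock a i) :
    w = 1 ∨ w = Equiv.swap a b := by
  have hsum : ∑ i, mergeBlock a (w i) = ∑ i, mergeBlock a i := Equiv.sum_comp w _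
  have heq : ∀ i, mergeBlock a (w i) = mergeBlock a i := fun i =>
    (Finset.sum_eq_sum_iff_of_le fun i _ => hw i).mp hsum i (Finset.mem_univ i)
  have hfix : ∀ i, i ≠ a → i ≠ b → w i = i := by
    intro i hia hib
    have h1 := heq i
    simp only [mergeBlock, ne_eq, Fin.ext_iff] at *
    split_ifs at h1 <;> omega
  have hAB : ∀ i, i = a ∨ i = b → w i = a ∨ w i = b := by
    intro i hi
    have h1 := heq i
    simp only [mergeBlock, Fin.ext_iff] at *
    split_ifs at h1 <;> omega
  have hne : a ≠ b := fun h => by rw [h] at hab; omega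
  rcases hAB a (Or.inl rfl) with ha | ha
  · left
    ext1 i
    by_cases hia : i = a
    · rw [hia, ha]; rfl
    by_cases hib : i = b
    · rcases hAB b (Or.inr rfl) with hb | hb
      · exact absurd (w.injective (hb.trans ha.symm)) hne.symm
      · rw [hib, hb]; rfl
    · exact hfix i hia hib
  · right
    ext1 i
    by_cases hia : i = a
    · rw [hia, ha, Equiv.swap_apply_left]
    by_cases hib : i = b
    · rcases hAB b (Or.inr rfl) with hb | hb
      · rw [hib, hb, Equiv.swap_apply_right]
      · exact absurd (w.injective (hb.trans ha.symm)) hne.symm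
    · rw [hfix i hia hib, Equiv.swap_apply_of_ne_of_ne hia hib]

theorem heckeEl_swap_sq (hc : MatCuspidal R) (hs : MatSchur R) [NeZero r] {a b : Fin c}
    (hab : (b : ℕ) = a + 1) :
    heckeEl R (Equiv.swap a b) * heckeEl R (Equiv.swap a b) ∈
      Submodule.span ℂ {parIdem R, (heckeEl R (Equiv.swap a b) : MatGA c r K ι)} := by
  let h : Fin c × Fin r → ℕ := fun x => mergeBlock a x.1
  have hP : pblk c r K ≤ bpar K h := by
    intro p hp x y hxy
    refine mem_bpar.mp hp ?_
    by_contra hle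
    exact absurd hxy (not_lt.mpr (mergeBlock_mono a (not_lt.mp hle)))
  have hperm : ∀ w : Equiv.Perm (Fin c), (∀ i, mergeBlock a (w i) ≤ mergeBlock a i) →
      bpermGL c r K w ∈ bpar K h := by
    intro w hw x y hxy
    have := mul_bpermGL_apply w (1 : Matrix (Fin c × Fin r) (Fin c × Fin r) K) x y
    rw [Matrix.one_mul] at this
    rw [this, Matrix.one_apply_ne]
    rintro rfl
    exact absurd hxy (not_lt.mpr (hw y.1))
  have hs' : bpermGL c r K (Equiv.swap a b) ∈ bpar K h := hperm _ fun i => by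
    simp only [Equiv.swap_apply_def, mergeBlock]
    split_ifs <;> simp_all
  have hT := heckeEl_mem_suppIn (R := R) hP hs'
  refine Submodule.span_mono ?_ (mem_span_heckeEl hc hs
    (fun p => by rw [← mul_assoc, parEl_mul_heckeEl])
    (fun p => by rw [mul_assoc, heckeEl_mul_parEl]))
  rintro _ ⟨w, hw, rfl⟩
  have hwQ := mul_mem hT hT _ hw
  rcases eq_one_or_swap_of_mergeBlock_le hab (w := w) (fun i => by
    by_contra hlt
    have := mem_bpar.mp hwQ (show h (i, 0) < h (w i, 0) from not_le.mp hlt)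
    have h2 := mul_bpermGL_apply w (1 : Matrix (Fin c × Fin r) (Fin c × Fin r) K) (w i, 0) (i, 0)
    rw [Matrix.one_mul, this] at h2
    simp at h2) with rfl | rfl
  · left; exact heckeEl_one R
  · right; rfl

end Hecke

section Hecke

open MonoidAlgebra

variable {c r : ℕ} {K : Type*} [Field K] [Fintype K] [DecidableEq K] {ι : Type*} [Fintype ι]
  [DecidableEq ι]

/-- The generators of the Hecke algebra. -/
def heckeGen (R : GL (Fin r) K →* Matrix ι ι ℂ) (c i : ℕ) : MatGA c r K ι :=
  if h : i + 1 < c then heckeEl R (Equiv.swap ⟨i, by omega⟩ ⟨i + 1, h⟩) else 0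

variable {R : GL (Fin r) K →* Matrix ι ι ℂ}

theorem heckeGen_of_lt {i : ℕ} (h : i + 1 < c) :
    heckeGen R c i = heckeEl R (Equiv.swap ⟨i, by omega⟩ ⟨i + 1, h⟩) := dif_pos h

theorem heckeGen_of_not_lt {i : ℕ} (h : ¬ i + 1 < c) : heckeGen R c i = 0 := dif_neg h

theorem heckeGen_mul {i : ℕ} (h : i + 1 < c) {w : Equiv.Perm (Fin c)}
    (hw : w⁻¹ ⟨i, by omega⟩ < w⁻¹ ⟨i + 1, h⟩) :
    heckeGen R c i * heckeEl R w = heckeEl R (Equiv.swap ⟨i, by omega⟩ ⟨i + 1, h⟩ * w) := by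
  rw [heckeGen_of_lt h, heckeEl_swap_mul R rfl hw]

theorem heckeFamily (hc : MatCuspidal R) (hs : MatSchur R) [NeZero r] :
    HeckeFamily (parIdem R) (heckeGen R c) where
  idem := parIdem_mul_self R
  left_id i := by
    by_cases h : i + 1 < c
    · rw [heckeGen_of_lt h, parIdem_mul_heckeEl]
    · rw [heckeGen_of_not_lt h, mul_zero]
  right_id i := by
    by_cases h : i + 1 < c
    · rw [heckeGen_of_lt h, heckeEl_mul_parIdem]
    · rw [heckeGen_of_not_lt h, zero_mul]
  quad i := by
    by_cases h : i + 1 < c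
    · rw [heckeGen_of_lt h]
      exact heckeEl_swap_sq hc hs rfl
    · rw [heckeGen_of_not_lt h, zero_mul]
      exact zero_mem _
  comm i j hij := by
    by_cases hj : j + 1 < c
    · have hi : i + 1 < c := by omega
      conv_lhs => rw [heckeGen_of_lt hj]
      conv_rhs => rw [heckeGen_of_lt hi]
      rw [heckeGen_mul hi, heckeGen_mul hj]
      · congr 1
        refine (Equiv.Perm.Disjoint.commute fun x => ?_).eq
        simp only [Equiv.swap_apply_def, Fin.ext_iff]
        by_cases hx : (x : ℕ) = i ∨ (x : ℕ) = i + 1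
        · right
          rw [if_neg (by omega), if_neg (by omega)]
        · left
          rw [if_neg (by omega), if_neg (by omega)]
      · simp only [Equiv.swap_inv, Equiv.swap_apply_def, Fin.ext_iff]
        split_ifs <;> simp only [Fin.lt_def] <;> omega
      · simp only [Equiv.swap_inv, Equiv.swap_apply_def, Fin.ext_iff]
        split_ifs <;> simp only [Fin.lt_def] <;> omega
    · rw [heckeGen_of_not_lt hj, mul_zero, zero_mul]
  braid i := by
    by_cases h2 : i + 1 + 1 < c
    · have h1 : i + 1 < c := by omega
      rw [mul_assoc, mul_assoc, congrArg (fun z => heckeGen R c i * (heckeGen R c (i + 1) * z))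
        (heckeGen_of_lt h1), congrArg (fun z => heckeGen R c (i + 1) * (heckeGen R c i * z))
        (heckeGen_of_lt h2)]
      have n1 : (⟨i, by omega⟩ : Fin c) ≠ ⟨i + 1, h1⟩ := by simp
      have n2 : (⟨i + 1, h1⟩ : Fin c) ≠ ⟨i + 1 + 1, h2⟩ := by simp
      have l1 : (⟨i, by omega⟩ : Fin c) < ⟨i + 1, h1⟩ := by simp
      have l2 : (⟨i + 1, h1⟩ : Fin c) < ⟨i + 1 + 1, h2⟩ := by simp
      have n3 : (⟨i, by omega⟩ : Fin c) ≠ ⟨i + 1 + 1, h2⟩ := (l1.trans l2).ne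
      rw [heckeGen_mul h2, heckeGen_mul h1, heckeGen_mul h1, heckeGen_mul h2]
      · rw [← mul_assoc, ← mul_assoc, Equiv.swap_mul_swap_mul_swap n1 n3,
          Equiv.swap_comm ⟨i, by omega⟩ (⟨i + 1, h1⟩ : Fin c), Equiv.swap_comm (⟨i + 1, h1⟩ : Fin c) ⟨i + 1 + 1, h2⟩,
          Equiv.swap_mul_swap_mul_swap n2.symm n3.symm, Equiv.swap_comm]
      all_goals
        simp only [_root_.mul_inv_rev, Equiv.swap_inv, Equiv.Perm.mul_apply, Equiv.swap_apply_left,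
          Equiv.swap_apply_right, Equiv.swap_apply_of_ne_of_ne n3.symm n2.symm,
          Equiv.swap_apply_of_ne_of_ne n1 n3]
        first | exact l1 | exact l2 | exact l1.trans l2
    · rw [heckeGen_of_not_lt h2]; simp

theorem sum_mul_swap_lt {a b : Fin c} (hab : (b : ℕ) = a + 1) (f : Fin c → ℕ) (hf : f b < f a)
    (N : ℕ) (hN : ∀ i, f i ≤ N) :
    ∑ i : Fin c, (i : ℕ) * (N - f (Equiv.swap a b i)) < ∑ i : Fin c, (i : ℕ) * (N - f i) := by
  have hne : a ≠ b := fun h => by rw [h] at hab; omega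
  have key : ∀ g : Fin c → ℕ, ∑ i, g i = g a + g b + ∑ i ∈ (Finset.univ.erase a).erase b, g i := by
    intro g
    rw [← Finset.add_sum_erase _ _ (Finset.mem_univ a), ← Finset.add_sum_erase (Finset.univ.erase a) _
      (Finset.mem_erase.mpr ⟨hne.symm, Finset.mem_univ b⟩), add_assoc]
  rw [key, key fun i => (i : ℕ) * (N - f i), Equiv.swap_apply_left, Equiv.swap_apply_right]
  refine add_lt_add_of_lt_of_le ?_ (le_of_eq (Finset.sum_congr rfl fun i hi => ?_))
  · rw [hab]
    have := hN a
    obtain ⟨x, hx⟩ := Nat.exists_eq_add_of_lt hf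
    obtain ⟨y, hy⟩ := Nat.exists_eq_add_of_le this
    have e1 : N - f a = y := by omega
    have e2 : N - f b = y + x + 1 := by omega
    rw [e1, e2]
    nlinarith
  · simp only [Finset.mem_erase] at hi
    rw [Equiv.swap_apply_of_ne_of_ne hi.2.1 hi.1]

theorem strictMono_of_adjacent {X : Type*} [Preorder X] {f : Fin c → X}
    (h : ∀ (i : ℕ) (hi : i + 1 < c), f ⟨i, by omega⟩ < f ⟨i + 1, hi⟩) : StrictMono f := by
  rcases c with _ | c
  · exact fun x => x.elim0
  · exact Fin.strictMono_iff_lt_succ.mpr fun i => h i (by omega)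

theorem heckeEl_mem_wordSpan (w : Equiv.Perm (Fin c)) :
    heckeEl R w ∈ wordSpan (parIdem R) (heckeGen R c) c := by
  induction h : ∑ i : Fin c, (i : ℕ) * (c - (w⁻¹ i : ℕ)) using Nat.strong_induction_on generalizing w with
  | _ n ih =>
    subst h
    by_cases hd : ∃ (i : ℕ) (hi : i + 1 < c), w⁻¹ ⟨i + 1, hi⟩ < w⁻¹ ⟨i, by omega⟩
    · obtain ⟨i, hi, hlt⟩ := hd
      have hmul := heckeGen_mul (R := R) hi (w := Equiv.swap ⟨i, Nat.lt_of_succ_lt hi⟩ ⟨i + 1, hi⟩ * w)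
        (by
          rw [_root_.mul_inv_rev, Equiv.swap_inv, Equiv.Perm.mul_apply, Equiv.Perm.mul_apply,
            Equiv.swap_apply_left, Equiv.swap_apply_right]
          exact hlt)
      rw [← mul_assoc, Equiv.swap_mul_self, one_mul] at hmul
      rw [← hmul]
      refine HeckeFamily.gen_mul_mem (Nat.lt_of_succ_lt hi) (ih _ ?_ _ rfl)
      have := sum_mul_swap_lt (a := ⟨i, Nat.lt_of_succ_lt hi⟩) (b := ⟨i + 1, hi⟩) rfl
        (fun x => (w⁻¹ x : ℕ)) hlt c (fun x => (w⁻¹ x).2.le)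
      refine lt_of_eq_of_lt (Finset.sum_congr rfl fun x _ => ?_) this
      rw [_root_.mul_inv_rev, Equiv.swap_inv, Equiv.Perm.mul_apply]
    · push Not at hd
      have hmono : StrictMono (w⁻¹ : Equiv.Perm (Fin c)) := by
        refine strictMono_of_adjacent fun i hi => lt_of_le_of_ne (hd i hi) fun h => ?_
        have := w⁻¹.injective h
        simp [Fin.ext_iff] at this
      have : w = 1 := by
        rw [← inv_eq_one]
        ext1 i
        have h1 : (⇑(w⁻¹ : Equiv.Perm (Fin c))) = id := by
          exact hmono.range_inj strictMono_id |>.mp (by rw [Equiv.range_eq_univ, Set.range_id])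
        exact congrFun h1 i
      rw [this, heckeEl_one]
      exact HeckeFamily.e_mem c

/-- The anti-involution of the matrix group algebra attached to an invariant form. -/
def sharp (B B' : Matrix (Fin c → ι) (Fin c → ι) ℂ) : MatGA c r K ι →ₗ[ℂ] MatGA c r K ι where
  toFun a := ∑ g, single g⁻¹ (B' * (a.coeff g)ᵀ * B)
  map_add' a b := by
    rw [← Finset.sum_add_distrib]
    refine Finset.sum_congr rfl fun g _ => ?_
    rw [← MonoidAlgebra.single_add, coeff_add, Finsupp.add_apply, Matrix.transpose_add, Matrix.mul_add, Matrix.add_mul]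
  map_smul' z a := by
    rw [RingHom.id_apply, Finset.smul_sum]
    refine Finset.sum_congr rfl fun g _ => ?_
    rw [MonoidAlgebra.smul_single, coeff_smul_apply, Matrix.transpose_smul, Matrix.mul_smul,
      Matrix.smul_mul]

theorem sharp_single (B B' : Matrix (Fin c → ι) (Fin c → ι) ℂ) (g : GL (Fin c × Fin r) K)
    (M : Matrix (Fin c → ι) (Fin c → ι) ℂ) :
    sharp B B' (single g M : MatGA c r K ι) = single g⁻¹ (B' * Mᵀ * B) := by
  show ∑ h, _ = _
  rw [Finset.sum_eq_single g]
  · simp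
  · intro h _ hh
    rw [coeff_single, Finsupp.single_eq_of_ne hh]
    simp
  · simp

theorem sharp_mul {B B' : Matrix (Fin c → ι) (Fin c → ι) ℂ} (hB : B * B' = 1)
    (a b : MatGA c r K ι) : sharp B B' (a * b) = sharp B B' b * sharp B B' a := by
  induction a using MonoidAlgebra.induction_linear with
  | zero => simp
  | add x y hx hy => rw [add_mul, _root_.map_add, hx, hy, _root_.map_add, mul_add]
  | single g M =>
    induction b using MonoidAlgebra.induction_linear with
    | zero => simp
    | add x y hx hy => rw [mul_add, _root_.map_add, hx, hy, _root_.map_add, add_mul]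
    | single h N =>
      rw [single_mul_single, sharp_single, sharp_single, sharp_single, single_mul_single,
        _root_.mul_inv_rev, Matrix.transpose_mul]
      congr 1
      calc B' * (Nᵀ * Mᵀ) * B = B' * Nᵀ * 1 * Mᵀ * B := by simp only [Matrix.mul_assoc, Matrix.one_mul]
        _ = _ := by rw [← hB]; simp only [Matrix.mul_assoc]

/-- The twisted trace attached to a class function. -/
def twTrace (κ : GL (Fin c × Fin r) K → ℂ) : MatGA c r K ι →ₗ[ℂ] ℂ where
  toFun a := ∑ g, κ g * (a.coeff g).trace
  map_add' a b := by
    rw [← Finset.sum_add_distrib]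
    refine Finset.sum_congr rfl fun g _ => ?_
    rw [coeff_add, Finsupp.add_apply, Matrix.trace_add, mul_add]
  map_smul' z a := by
    rw [RingHom.id_apply, smul_eq_mul, Finset.mul_sum]
    refine Finset.sum_congr rfl fun g _ => ?_
    rw [coeff_smul_apply, Matrix.trace_smul, smul_eq_mul]; ring

theorem twTrace_apply (κ : GL (Fin c × Fin r) K → ℂ) (a : MatGA c r K ι) :
    twTrace κ a = ∑ g, κ g * (a.coeff g).trace := rfl

theorem twTrace_single (κ : GL (Fin c × Fin r) K → ℂ) (g : GL (Fin c × Fin r) K)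
    (M : Matrix (Fin c → ι) (Fin c → ι) ℂ) :
    twTrace κ (single g M : MatGA c r K ι) = κ g * M.trace := by
  rw [twTrace_apply, Finset.sum_eq_single g]
  · simp
  · intro h _ hh
    rw [coeff_single, Finsupp.single_eq_of_ne hh]
    simp
  · simp

theorem twTrace_mul_comm {κ : GL (Fin c × Fin r) K → ℂ} (hκ : ∀ g h, κ (g * h) = κ (h * g))
    (a b : MatGA c r K ι) : twTrace κ (a * b) = twTrace κ (b * a) := by
  induction a using MonoidAlgebra.induction_linear with
  | zero => simp
  | add x y hx hy => rw [add_mul, _root_.map_add, hx, hy, mul_add, _root_.map_add]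
  | single g M =>
    induction b using MonoidAlgebra.induction_linear with
    | zero => simp
    | add x y hx hy => rw [mul_add, _root_.map_add, hx, hy, add_mul, _root_.map_add]
    | single h N =>
      rw [single_mul_single, single_mul_single, twTrace_single, twTrace_single, hκ,
        Matrix.trace_mul_comm]

theorem twTrace_sharp {B B' : Matrix (Fin c → ι) (Fin c → ι) ℂ} (hB : B * B' = 1)
    (κ : GL (Fin c × Fin r) K → ℂ) (a : MatGA c r K ι) :
    twTrace κ (sharp B B' a) = twTrace (fun g => κ g⁻¹) a := by
  induction a using MonoidAlgebra.induction_linear with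
  | zero => simp
  | add x y hx hy => rw [_root_.map_add, _root_.map_add, hx, hy, _root_.map_add]
  | single g M =>
    rw [sharp_single, twTrace_single, twTrace_single, Matrix.trace_mul_comm, ← Matrix.mul_assoc, hB,
      Matrix.one_mul, Matrix.trace_transpose]

/-- An invariant bilinear form on a matrix representation. -/
structure InvForm {Γ : Type*} [Group Γ] (R : Γ →* Matrix ι ι ℂ) (B B' : Matrix ι ι ℂ) : Prop where
  mul_inv : B * B' = 1
  inv_mul : B' * B = 1
  inv : ∀ g, (R g)ᵀ * B = B * R g⁻¹

theorem twTrace_inv_eq (hc : MatCuspidal R) (hs : MatSchur R) [NeZero r] {B B' : Matrix ι ι ℂ}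
    (hB : InvForm R B B') {a : MatGA c r K ι}
    (hl : ∀ p, parEl R p * a = a) (hr : ∀ p, a * parEl R p = a)
    {κ : GL (Fin c × Fin r) K → ℂ} (hκ : ∀ g h, κ (g * h) = κ (h * g)) :
    twTrace (fun g => κ g⁻¹) a = twTrace κ a := by
  let S : MatGA c r K ι →ₗ[ℂ] MatGA c r K ι := sharp (tens fun _ => B) (tens fun _ => B')
  have hBB : tens (fun _ : Fin c => B) * tens (fun _ => B') = 1 := by
    rw [← tens_mul, ← tens_one]
    exact congrArg tens (funext fun _ => hB.mul_inv)
  have hBB' : tens (fun _ : Fin c => B') * tens (fun _ => B) = 1 := by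
    rw [← tens_mul, ← tens_one]
    exact congrArg tens (funext fun _ => hB.inv_mul)
  have hSp : ∀ p, S (parEl R p) = parEl R p⁻¹ := by
    intro p
    show sharp _ _ (MonoidAlgebra.single (p : GL (Fin c × Fin r) K) (sig R p)) =
      MonoidAlgebra.single ((p⁻¹ : pblk c r K) : GL (Fin c × Fin r) K) (sig R p⁻¹)
    rw [sharp_single]
    congr 1
    rw [sig_apply, tens_transpose, ← tens_mul, ← tens_mul, sig_apply]
    congr 1
    ext1 x
    simp only [Pi.mul_apply]
    rw [Matrix.mul_assoc, hB.inv, ← Matrix.mul_assoc, hB.inv_mul, Matrix.one_mul, _root_.map_inv (dblk x)]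
  have hSe : S (parIdem R) = parIdem R := by
    rw [parIdem, _root_.map_smul, _root_.map_sum]
    congr 1
    exact Fintype.sum_equiv (Equiv.inv _) _ _ hSp
  have hSm : ∀ w, S (permEl c r K ι w) = permEl c r K ι w⁻¹ := by
    intro w
    show sharp _ _ (MonoidAlgebra.single (bpermGL c r K w) (permTens ι w)) =
      MonoidAlgebra.single (bpermGL c r K w⁻¹) (permTens ι w⁻¹)
    rw [sharp_single, _root_.map_inv (bpermGL c r K), permTens_transpose, Matrix.mul_assoc,
      permTens_mul_tens_const, ← Matrix.mul_assoc, hBB', Matrix.one_mul]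
  have hSt : ∀ i, S (heckeGen R c i) = heckeGen R c i := by
    intro i
    by_cases h : i + 1 < c
    · rw [heckeGen_of_lt h, heckeEl, sharp_mul hBB, sharp_mul hBB, hSe, hSm, Equiv.swap_inv,
        mul_assoc]
    · rw [heckeGen_of_not_lt h, _root_.map_zero]
  have ha : a ∈ wordSpan (parIdem R) (heckeGen R c) c := by
    refine Submodule.span_le.mpr ?_ (mem_span_heckeEl hc hs hl hr)
    rintro _ ⟨w, _, rfl⟩
    exact heckeEl_mem_wordSpan w
  rw [← twTrace_sharp hBB]
  exact (heckeFamily hc hs).trace_sharp S (sharp_mul hBB) hSe hSt (twTrace κ)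
    (twTrace_mul_comm hκ) ha

/-- A constituent of the representation induced from the tensor power of a cuspidal representation
with an invariant form is self-dual. -/
theorem repIso_dual_of_invForm (hc : MatCuspidal R) (hs : MatSchur R) [NeZero r] {B B' : Matrix ι ι ℂ}
    (hB : InvForm R B B') {W : Type*} [AddCommGroup W] [Module ℂ W] [FiniteDimensional ℂ W]
    {π : Representation ℂ (GL (Fin c × Fin r) K) W} (hπ : IsIrred π)
    {T : W →ₗ[ℂ] (Fin c → ι) → ℂ} (hT0 : T ≠ 0)
    (hT : ∀ (p : pblk c r K) w, T (π p w) = sig R p *ᵥ T w) : RepIso π π.dual := by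
  by_contra hne
  obtain ⟨w1, hw1⟩ : ∃ w1, T w1 ≠ 0 := by
    by_contra! h
    exact hT0 (LinearMap.ext h)
  obtain ⟨s0, hs0⟩ := Function.ne_iff.mp hw1
  let k : GL (Fin c × Fin r) K → Matrix (Fin c → ι) (Fin c → ι) ℂ := fun g =>
    ∑ p : pblk c r K, Matrix.of fun x y =>
      T (π (g * (p : GL (Fin c × Fin r) K)⁻¹) w1) x * sig R p s0 y
  let a : MatGA c r K ι := MonoidAlgebra.ofCoeff (Finsupp.equivFunOnFinite.symm k)
  have ha : ∀ g, a.coeff g = k g := fun g => rfl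
  have hl : ∀ p, parEl R p * a = a := by
    intro p
    refine MonoidAlgebra.ext (Finsupp.ext fun g => ?_)
    rw [coeff_parEl_mul, ha, ha, Finset.mul_sum]
    refine Finset.sum_congr rfl fun p' _ => ?_
    have h1 : π (g * (p' : GL (Fin c × Fin r) K)⁻¹) w1 =
        π p (π ((p : GL (Fin c × Fin r) K)⁻¹ * g * (p' : GL (Fin c × Fin r) K)⁻¹) w1) := by
      rw [← Module.End.mul_apply, ← _root_.map_mul]
      congr 2; group
    ext x y
    rw [Matrix.of_apply, h1, hT, Matrix.mul_apply, Matrix.mulVec, dotProduct, Finset.sum_mul]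
    exact Finset.sum_congr rfl fun z _ => by rw [Matrix.of_apply, ← mul_assoc (sig R p x z)]
  have hr : ∀ p, a * parEl R p = a := by
    intro p
    refine MonoidAlgebra.ext (Finsupp.ext fun g => ?_)
    rw [coeff_mul_parEl, ha, ha, Finset.sum_mul]
    refine Fintype.sum_equiv (Equiv.mulRight p) _ _ fun p' => ?_
    ext x y
    have h1 : sig R (p' * p) s0 y = ∑ z, sig R p' s0 z * sig R p z y := by
      rw [_root_.map_mul, Matrix.mul_apply]
    show _ = T (π (g * ((p' * p : pblk c r K) : GL (Fin c × Fin r) K)⁻¹) w1) x * sig R (p' * p) s0 y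
    rw [Matrix.mul_apply, h1, Finset.mul_sum]
    refine Finset.sum_congr rfl fun z _ => ?_
    rw [Matrix.of_apply, mul_assoc, Subgroup.coe_mul, _root_.mul_inv_rev, mul_assoc]
  have htr : ∀ κ : GL (Fin c × Fin r) K → ℂ, (∀ g h, κ (g * h) = κ (h * g)) →
      twTrace κ a = Nat.card (pblk c r K) * T ((∑ g, κ g • π g) w1) s0 := by
    intro κ hκ
    have h1 : ∀ g, (k g).trace =
        ∑ p : pblk c r K, T (π (p * g * (p : GL (Fin c × Fin r) K)⁻¹) w1) s0 := by
      intro g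
      rw [Matrix.trace_sum]
      refine Finset.sum_congr rfl fun p _ => ?_
      have h : π (p * g * (p : GL (Fin c × Fin r) K)⁻¹) w1 =
          π p (π (g * (p : GL (Fin c × Fin r) K)⁻¹) w1) := by
        rw [mul_assoc, _root_.map_mul]; rfl
      rw [h, hT, Matrix.trace, Matrix.mulVec, dotProduct]
      exact Finset.sum_congr rfl fun z _ => mul_comm _ _
    rw [twTrace_apply]
    simp only [ha, h1, Finset.mul_sum]
    rw [Finset.sum_comm]
    have h2 : ∀ p : pblk c r K, ∑ g, κ g * T (π (p * g * (p : GL (Fin c × Fin r) K)⁻¹) w1) s0 =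
        T ((∑ g, κ g • π g) w1) s0 := by
      intro p
      rw [LinearMap.sum_apply, _root_.map_sum, Finset.sum_apply]
      refine Fintype.sum_equiv (MulAut.conj (p : GL (Fin c × Fin r) K)).toEquiv _ _ fun g => ?_
      have : κ (MulAut.conj (p : GL (Fin c × Fin r) K) g) = κ g := by
        rw [MulAut.conj_apply, hκ, inv_mul_cancel_left]
      show _ = T ((κ (MulAut.conj (p : GL (Fin c × Fin r) K) g) • π (p * g * (p : GL (Fin c × Fin r) K)⁻¹)) w1) s0
      rw [this, LinearMap.smul_apply, _root_.map_smul, Pi.smul_apply, smul_eq_mul]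
    rw [Finset.sum_congr rfl fun p _ => h2 p, Finset.sum_const, Finset.card_univ, nsmul_eq_mul,
      Nat.card_eq_fintype_card]
  let κ : GL (Fin c × Fin r) K → ℂ := fun g => LinearMap.trace ℂ W (π g)
  have hκ : ∀ g h, κ (g * h) = κ (h * g) := by
    intro g h
    simp only [κ, _root_.map_mul]
    exact LinearMap.trace_mul_comm ℂ _ _
  have h1 := twTrace_inv_eq hc hs hB hl hr hκ
  rw [htr κ hκ, htr _ fun g h => by rw [_root_.mul_inv_rev, _root_.mul_inv_rev, hκ]] at h1
  simp only [κ] at h1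
  rw [hπ.sum_character hne, hπ.sum_character_inv] at h1
  simp only [LinearMap.zero_apply, _root_.map_zero, Pi.zero_apply, mul_zero, LinearMap.smul_apply,
    LinearMap.id_apply, _root_.map_smul, Pi.smul_apply, smul_eq_mul, mul_eq_zero, div_eq_zero_iff,
    Nat.cast_eq_zero] at h1
  have : Nontrivial W := ⟨w1, 0, fun h => hw1 (by rw [h, _root_.map_zero])⟩
  rcases h1 with h1 | (h1 | h1) | h1
  · exact Nat.card_pos.ne' h1
  · exact Fintype.card_ne_zero h1
  · exact Module.finrank_pos.ne' h1
  · exact hs0 h1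

end Hecke

section GenericVector

variable {n : ℕ} {K : Type*} [Field K]

/-- The sum of the entries just above the diagonal. -/
def superSum (M : Matrix (Fin n) (Fin n) K) : K :=
  ∑ i : Fin n, ∑ j : Fin n, if (i : ℕ) + 1 = j then M i j else 0

theorem superSum_add (M N : Matrix (Fin n) (Fin n) K) :
    superSum (M + N) = superSum M + superSum N := by
  simp only [superSum, ← Finset.sum_add_distrib]
  refine Finset.sum_congr rfl fun i _ => Finset.sum_congr rfl fun j _ => ?_
  split_ifs <;> simp

theorem superSum_eq_zero {M : Matrix (Fin n) (Fin n) K} (h : ∀ i j : Fin n, (i : ℕ) + 1 = j → M i j = 0) :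
    superSum M = 0 :=
  Finset.sum_eq_zero fun i _ => Finset.sum_eq_zero fun j _ => by
    split_ifs with hij
    · exact h i j hij
    · rfl

theorem superSum_one : superSum (1 : Matrix (Fin n) (Fin n) K) = 0 :=
  superSum_eq_zero fun i j h => Matrix.one_apply_ne fun hij => by rw [hij] at h; omega

theorem superSum_mul {u u' : GL (Fin n) K} (hu : u ∈ bunip K (id : Fin n → Fin n))
    (hu' : u' ∈ bunip K (id : Fin n → Fin n)) :
    superSum ((u * u' : GL (Fin n) K) : Matrix (Fin n) (Fin n) K) =
      superSum (u : Matrix (Fin n) (Fin n) K) + superSum (u' : Matrix (Fin n) (Fin n) K) := by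
  have h : ((u * u' : GL (Fin n) K) : Matrix (Fin n) (Fin n) K) + 1 =
      ((u : Matrix (Fin n) (Fin n) K) - 1) * ((u' : Matrix (Fin n) (Fin n) K) - 1) +
        ((u : Matrix (Fin n) (Fin n) K) + (u' : Matrix (Fin n) (Fin n) K)) := by
    rw [Units.val_mul, Matrix.mul_sub, Matrix.sub_mul, Matrix.sub_mul, Matrix.mul_one, Matrix.one_mul,
      Matrix.mul_one]
    abel
  have h0 : superSum (((u : Matrix (Fin n) (Fin n) K) - 1) *
      ((u' : Matrix (Fin n) (Fin n) K) - 1)) = 0 := by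
    refine superSum_eq_zero fun i j hij => ?_
    rw [Matrix.mul_apply]
    refine Finset.sum_eq_zero fun k _ => ?_
    by_cases hk : i < k
    · rw [mem_bunip.mp hu' k j (by simp only [id, Fin.lt_def] at hk ⊢; omega), mul_zero]
    · rw [mem_bunip.mp hu i k hk, zero_mul]
  have := congrArg superSum h
  rwa [superSum_add, superSum_one, add_zero, superSum_add, superSum_add, h0, zero_add] at this

theorem superSum_inv {u : GL (Fin n) K} (hu : u ∈ bunip K (id : Fin n → Fin n)) :
    superSum ((u⁻¹ : GL (Fin n) K) : Matrix (Fin n) (Fin n) K) =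
      - superSum (u : Matrix (Fin n) (Fin n) K) := by
  have := superSum_mul hu (inv_mem hu)
  rw [mul_inv_cancel, Units.val_one, superSum_one] at this
  exact (neg_eq_of_add_eq_zero_right this.symm).symm

/-- The matrix differing from the identity only above the diagonal in one column. -/
def colMat (j₀ : Fin n) (a : Fin n → K) : Matrix (Fin n) (Fin n) K :=
  1 + vecMulVec (fun i => if i < j₀ then a i else 0) (Pi.single j₀ 1)

theorem colMat_apply (j₀ : Fin n) (a : Fin n → K) (i j : Fin n) :
    colMat j₀ a i j = (1 : Matrix (Fin n) (Fin n) K) i j + if i < j₀ ∧ j = j₀ then a i else 0 := by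
  rw [colMat, Matrix.add_apply, vecMulVec_apply, Pi.single_apply]
  split_ifs <;> simp_all

theorem colMat_mul_apply (j₀ : Fin n) (a : Fin n → K) (M : Matrix (Fin n) (Fin n) K) (i j : Fin n) :
    (colMat j₀ a * M) i j = M i j + if i < j₀ then a i * M j₀ j else 0 := by
  rw [colMat, Matrix.add_mul, Matrix.one_mul, Matrix.add_apply, vecMulVec_mul, vecMulVec_apply,
    single_one_vecMul]
  split_ifs <;> simp

theorem colMat_mul (j₀ : Fin n) (a b : Fin n → K) :
    colMat j₀ a * colMat j₀ b = colMat j₀ (a + b) := by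
  ext i j
  rw [colMat_mul_apply, colMat_apply, colMat_apply, colMat_apply, if_neg (by simp : ¬ (j₀ < j₀ ∧ j = j₀)), add_zero, Matrix.one_apply, Matrix.one_apply]
  by_cases h2 : j = j₀
  · subst h2
    by_cases h1 : i < j
    · simp only [h1, if_true, and_self, Pi.add_apply]; ring
    · simp [h1]
  · simp [h2, Ne.symm h2]

theorem colMat_zero (j₀ : Fin n) : colMat j₀ (0 : Fin n → K) = 1 := by
  ext i j
  rw [colMat_apply]; simp

/-- The invertible matrix differing from the identity only above the diagonal in one column. -/
def colGL (j₀ : Fin n) (a : Fin n → K) : GL (Fin n) K where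
  val := colMat j₀ a
  inv := colMat j₀ (-a)
  val_inv := by rw [colMat_mul, add_neg_cancel, colMat_zero]
  inv_val := by rw [colMat_mul, neg_add_cancel, colMat_zero]

theorem colGL_val (j₀ : Fin n) (a : Fin n → K) :
    (colGL j₀ a : Matrix (Fin n) (Fin n) K) = colMat j₀ a := rfl

theorem colGL_mul (j₀ : Fin n) (a b : Fin n → K) :
    colGL j₀ a * colGL j₀ b = colGL j₀ (a + b) := Units.ext (colMat_mul j₀ a b)

theorem colGL_inv (j₀ : Fin n) (a : Fin n → K) : (colGL j₀ a)⁻¹ = colGL j₀ (-a) := by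
  rw [inv_eq_iff_mul_eq_one, colGL_mul, add_neg_cancel]
  exact Units.ext (colMat_zero j₀)

theorem colGL_mem (j₀ : Fin n) (a : Fin n → K) : colGL j₀ a ∈ bunip K (id : Fin n → Fin n) := by
  rw [mem_bunip_iff]
  intro i j hij
  rw [colGL_val, colMat_apply, if_neg, add_zero]
  rintro ⟨h, rfl⟩
  exact hij h

/-- Upper unitriangular matrices whose first columns are those of the identity. -/
def unipFrom (K : Type*) [Field K] (n m : ℕ) : Subgroup (GL (Fin n) K) where
  carrier := {u | u ∈ bunip K (id : Fin n → Fin n) ∧ ∀ j : Fin n, (j : ℕ) < m → ∀ i,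
    (u : Matrix (Fin n) (Fin n) K) i j = (1 : Matrix (Fin n) (Fin n) K) i j}
  one_mem' := ⟨one_mem _, fun _ _ _ => rfl⟩
  mul_mem' := by
    rintro a b ⟨ha, ha'⟩ ⟨hb, hb'⟩
    refine ⟨mul_mem ha hb, fun j hj i => ?_⟩
    rw [Units.val_mul, Matrix.mul_apply, Finset.sum_eq_single j]
    · rw [hb' j hj, Matrix.one_apply_eq, mul_one, ha' j hj]
    · intro k _ hk
      rw [hb' j hj, Matrix.one_apply_ne hk, mul_zero]
    · simp
  inv_mem' := by
    rintro a ⟨ha, ha'⟩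
    refine ⟨inv_mem ha, fun j hj i => ?_⟩
    have : ((a⁻¹ * a : GL (Fin n) K) : Matrix (Fin n) (Fin n) K) i j =
        ((a⁻¹ : GL (Fin n) K) : Matrix (Fin n) (Fin n) K) i j := by
      rw [Units.val_mul, Matrix.mul_apply, Finset.sum_eq_single j]
      · rw [ha' j hj, Matrix.one_apply_eq, mul_one]
      · intro k _ hk
        rw [ha' j hj, Matrix.one_apply_ne hk, mul_zero]
      · simp
    rw [← this, inv_mul_cancel, Units.val_one]

theorem unipFrom_zero {u : GL (Fin n) K} (hu : u ∈ bunip K (id : Fin n → Fin n)) :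
    u ∈ unipFrom K n 0 := ⟨hu, fun j hj => absurd hj (by omega)⟩

theorem colGL_mul_mem {j₀ : Fin n} {u : GL (Fin n) K} (hu : u ∈ unipFrom K n j₀) :
    colGL j₀ (-fun i => (u : Matrix (Fin n) (Fin n) K) i j₀) * u ∈ unipFrom K n (j₀ + 1) := by
  refine ⟨mul_mem (colGL_mem _ _) hu.1, fun j hj i => ?_⟩
  have hu1 := mem_bunip_iff.mp hu.1
  rw [Units.val_mul, colGL_val, colMat_mul_apply]
  rcases Nat.lt_succ_iff_lt_or_eq.mp hj with h | h
  · rw [hu.2 j h, hu.2 j h, Matrix.one_apply_ne (i := j₀) (j := j) (fun h' => by rw [h'] at h; omega)]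
    simp
  · obtain rfl : j = j₀ := Fin.ext h
    rw [hu1 j j (by simp), Matrix.one_apply_eq]
    split_ifs with hi
    · rw [Matrix.one_apply_ne hi.ne]; simp
    · rw [add_zero]
      exact hu1 i j hi

theorem unipFrom_mul_apply {m : ℕ} {u : GL (Fin n) K} (hu : u ∈ unipFrom K n m)
    {M : Matrix (Fin n) (Fin n) K} {j : Fin n} (hM : ∀ k : Fin n, m ≤ k → M k j = 0) (i : Fin n) :
    ((u : Matrix (Fin n) (Fin n) K) * M) i j = M i j := by
  conv_rhs => rw [← Matrix.one_mul M]
  rw [Matrix.mul_apply, Matrix.mul_apply]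
  refine Finset.sum_congr rfl fun k _ => ?_
  by_cases hk : m ≤ k
  · rw [hM k hk, mul_zero, mul_zero]
  · rw [hu.2 k (by omega)]

theorem colGL_conj_mem {j₀ : Fin n} (a : Fin n → K) {u : GL (Fin n) K}
    (hu : u ∈ unipFrom K n (j₀ + 1)) :
    (colGL j₀ a)⁻¹ * u * colGL j₀ a ∈ unipFrom K n (j₀ + 1) := by
  refine ⟨mul_mem (mul_mem (inv_mem (colGL_mem _ _)) hu.1) (colGL_mem _ _), fun j hj i => ?_⟩
  have h : ∀ k, ((u : Matrix (Fin n) (Fin n) K) * (colGL j₀ a : Matrix (Fin n) (Fin n) K)) k j =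
      (colGL j₀ a : Matrix (Fin n) (Fin n) K) k j := by
    refine unipFrom_mul_apply hu fun k hk => ?_
    rw [colGL_val, colMat_apply, Matrix.one_apply_ne (fun h => by rw [h] at hk; omega), if_neg,
      add_zero]
    rintro ⟨h, -⟩
    rw [Fin.lt_def] at h
    omega
  rw [mul_assoc, Units.val_mul, Units.val_mul, Matrix.mul_apply]
  simp only [h]
  rw [← Matrix.mul_apply, ← Units.val_mul, inv_mul_cancel, Units.val_one]

/-- The part of the superdiagonal sum coming from the columns to the right of a given one. -/
def superSumGt (j₀ : Fin n) (M : Matrix (Fin n) (Fin n) K) : K :=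
  ∑ i : Fin n, ∑ j : Fin n, if (i : ℕ) + 1 = j ∧ j₀ < j then M i j else 0

theorem superSum_eq_superSumGt {j₀ : Fin n} {M N : Matrix (Fin n) (Fin n) K}
    (h0 : ∀ i j : Fin n, (i : ℕ) + 1 = j → j ≤ j₀ → M i j = 0)
    (h1 : ∀ i j : Fin n, (i : ℕ) + 1 = j → j₀ < j → M i j = N i j) :
    superSum M = superSumGt j₀ N := by
  refine Finset.sum_congr rfl fun i _ => Finset.sum_congr rfl fun j _ => ?_
  by_cases hij : (i : ℕ) + 1 = j
  · by_cases hj : j₀ < j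
    · rw [if_pos hij, if_pos ⟨hij, hj⟩, h1 i j hij hj]
    · rw [if_pos hij, if_neg fun h => hj h.2, h0 i j hij (not_lt.mp hj)]
  · rw [if_neg hij, if_neg fun h => hij h.1]

theorem superSum_eq_add {j₀ p : Fin n} (hp : (p : ℕ) + 1 = j₀) {M : Matrix (Fin n) (Fin n) K}
    (h0 : ∀ i j : Fin n, (i : ℕ) + 1 = j → j < j₀ → M i j = 0) :
    superSum M = M p j₀ + superSumGt j₀ M := by
  have : M p j₀ = ∑ i : Fin n, ∑ j : Fin n, if (i : ℕ) + 1 = j ∧ j = j₀ then M i j else 0 := by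
    rw [Finset.sum_eq_single p, Finset.sum_eq_single j₀, if_pos ⟨hp, rfl⟩]
    · intro j _ hj
      rw [if_neg fun h => hj h.2]
    · simp
    · intro i _ hi
      refine Finset.sum_eq_zero fun j _ => if_neg ?_
      rintro ⟨h, rfl⟩
      exact hi (Fin.ext (by omega))
    · simp
  rw [this, superSum, superSumGt, ← Finset.sum_add_distrib]
  refine Finset.sum_congr rfl fun i _ => ?_
  rw [← Finset.sum_add_distrib]
  refine Finset.sum_congr rfl fun j _ => ?_
  by_cases hij : (i : ℕ) + 1 = j
  · rcases lt_trichotomy j j₀ with hj | hj | hj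
    · simp [hj.ne, hj.not_gt, h0 i j hij hj]
    · simp [hij, hj]
    · simp [hij, hj, hj.ne']
  · simp [hij]

/-- An invertible matrix with a prescribed nonzero row, trivial below a given row. -/
theorem exists_row_GL {j₀ p : Fin n} (hp : (p : ℕ) + 1 = j₀) {b : Fin n → K}
    (hb : ∀ i, j₀ ≤ i → b i = 0) (hb0 : b ≠ 0) :
    ∃ d : GL (Fin n) K, (∀ j, (d : Matrix (Fin n) (Fin n) K) p j = b j) ∧
      ∀ i j, j₀ ≤ i → (d : Matrix (Fin n) (Fin n) K) i j = (1 : Matrix (Fin n) (Fin n) K) i j := by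
  obtain ⟨s, hs⟩ := Function.ne_iff.mp hb0
  have hs' : b s ≠ 0 := hs
  have hsj : s < j₀ := by
    by_contra h
    exact hs' (hb s (not_lt.mp h))
  have hdet : ((1 : Matrix (Fin n) (Fin n) K).updateRow s b).det = b s := by
    rw [← cramer_transpose_apply, Matrix.transpose_one, cramer_one]; rfl
  let e : GL (Fin n) K := GeneralLinearGroup.mkOfDetNeZero _ (hdet.trans_ne hs')
  have he : (e : Matrix (Fin n) (Fin n) K) = (1 : Matrix (Fin n) (Fin n) K).updateRow s b := rfl
  refine ⟨permGL K (Equiv.swap p s) * e, fun j => ?_, fun i j hi => ?_⟩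
  · rw [Units.val_mul, permGL_mul_apply, Equiv.swap_inv, Equiv.swap_apply_left, he, updateRow_self]
  · have hip : i ≠ p := fun h => by rw [h, Fin.le_def] at hi; omega
    have his : i ≠ s := fun h => by rw [h] at hi; exact absurd hsj (not_lt.mpr hi)
    rw [Units.val_mul, permGL_mul_apply, Equiv.swap_inv, Equiv.swap_apply_of_ne_of_ne hip his, he,
      updateRow_ne his]

variable [Fintype K] [DecidableEq K]

theorem sum_addChar_dotProduct {ψ : AddChar K ℂ} (hψ : ψ.IsPrimitive) (a : Fin n → K) :
    ∑ b : Fin n → K, ψ (-(b ⬝ᵥ a)) = if a = 0 then (Fintype.card (Fin n → K) : ℂ) else 0 := by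
  let χ : AddChar (Fin n → K) ℂ :=
    { toFun := fun b => ψ (-(b ⬝ᵥ a))
      map_zero_eq_one' := by simp
      map_add_eq_mul' := fun x y => by rw [add_dotProduct, neg_add, AddChar.map_add_eq_mul] }
  have hχ : ∀ b, χ b = ψ (-(b ⬝ᵥ a)) := fun b => rfl
  have : χ = 0 ↔ a = 0 := by
    constructor
    · intro h
      by_contra ha
      obtain ⟨i, hi⟩ := Function.ne_iff.mp ha
      refine hψ (neg_ne_zero.mpr hi) ?_
      ext x
      have := DFunLike.congr_fun h (Pi.single i x)
      rw [hχ, single_dotProduct] at this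
      rw [AddChar.mulShift_apply, neg_mul, mul_comm]
      simpa using this
    · rintro rfl
      ext b
      simp [hχ]
  classical
  have h := AddChar.sum_eq_ite χ
  simp only [hχ, this] at h
  exact h

variable {V : Type*} [AddCommGroup V] [Module ℂ V]

/-- A cuspidal representation contains a vector transforming under the upper unitriangular group
by a nondegenerate character. -/
theorem exists_generic_vector {ρ : Representation ℂ (GL (Fin n) K) V} (hρ : IsCuspidal ρ)
    (hV : ∃ v : V, v ≠ 0) {ψ : AddChar K ℂ} (hψ : ψ.IsPrimitive) :
    ∃ v : V, v ≠ 0 ∧ ∀ u ∈ bunip K (id : Fin n → Fin n),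
      ρ u v = ψ (superSum (u : Matrix (Fin n) (Fin n) K)) • v := by
  have key : ∀ k m : ℕ, m + k = n → ∃ v : V, v ≠ 0 ∧ ∀ u ∈ unipFrom K n m,
      ρ u v = ψ (superSum (u : Matrix (Fin n) (Fin n) K)) • v := by
    intro k
    induction k with
    | zero =>
      intro m hm
      obtain ⟨v, hv⟩ := hV
      refine ⟨v, hv, fun u hu => ?_⟩
      have : u = 1 := Units.ext (Matrix.ext fun i j => hu.2 j (by omega) i)
      rw [this, _root_.map_one, Units.val_one, superSum_one, AddChar.map_zero_eq_one, one_smul]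
      rfl
    | succ k ih =>
      intro m hm
      obtain ⟨v, hv0, hv⟩ := ih (m + 1) (by omega)
      let j₀ : Fin n := ⟨m, by omega⟩
      rcases Nat.eq_zero_or_pos m with hm0 | hm0
      · refine ⟨v, hv0, fun u hu => hv u ⟨hu.1, fun j hj i => ?_⟩⟩
        exact mem_bunip_iff.mp hu.1 i j (by simp only [id, Fin.lt_def]; omega)
      let p : Fin n := ⟨m - 1, by omega⟩
      have hp : (p : ℕ) + 1 = j₀ := by simp only [p, j₀]; omega
      let w : (Fin n → K) → V := fun b => ∑ a : Fin n → K, ψ (-(b ⬝ᵥ a)) • ρ (colGL j₀ a) v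
      have hw1 : ∀ b, ∀ u ∈ unipFrom K n (m + 1),
          ρ u (w b) = ψ (superSum (u : Matrix (Fin n) (Fin n) K)) • w b := by
        intro b u hu
        simp only [w]
        rw [_root_.map_sum, Finset.smul_sum]
        refine Finset.sum_congr rfl fun a _ => ?_
        have h1 : ρ u (ρ (colGL j₀ a) v) = ρ (colGL j₀ a) (ρ ((colGL j₀ a)⁻¹ * u * colGL j₀ a) v) := by
          rw [← Module.End.mul_apply, ← Module.End.mul_apply, ← _root_.map_mul, ← _root_.map_mul]
          congr 2; group
        have hc := colGL_mem j₀ a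
        have h2 : superSum (((colGL j₀ a)⁻¹ * u * colGL j₀ a : GL (Fin n) K) : Matrix (Fin n) (Fin n) K)
            = superSum (u : Matrix (Fin n) (Fin n) K) := by
          rw [superSum_mul (mul_mem (inv_mem hc) hu.1) hc, superSum_mul (inv_mem hc) hu.1,
            superSum_inv hc]
          ring
        rw [_root_.map_smul, h1, hv _ (colGL_conj_mem (j₀ := j₀) a hu), h2, _root_.map_smul,
          smul_comm]
      have hw2 : ∀ b a, ρ (colGL j₀ a) (w b) = ψ (b ⬝ᵥ a) • w b := by
        intro b a
        simp only [w]
        rw [_root_.map_sum, Finset.smul_sum]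
        refine Fintype.sum_equiv (Equiv.addLeft a) _ _ fun x => ?_
        rw [_root_.map_smul, ← Module.End.mul_apply, ← _root_.map_mul, colGL_mul, smul_smul,
          ← AddChar.map_add_eq_mul, Equiv.coe_addLeft, dotProduct_add]
        congr 2
        ring
      have hwsum : ∑ b, w b = (Fintype.card (Fin n → K) : ℂ) • v := by
        simp only [w]
        rw [Finset.sum_comm]
        simp only [← Finset.sum_smul, sum_addChar_dotProduct hψ]
        rw [Finset.sum_eq_single 0]
        · have : colGL j₀ (0 : Fin n → K) = 1 := Units.ext (colMat_zero j₀)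
          rw [if_pos rfl, this, _root_.map_one]; rfl
        · intro a _ ha
          rw [if_neg ha, zero_smul]
        · simp
      obtain ⟨b, hb⟩ : ∃ b, w b ≠ 0 := by
        by_contra! h
        rw [Finset.sum_eq_zero fun b _ => h b] at hwsum
        exact smul_ne_zero (Nat.cast_ne_zero.mpr Fintype.card_ne_zero) hv0 hwsum.symm
      have hbz : ∀ i, j₀ ≤ i → b i = 0 := by
        intro i hi
        by_contra hbi
        refine hψ hbi ?_
        ext x
        have h1 : colGL j₀ (Pi.single i x : Fin n → K) = 1 := by
          refine Units.ext (Matrix.ext fun i' j' => ?_)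
          rw [colGL_val, colMat_apply, Units.val_one]
          split_ifs with h
          · rw [Pi.single_eq_of_ne (h.1.trans_le hi).ne, add_zero]
          · rw [add_zero]
        have h2 := hw2 b (Pi.single i x)
        rw [h1, _root_.map_one, dotProduct_single, Module.End.one_apply] at h2
        rw [AddChar.mulShift_apply, AddChar.one_apply]
        by_contra h3
        refine hb ((smul_eq_zero.mp (?_ : (ψ (b i * x) - 1) • w b = 0)).resolve_left (sub_ne_zero.mpr h3))
        rw [sub_smul, ← h2, one_smul, sub_self]
      have hw3 : ∀ u ∈ unipFrom K n m, ρ u (w b) =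
          ψ (b ⬝ᵥ (fun i => (u : Matrix (Fin n) (Fin n) K) i j₀ - (1 : Matrix (Fin n) (Fin n) K) i j₀) +
            superSumGt j₀ (u : Matrix (Fin n) (Fin n) K)) • w b := by
        intro u hu
        have hu' := colGL_mul_mem (j₀ := j₀) hu
        set a : Fin n → K := fun i => (u : Matrix (Fin n) (Fin n) K) i j₀ with ha
        have h1 : ρ u (w b) = ρ (colGL j₀ a) (ρ (colGL j₀ (-a) * u) (w b)) := by
          rw [← Module.End.mul_apply, ← _root_.map_mul, ← mul_assoc, ← colGL_inv, mul_inv_cancel, one_mul]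
        have h2 : superSum ((colGL j₀ (-a) * u : GL (Fin n) K) : Matrix (Fin n) (Fin n) K) =
            superSumGt j₀ (u : Matrix (Fin n) (Fin n) K) := by
          refine superSum_eq_superSumGt (fun i j hij hj => ?_) fun i j hij hj => ?_
          · rw [hu'.2 j (by rw [Fin.le_def] at hj; exact Nat.lt_succ_of_le hj),
              Matrix.one_apply_ne fun h => by rw [h] at hij; omega]
          · rw [Units.val_mul, colGL_val, colMat_mul_apply, if_neg, add_zero]
            rw [Fin.lt_def] at hj ⊢
            omega
        have h3 : b ⬝ᵥ (fun i => a i - (1 : Matrix (Fin n) (Fin n) K) i j₀) = b ⬝ᵥ a := by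
          refine Finset.sum_congr rfl fun i _ => ?_
          by_cases hi : i = j₀
          · rw [hbz i hi.ge, zero_mul, zero_mul]
          · show b i * (a i - (1 : Matrix (Fin n) (Fin n) K) i j₀) = _
            rw [Matrix.one_apply_ne hi, sub_zero]
        rw [h1, hw1 b _ hu', h2, _root_.map_smul, hw2, smul_smul, h3, AddChar.map_add_eq_mul, mul_comm]
      have hb0 : b ≠ 0 := by
        rintro rfl
        have hf : Monotone fun i : Fin n => if i < j₀ then (0 : Fin 2) else 1 := by
          intro i j hij
          dsimp only
          split_ifs with h1 h2
          · exact le_rfl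
          · exact Fin.zero_le _
          · exact absurd (hij.trans_lt ‹_›) h1
          · exact le_rfl
        refine hb (hρ 2 _ le_rfl hf ?_ _ fun A hA => ?_)
        · intro x
          fin_cases x
          · refine ⟨p, if_pos ?_⟩
            rw [Fin.lt_def]; omega
          · exact ⟨j₀, if_neg (lt_irrefl _)⟩
        · have hA0 : ∀ i j, ¬ (i < j₀ ∧ j₀ ≤ j) → (A : Matrix (Fin n) (Fin n) K) i j =
              (1 : Matrix (Fin n) (Fin n) K) i j := by
            intro i j h
            refine hA i j ?_
            dsimp only
            split_ifs with h1 h2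
            · exact lt_irrefl _
            · exact absurd ⟨h1, not_lt.mp h2⟩ h
            · simp
            · exact lt_irrefl _
          have hAm : A ∈ unipFrom K n m := by
            refine ⟨mem_bunip_iff.mpr fun i j h => hA0 i j fun h' => h (h'.1.trans_le h'.2),
              fun j hj i => hA0 i j fun h' => ?_⟩
            have := h'.2
            rw [Fin.le_def] at this
            exact absurd this (not_le.mpr hj)
          have hz : superSumGt j₀ (A : Matrix (Fin n) (Fin n) K) = 0 := by
            refine Finset.sum_eq_zero fun i _ => Finset.sum_eq_zero fun j _ => ?_
            split_ifs with h
            · rw [hA0 i j, Matrix.one_apply_ne]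
              · rintro rfl
                omega
              · rintro ⟨h', -⟩
                have := h.2
                rw [Fin.lt_def] at this h'
                omega
            · rfl
          rw [hw3 A hAm, zero_dotProduct, hz, add_zero, AddChar.map_zero_eq_one, one_smul]
      obtain ⟨d, hd1, hd2⟩ := exists_row_GL hp hbz hb0
      refine ⟨ρ d (w b), ?_, fun u hu => ?_⟩
      · intro h
        apply hb
        have : ρ d⁻¹ (ρ d (w b)) = 0 := by rw [h, _root_.map_zero]
        rwa [← Module.End.mul_apply, ← _root_.map_mul, inv_mul_cancel, _root_.map_one] at this
      have hN : ∀ i j : Fin n, j < j₀ → ((u : Matrix (Fin n) (Fin n) K) - 1) i j = 0 := by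
        intro i j hj
        rw [Matrix.sub_apply, hu.2 j hj, sub_self]
      have hNd : ((u : Matrix (Fin n) (Fin n) K) - 1) * (d : Matrix (Fin n) (Fin n) K) =
          (u : Matrix (Fin n) (Fin n) K) - 1 := by
        conv_rhs => rw [← Matrix.mul_one ((u : Matrix (Fin n) (Fin n) K) - 1)]
        ext i j
        rw [Matrix.mul_apply, Matrix.mul_apply]
        refine Finset.sum_congr rfl fun t _ => ?_
        by_cases ht : j₀ ≤ t
        · rw [hd2 t j ht]
        · rw [hN i t (not_le.mp ht), zero_mul, zero_mul]
      have hMe : ((d⁻¹ * u * d : GL (Fin n) K) : Matrix (Fin n) (Fin n) K) - 1 =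
          ((d⁻¹ : GL (Fin n) K) : Matrix (Fin n) (Fin n) K) * ((u : Matrix (Fin n) (Fin n) K) - 1) := by
        rw [← hNd, Matrix.sub_mul, Matrix.one_mul, Matrix.mul_sub, ← Units.val_mul, ← Units.val_mul,
          ← Units.val_mul, inv_mul_cancel, Units.val_one, mul_assoc]
      set M := ((d⁻¹ * u * d : GL (Fin n) K) : Matrix (Fin n) (Fin n) K) - 1 with hM
      have hdM : (d : Matrix (Fin n) (Fin n) K) * M = (u : Matrix (Fin n) (Fin n) K) - 1 := by
        rw [hMe, ← Matrix.mul_assoc, ← Units.val_mul, mul_inv_cancel, Units.val_one, Matrix.one_mul]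
      have hM1 : ∀ i j : Fin n, j < j₀ → M i j = 0 := by
        intro i j hj
        rw [hMe, Matrix.mul_apply]
        exact Finset.sum_eq_zero fun t _ => by rw [hN t j hj, mul_zero]
      have hM2 : ∀ i j : Fin n, j₀ ≤ i → M i j = ((u : Matrix (Fin n) (Fin n) K) - 1) i j := by
        intro i j hi
        rw [← hdM, Matrix.mul_apply]
        conv_lhs => rw [← Matrix.one_mul M, Matrix.mul_apply]
        exact Finset.sum_congr rfl fun t _ => by rw [hd2 i t hi]
      have hMm : d⁻¹ * u * d ∈ unipFrom K n m := by
        refine ⟨mem_bunip.mpr fun i j hij => ?_, fun j hj i => ?_⟩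
        · rw [← hM]
          by_cases hj : j < j₀
          · exact hM1 i j hj
          · rw [hM2 i j ((not_lt.mp hj).trans (not_lt.mp hij))]
            exact hu.1 i j hij
        · rw [← sub_eq_zero, ← Matrix.sub_apply]
          exact hM1 i j hj
      have h1 : ρ u (ρ d (w b)) = ρ d (ρ (d⁻¹ * u * d) (w b)) := by
        rw [← Module.End.mul_apply, ← Module.End.mul_apply, ← _root_.map_mul, ← _root_.map_mul]
        congr 2; group
      have h2 : b ⬝ᵥ (fun i => ((d⁻¹ * u * d : GL (Fin n) K) : Matrix (Fin n) (Fin n) K) i j₀ -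
          (1 : Matrix (Fin n) (Fin n) K) i j₀) = ((u : Matrix (Fin n) (Fin n) K) - 1) p j₀ := by
        rw [← hdM, Matrix.mul_apply]
        exact Finset.sum_congr rfl fun t _ => by rw [hd1, hM, Matrix.sub_apply]
      have hne : ∀ i j : Fin n, (i : ℕ) + 1 = j → (1 : Matrix (Fin n) (Fin n) K) i j = 0 :=
        fun i j hij => Matrix.one_apply_ne fun h => by rw [h] at hij; omega
      have h3 : superSumGt j₀ ((d⁻¹ * u * d : GL (Fin n) K) : Matrix (Fin n) (Fin n) K) =
          superSumGt j₀ (u : Matrix (Fin n) (Fin n) K) := by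
        refine Finset.sum_congr rfl fun i _ => Finset.sum_congr rfl fun j _ => ?_
        split_ifs with h
        · have h4 := hM2 i j (by rw [Fin.le_def]; have := Fin.lt_def.mp h.2; omega)
          rwa [hM, Matrix.sub_apply, Matrix.sub_apply, hne i j h.1, sub_zero, sub_zero] at h4
        · rfl
      rw [h1, hw3 _ hMm, h2, h3, _root_.map_smul, superSum_eq_add hp, Matrix.sub_apply, hne p j₀ hp,
        sub_zero]
      intro i j hij hj
      rw [hu.2 j hj, hne i j hij]
  obtain ⟨v, hv0, hv⟩ := key n 0 (zero_add n)
  exact ⟨v, hv0, fun u hu => hv u (unipFrom_zero hu)⟩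

end GenericVector

section Coefficients

theorem IsIrred.exists_coeff_ne_zero {Γ X : Type*} [Group Γ] [AddCommGroup X] [Module ℂ X]
    {σ : Representation ℂ Γ X} (hσ : IsIrred σ) {l : Module.Dual ℂ X} (hl : l ≠ 0) {v : X}
    (hv : v ≠ 0) : ∃ g, l (σ g v) ≠ 0 := by
  by_contra! h
  let N : Submodule ℂ X :=
    { carrier := {x | ∀ g, l (σ g x) = 0}
      add_mem' := fun {x y} hx hy g => by rw [map_add, map_add, hx g, hy g, add_zero]
      zero_mem' := fun g => by rw [map_zero, map_zero]
      smul_mem' := fun z x hx g => by rw [_root_.map_smul, _root_.map_smul, hx g, smul_zero] }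
  rcases hσ.2 N (fun g x hx g' => by
    rw [← Module.End.mul_apply, ← _root_.map_mul]; exact hx _) with hN | hN
  · exact hv ((Submodule.mem_bot ℂ).mp (hN ▸ (show v ∈ N from h)))
  · refine hl (LinearMap.ext fun x => ?_)
    have hx : x ∈ N := hN ▸ Submodule.mem_top
    have := hx 1
    rwa [_root_.map_one, Module.End.one_apply] at this

theorem RepIso.dual {Γ X Y : Type*} [Group Γ] [AddCommGroup X] [Module ℂ X] [AddCommGroup Y]
    [Module ℂ Y] {σ : Representation ℂ Γ X} {τ : Representation ℂ Γ Y} (h : RepIso σ τ) :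
    RepIso τ.dual σ.dual := by
  obtain ⟨e, he⟩ := h
  refine ⟨e.dualMap, fun g l => LinearMap.ext fun x => ?_⟩
  show l (τ g⁻¹ (e x)) = l (e (σ g⁻¹ x))
  rw [he]

end Coefficients

section FlipDatum

/-- The square root trick for groups of odd order. -/
theorem mul_pow_succ_comm_of_involution {Γ : Type*} [Group Γ] {x n n' : Γ} {k : ℕ}
    (hx : x * x = 1) (hn : n * x = x * n') (hz : (n⁻¹ * n') ^ (2 * k + 1) = 1) :
    n * (n⁻¹ * n') ^ (k + 1) * x = x * (n * (n⁻¹ * n') ^ (k + 1)) := by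
  have hxi : x⁻¹ = x := inv_eq_of_mul_eq_one_left hx
  have h1 : x * n * x⁻¹ = n' := by
    rw [hxi, mul_assoc, hn, ← mul_assoc, hx, one_mul]
  have h2 : x * n' * x⁻¹ = n := by rw [← hn, mul_inv_cancel_right]
  have hconj : x * (n⁻¹ * n') * x⁻¹ = (n⁻¹ * n')⁻¹ := by
    calc x * (n⁻¹ * n') * x⁻¹ = (x * n * x⁻¹)⁻¹ * (x * n' * x⁻¹) := by group
      _ = _ := by rw [h1, h2]; group
  have hpow : x * (n⁻¹ * n') ^ (k + 1) * x⁻¹ = ((n⁻¹ * n') ^ (k + 1))⁻¹ := by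
    rw [← conj_pow, hconj, inv_pow]
  have hZ : n * (n⁻¹ * n') ^ (k + 1) = n' * ((n⁻¹ * n') ^ (k + 1))⁻¹ := by
    rw [eq_mul_inv_iff_mul_eq, mul_assoc, ← pow_add,
      show k + 1 + (k + 1) = 2 * k + 1 + 1 by ring, pow_succ, hz, one_mul, mul_inv_cancel_left]
  calc n * (n⁻¹ * n') ^ (k + 1) * x
      = (x * n * x⁻¹) * (x * (n⁻¹ * n') ^ (k + 1) * x⁻¹) * x := by rw [hZ, h1, hpow]
    _ = _ := by group

/-- A subgroup with a nondegenerate character and an anti-involution of the group, subject to the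
double coset condition of Gelfand and Kazhdan, together with an element inverting the
character. -/
structure FlipDatum (Γ : Type*) [Group Γ] where
  U : Subgroup Γ
  χ : Γ → ℂ
  χ_mul : ∀ u ∈ U, ∀ u' ∈ U, χ (u * u') = χ u * χ u'
  χ_one : χ 1 = 1
  θ : Γ → Γ
  θ_mul : ∀ g h, θ (g * h) = θ h * θ g
  θ_θ : ∀ g, θ (θ g) = g
  flip_adm : ∀ γ, (∀ u ∈ U, ∀ u' ∈ U, u' * γ = γ * u → χ u' = χ u) →
    ∃ a ∈ U, ∃ b ∈ U, θ γ = a * γ * b ∧ χ a * χ b = 1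
  d : Γ
  z : Γ
  d_sq : d * d = 1
  z_sq : z * z = 1
  z_comm : ∀ g, z * g = g * z
  θ_d : θ d = z * d
  d_mem : ∀ u ∈ U, d * u * d ∈ U
  χ_d : ∀ u ∈ U, χ (d * u * d) * χ u = 1
  k : ℕ
  pow_eq : ∀ u ∈ U, u ^ (2 * k + 1) = 1

namespace FlipDatum

variable {Γ : Type*} [Group Γ] (D : FlipDatum Γ)

theorem θ_one : D.θ 1 = 1 := by
  have := D.θ_mul 1 1
  rwa [mul_one, left_eq_mul] at this

theorem θ_inv (g : Γ) : D.θ g⁻¹ = (D.θ g)⁻¹ := by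
  rw [eq_inv_iff_mul_eq_one, ← D.θ_mul, mul_inv_cancel, D.θ_one]

theorem d_inv : D.d⁻¹ = D.d := inv_eq_of_mul_eq_one_right D.d_sq

theorem χ_inv_mul {u : Γ} (hu : u ∈ D.U) : D.χ u⁻¹ * D.χ u = 1 := by
  rw [← D.χ_mul _ (inv_mem hu) _ hu, inv_mul_cancel, D.χ_one]

theorem χ_ne_zero {u : Γ} (hu : u ∈ D.U) : D.χ u ≠ 0 := by
  intro h
  have := D.χ_inv_mul hu
  rw [h, mul_zero] at this
  exact zero_ne_one this

theorem χ_inv {u : Γ} (hu : u ∈ D.U) : D.χ u⁻¹ = (D.χ u)⁻¹ :=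
  eq_inv_of_mul_eq_one_left (D.χ_inv_mul hu)

theorem χ_pow {u : Γ} (hu : u ∈ D.U) (n : ℕ) : D.χ (u ^ n) = D.χ u ^ n := by
  induction n with
  | zero => rw [pow_zero, pow_zero, D.χ_one]
  | succ n ih => rw [pow_succ, pow_succ, D.χ_mul _ (pow_mem hu n) _ hu, ih]

theorem χ_pow_eq {u : Γ} (hu : u ∈ D.U) : D.χ u ^ (2 * D.k + 1) = 1 := by
  rw [← D.χ_pow hu, D.pow_eq u hu, D.χ_one]

theorem pow_two_mul {u : Γ} (hu : u ∈ D.U) : u ^ (D.k + 1) * u ^ (D.k + 1) = u := by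
  rw [← pow_add, show D.k + 1 + (D.k + 1) = (2 * D.k + 1) + 1 by ring, pow_succ, D.pow_eq u hu,
    one_mul]

theorem θ_z : D.θ D.z = D.z := by
  have h := D.θ_θ D.d
  rw [D.θ_d, D.θ_mul, D.θ_d] at h
  have h' : D.z * (D.d * D.θ D.z) = D.z * (D.d * D.z) := by
    rw [← mul_assoc, h, ← D.z_comm D.d, ← mul_assoc, D.z_sq, one_mul]
  exact mul_left_cancel (mul_left_cancel h')

/-- The automorphism attached to the anti-involution. -/
def θinv : Γ →* Γ where
  toFun g := D.θ g⁻¹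
  map_one' := by rw [inv_one, D.θ_one]
  map_mul' g h := by rw [_root_.mul_inv_rev, D.θ_mul]

/-- The twist of `θinv` by `d`. -/
def inv' : Γ →* Γ where
  toFun g := D.d * D.θ g⁻¹ * D.d
  map_one' := by rw [inv_one, D.θ_one, mul_one, D.d_sq]
  map_mul' g h := by
    rw [_root_.mul_inv_rev, D.θ_mul]
    have := D.d_sq
    calc D.d * (D.θ g⁻¹ * D.θ h⁻¹) * D.d = D.d * D.θ g⁻¹ * 1 * D.θ h⁻¹ * D.d := by group
      _ = _ := by rw [← D.d_sq]; group

/-- The involution on the symmetric space compatible with `inv'`. -/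
def symInv (x : Γ) : Γ := D.z * (D.d * D.θ x * D.d)

theorem symInv_eq (x : Γ) : D.symInv x = D.θ (x * D.d) * D.d := by
  rw [symInv, D.θ_mul, D.θ_d]; group

theorem symInv_conj (g x : Γ) :
    D.symInv (g * x * g⁻¹) = D.inv' g * D.symInv x * (D.inv' g)⁻¹ := by
  show D.z * (D.d * D.θ (g * x * g⁻¹) * D.d) =
    (D.d * D.θ g⁻¹ * D.d) * (D.z * (D.d * D.θ x * D.d)) * (D.d * D.θ g⁻¹ * D.d)⁻¹
  have hd := D.d_inv
  rw [← mul_assoc (D.d * D.θ g⁻¹ * D.d) D.z, ← D.z_comm, D.θ_mul, D.θ_mul, D.θ_inv,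
    _root_.mul_inv_rev, _root_.mul_inv_rev, inv_inv, hd]
  simp only [mul_assoc]
  rw [← mul_assoc D.d D.d, D.d_sq, one_mul, ← mul_assoc D.d D.d, D.d_sq, one_mul]

theorem symInv_symInv (x : Γ) : D.symInv (D.symInv x) = x := by
  simp only [symInv, D.θ_mul, D.θ_d, D.θ_z, D.θ_θ]
  have hz := D.z_comm
  calc D.z * (D.d * (D.z * D.d * (x * (D.z * D.d)) * D.z) * D.d)
      = D.z * (D.d * D.z) * (D.d * (x * D.z) * D.d) * (D.z * D.d) := by group
    _ = D.z * (D.z * D.d) * (D.d * (D.z * x) * D.d) * (D.z * D.d) := by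
        rw [hz D.d, hz x]
    _ = (D.z * D.z) * (D.d * D.d) * (D.z * x) * (D.d * D.z) * D.d := by group
    _ = (D.z * x) * (D.z * D.d) * D.d := by rw [D.z_sq, D.d_sq, ← hz D.d]; group
    _ = x * (D.z * D.z) * (D.d * D.d) := by rw [hz x]; group
    _ = x := by rw [D.z_sq, D.d_sq]; group

theorem symInv_sq {x : Γ} (hx : x * x = 1) : D.symInv x * D.symInv x = 1 := by
  have hz := D.z_comm
  have hθ : D.θ x * D.θ x = 1 := by rw [← D.θ_mul, hx, D.θ_one]
  calc D.z * (D.d * D.θ x * D.d) * (D.z * (D.d * D.θ x * D.d))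
      = D.z * ((D.d * D.θ x * D.d) * D.z) * (D.d * D.θ x * D.d) := by group
    _ = (D.z * D.z) * (D.d * D.θ x) * (D.d * D.d) * D.θ x * D.d := by rw [← hz]; group
    _ = D.d * (D.θ x * D.θ x) * D.d := by rw [D.z_sq, D.d_sq]; group
    _ = 1 := by rw [hθ, mul_one, D.d_sq]

theorem inv'_inv' (g : Γ) : D.inv' (D.inv' g) = g := by
  show D.d * D.θ (D.d * D.θ g⁻¹ * D.d)⁻¹ * D.d = g
  rw [_root_.mul_inv_rev, _root_.mul_inv_rev, D.d_inv, ← D.θ_inv, inv_inv]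
  simp only [D.θ_mul, D.θ_d, D.θ_θ]
  have hz := D.z_comm
  calc D.d * (D.z * D.d * g * (D.z * D.d)) * D.d
      = (D.d * D.z) * D.d * g * D.z * (D.d * D.d) := by group
    _ = (D.z * D.d) * D.d * g * D.z := by rw [hz D.d, D.d_sq, mul_one]
    _ = D.z * (D.d * D.d) * (g * D.z) := by group
    _ = D.z * D.z * g := by rw [D.d_sq, ← hz g]; group
    _ = g := by rw [D.z_sq, one_mul]

variable {X : Type*} [AddCommGroup X] [Module ℂ X] {ρ : Representation ℂ Γ X}

theorem exists_functional [Finite Γ] {v₀ : X} (h0 : v₀ ≠ 0)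
    (hv₀ : ∀ u ∈ D.U, ρ u v₀ = D.χ u • v₀) :
    ∃ l : Module.Dual ℂ X, l v₀ ≠ 0 ∧ ∀ u ∈ D.U, ∀ v, l (ρ u v) = D.χ u * l v := by
  have : Fintype D.U := Fintype.ofFinite _
  obtain ⟨m, hm⟩ : ∃ m : Module.Dual ℂ X, m v₀ ≠ 0 := by
    by_contra! h
    exact h0 ((Module.forall_dual_apply_eq_zero_iff ℂ v₀).mp h)
  refine ⟨∑ u : D.U, D.χ (u : Γ)⁻¹ • m.comp (ρ (u : Γ)), ?_, fun u hu v => ?_⟩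
  · have : ∀ u : D.U, (D.χ (u : Γ)⁻¹ • m.comp (ρ (u : Γ))) v₀ = m v₀ := fun u => by
      rw [LinearMap.smul_apply, LinearMap.comp_apply, hv₀ u u.2, _root_.map_smul, smul_smul,
        D.χ_inv_mul u.2, one_smul]
    rw [LinearMap.sum_apply, Finset.sum_congr rfl fun u _ => this u, Finset.sum_const,
      nsmul_eq_mul]
    exact mul_ne_zero (Nat.cast_ne_zero.mpr (Finset.card_pos.mpr ⟨1, Finset.mem_univ _⟩).ne') hm
  · rw [LinearMap.sum_apply, LinearMap.sum_apply, Finset.mul_sum]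
    refine Fintype.sum_equiv (Equiv.mulRight (⟨u, hu⟩ : D.U)) _ _ fun x => ?_
    simp only [LinearMap.smul_apply, LinearMap.comp_apply, smul_eq_mul, Equiv.coe_mulRight,
      Subgroup.coe_mul, _root_.mul_inv_rev, _root_.map_mul, Module.End.mul_apply]
    rw [D.χ_mul _ (inv_mem hu) _ (inv_mem x.2), ← mul_assoc, ← mul_assoc, mul_comm (D.χ u),
      D.χ_inv_mul hu, one_mul]

theorem coeff_θ {l : Module.Dual ℂ X} (hl : ∀ u ∈ D.U, ∀ v, l (ρ u v) = D.χ u * l v) {v₀ : X}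
    (hv₀ : ∀ u ∈ D.U, ρ u v₀ = D.χ u • v₀) (g : Γ) : l (ρ g v₀) = l (ρ (D.θ g) v₀) := by
  have key : ∀ g, l (ρ g v₀) ≠ 0 → l (ρ g v₀) = l (ρ (D.θ g) v₀) := by
    intro g hg
    obtain ⟨a, ha, b, hb, hab, h1⟩ := D.flip_adm g fun u hu u' hu' huu => by
      have h := congrArg (fun x => l (ρ x v₀)) huu
      simp only [_root_.map_mul, Module.End.mul_apply] at h
      rw [hl u' hu', hv₀ u hu, _root_.map_smul, _root_.map_smul, smul_eq_mul] at h
      exact mul_right_cancel₀ hg h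
    rw [hab]
    simp only [_root_.map_mul, Module.End.mul_apply]
    rw [hl a ha, hv₀ b hb, _root_.map_smul, _root_.map_smul, smul_eq_mul, ← mul_assoc, h1, one_mul]
  by_cases hg : l (ρ g v₀) = 0
  · by_cases hg' : l (ρ (D.θ g) v₀) = 0
    · rw [hg, hg']
    · have := key _ hg'
      rw [D.θ_θ] at this
      exact this.symm
  · exact key g hg

theorem exists_conj_symInv {l : Module.Dual ℂ X}
    (hl : ∀ u ∈ D.U, ∀ v, l (ρ u v) = D.χ u * l v) {x₀ : Γ} (hx₀ : x₀ * x₀ = 1) {w : X}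
    (hw : ∀ h, h * x₀ = x₀ * h → ρ h w = w) {g : Γ} (hg : l (ρ g w) ≠ 0) :
    ∃ y ∈ D.U, D.χ y = 1 ∧ D.symInv (g * x₀ * g⁻¹) = y * (g * x₀ * g⁻¹) * y⁻¹ := by
  generalize hx : g * x₀ * g⁻¹ = x
  have hxx : x * x = 1 := by
    rw [← hx]
    calc g * x₀ * g⁻¹ * (g * x₀ * g⁻¹) = g * (x₀ * x₀) * g⁻¹ := by group
      _ = 1 := by rw [hx₀]; group
  have hxi : x⁻¹ = x := inv_eq_of_mul_eq_one_right hxx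
  have hfix : ∀ y ∈ D.U, y * x = x * y → D.χ y = 1 := by
    intro y hy hyx
    have h1 : ρ (g⁻¹ * y * g) w = w := hw _ (by
      have : x₀ = g⁻¹ * x * g := by rw [← hx]; group
      rw [this]
      calc g⁻¹ * y * g * (g⁻¹ * x * g) = g⁻¹ * (y * x) * g := by group
        _ = _ := by rw [hyx]; group)
    have h2 : l (ρ y (ρ g w)) = l (ρ g w) := by
      conv_rhs => rw [← h1]
      rw [← Module.End.mul_apply, ← Module.End.mul_apply, ← _root_.map_mul, ← _root_.map_mul]
      congr 3
      group
    rw [hl y hy] at h2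
    exact mul_right_cancel₀ hg (by rw [h2, one_mul])
  have hanti : ∀ u ∈ D.U, ∀ u' ∈ D.U, u' * x = x * u → D.χ u * D.χ u' = 1 := by
    intro u hu u' hu' huu
    have hz : u⁻¹ * u' ∈ D.U := mul_mem (inv_mem hu) hu'
    have hy : u * (u⁻¹ * u') ^ (D.k + 1) ∈ D.U := mul_mem hu (pow_mem hz _)
    have hcomm : u * (u⁻¹ * u') ^ (D.k + 1) * x = x * (u * (u⁻¹ * u') ^ (D.k + 1)) := by
      refine mul_pow_succ_comm_of_involution hxx ?_ (D.pow_eq _ hz)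
      calc u * x = x * x * (u * x) := by rw [hxx, one_mul]
        _ = x * (x * u) * x := by group
        _ = x * u' * (x * x) := by rw [← huu]; group
        _ = x * u' := by rw [hxx, mul_one]
    have h1 := hfix _ hy hcomm
    rw [D.χ_mul _ hu _ (pow_mem hz _), D.χ_pow hz] at h1
    have h2 : D.χ (u⁻¹ * u') ^ (D.k + 1) * D.χ (u⁻¹ * u') ^ (D.k + 1) = D.χ (u⁻¹ * u') := by
      rw [← D.χ_pow hz, ← D.χ_mul _ (pow_mem hz _) _ (pow_mem hz _), D.pow_two_mul hz]
    have h3 : D.χ u * D.χ (u⁻¹ * u') = D.χ u' := by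
      rw [← D.χ_mul _ hu _ hz, mul_inv_cancel_left]
    rw [← h3, ← h2]
    linear_combination (D.χ u * D.χ (u⁻¹ * u') ^ (D.k + 1) + 1) * h1
  obtain ⟨a, ha, b, hb, hab, h1⟩ := D.flip_adm (x * D.d) fun u hu u' hu' huu => by
    have h2 := hanti _ (D.d_mem u hu) u' hu' (by
      have : u' * x = x * D.d * u * D.d⁻¹ := by rw [← huu]; group
      rw [this, D.d_inv]; group)
    have h3 := D.χ_d u hu
    have h4 : D.χ (D.d * u * D.d) ≠ 0 := D.χ_ne_zero (D.d_mem u hu)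
    exact mul_left_cancel₀ h4 (h2.trans h3.symm)
  have hb' := D.d_mem b hb
  have hχb := D.χ_d b hb
  have hj : D.symInv x = a * x * (D.d * b * D.d) := by
    rw [D.symInv_eq, hab]; group
  generalize D.d * b * D.d = b' at hb' hχb hj
  have hχ : D.χ b' = D.χ a := mul_right_cancel₀ (D.χ_ne_zero hb) (hχb.trans h1.symm)
  have hjj := D.symInv_sq hxx
  rw [hj] at hjj
  have hu : b' * a ∈ D.U := mul_mem hb' ha
  have hux : x * (b' * a) * x⁻¹ = (b' * a)⁻¹ := by
    rw [eq_inv_iff_mul_eq_one, hxi]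
    calc x * (b' * a) * x * (b' * a) = a⁻¹ * (a * x * b' * (a * x * b')) * a := by group
      _ = 1 := by rw [hjj]; group
  have hs : (b' * a) ^ (D.k + 1) * x * ((b' * a) ^ (D.k + 1))⁻¹ = b' * a * x := by
    have : x * ((b' * a) ^ (D.k + 1))⁻¹ = (b' * a) ^ (D.k + 1) * x := by
      rw [← inv_pow, ← hux, conj_pow, hxi]
      calc x * (x * (b' * a) ^ (D.k + 1) * x) = (x * x) * (b' * a) ^ (D.k + 1) * x := by group
        _ = _ := by rw [hxx, one_mul]
    rw [mul_assoc, this, ← mul_assoc, D.pow_two_mul hu]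
  have hy : b'⁻¹ * (b' * a) ^ (D.k + 1) ∈ D.U := mul_mem (inv_mem hb') (pow_mem hu _)
  refine ⟨_, hy, ?_, ?_⟩
  · have h2 : D.χ ((b' * a) ^ (D.k + 1)) * D.χ ((b' * a) ^ (D.k + 1)) = D.χ b' * D.χ b' := by
      rw [← D.χ_mul _ (pow_mem hu _) _ (pow_mem hu _), D.pow_two_mul hu, D.χ_mul _ hb' _ ha, hχ]
    have h3 := D.χ_pow_eq hy
    have h4 : D.χ (b'⁻¹ * (b' * a) ^ (D.k + 1)) ^ 2 = 1 := by
      rw [D.χ_mul _ (inv_mem hb') _ (pow_mem hu _), D.χ_inv hb', mul_pow, sq (D.χ _), h2, ← sq,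
        inv_pow, inv_mul_cancel₀ (pow_ne_zero 2 (D.χ_ne_zero hb'))]
    rwa [pow_succ, pow_mul, h4, one_pow, one_mul] at h3
  · rw [hj]
    calc a * x * b' = b'⁻¹ * (b' * a * x) * b' := by group
      _ = _ := by rw [← hs]; group

theorem repIso_comp_inv' [Fintype Γ] [FiniteDimensional ℂ X] (hρ : IsIrred ρ)
    {l : Module.Dual ℂ X} (hl0 : l ≠ 0)
    (hl : ∀ u ∈ D.U, ∀ v, l (ρ u v) = D.χ u * l v) {x₀ : Γ} (hx₀ : x₀ * x₀ = 1) {w : X}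
    (hw0 : w ≠ 0) (hw : ∀ h, h * x₀ = x₀ * h → ρ h w = w) : RepIso ρ (ρ.comp D.inv') := by
  obtain ⟨g₁, hg₁⟩ := hρ.exists_coeff_ne_zero hl0 hw0
  obtain ⟨x₁, hx₁⟩ : ∃ x₁, x₁ = g₁ * x₀ * g₁⁻¹ := ⟨_, rfl⟩
  obtain ⟨w₁, hw₁⟩ : ∃ w₁, w₁ = ρ g₁ w := ⟨_, rfl⟩
  have hxx : x₁ * x₁ = 1 := by
    rw [hx₁]
    calc g₁ * x₀ * g₁⁻¹ * (g₁ * x₀ * g₁⁻¹) = g₁ * (x₀ * x₀) * g₁⁻¹ := by group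
      _ = 1 := by rw [hx₀]; group
  have hfix : ∀ h, h * x₁ = x₁ * h → ρ h w₁ = w₁ := by
    intro h hh
    have : ρ (g₁⁻¹ * h * g₁) w = w := hw _ (by
      have hx : x₀ = g₁⁻¹ * x₁ * g₁ := by rw [hx₁]; group
      rw [hx]
      calc g₁⁻¹ * h * g₁ * (g₁⁻¹ * x₁ * g₁) = g₁⁻¹ * (h * x₁) * g₁ := by group
        _ = _ := by rw [hh]; group)
    rw [hw₁]
    conv_rhs => rw [← this]
    rw [← Module.End.mul_apply, ← Module.End.mul_apply, ← _root_.map_mul, ← _root_.map_mul]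
    congr 2
    group
  rw [← hw₁] at hg₁
  have hk1 : l (ρ 1 w₁) ≠ 0 := by rwa [_root_.map_one, Module.End.one_apply]
  have hright : ∀ g h, h * x₁ = x₁ * h → l (ρ (g * h) w₁) = l (ρ g w₁) := by
    intro g h hh
    rw [_root_.map_mul, Module.End.mul_apply, hfix h hh]
  obtain ⟨y₀, hy₀, -, hj₀⟩ := D.exists_conj_symInv hl hxx hfix hk1
  simp only [one_mul, inv_one, mul_one] at hj₀
  have key : ∀ g, l (ρ g w₁) ≠ 0 → l (ρ g w₁) = l (ρ (D.inv' g * y₀) w₁) := by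
    intro g hg
    obtain ⟨y, hy, hy1, hj⟩ := D.exists_conj_symInv hl hxx hfix hg
    rw [D.symInv_conj, hj₀] at hj
    have h1 := hright (D.inv' g * y₀) ((D.inv' g * y₀)⁻¹ * (y * g)) (by
      have : x₁ = (D.inv' g * y₀)⁻¹ * (D.inv' g * (y₀ * x₁ * y₀⁻¹) * (D.inv' g)⁻¹) *
        (D.inv' g * y₀) := by group
      conv_rhs => rw [this, hj]
      group)
    rw [← h1, mul_inv_cancel_left, _root_.map_mul, Module.End.mul_apply, hl y hy, hy1, one_mul]
  have hall : ∀ g, l (ρ g w₁) = l (ρ (D.inv' g * y₀) w₁) := by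
    intro g
    by_cases hg : l (ρ g w₁) = 0
    · by_cases hg' : l (ρ (D.inv' g * y₀) w₁) = 0
      · rw [hg, hg']
      · exfalso
        have h1 := key _ hg'
        have h2 : D.inv' (D.inv' g * y₀) * y₀ = g * (D.inv' y₀ * y₀) := by
          rw [_root_.map_mul, D.inv'_inv', mul_assoc]
        have h4 := D.symInv_symInv x₁
        rw [hj₀, D.symInv_conj, hj₀] at h4
        rw [h2, hright g (D.inv' y₀ * y₀) (by
          nth_rw 2 [← h4]
          group)] at h1
        exact hg' (h1.trans hg)
    · exact key g hg
  have h0 : l w₁ ≠ 0 := hg₁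
  refine hρ.repIso_of_coeff rfl (l := l) (l' := l) (v := w₁)
    (v' := ρ y₀ w₁) (fun g => ?_) h0
  rw [hall g, _root_.map_mul, Module.End.mul_apply]
  rfl

theorem repIso_dual_comp_θinv [Fintype Γ] [FiniteDimensional ℂ X] (hρ : IsIrred ρ)
    {l : Module.Dual ℂ X} (hl : ∀ u ∈ D.U, ∀ v, l (ρ u v) = D.χ u * l v) {v₀ : X}
    (hv₀ : ∀ u ∈ D.U, ρ u v₀ = D.χ u • v₀) (h0 : l v₀ ≠ 0) :
    RepIso ρ (Representation.dual (ρ.comp D.θinv)) := by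
  refine hρ.repIso_of_coeff Subspace.dual_finrank_eq.symm (l := l)
    (l' := Module.Dual.eval ℂ X v₀) (v := v₀) (v' := l) (fun g => ?_) h0
  rw [D.coeff_θ hl hv₀]
  show _ = l (ρ (D.θ (g⁻¹)⁻¹) v₀)
  rw [inv_inv]

/-- An irreducible generic representation distinguished by the centralizer of an involution is
self-dual. -/
theorem repIso_dual [Finite Γ] [FiniteDimensional ℂ X] (hρ : IsIrred ρ) {v₀ : X} (h0 : v₀ ≠ 0)
    (hv₀ : ∀ u ∈ D.U, ρ u v₀ = D.χ u • v₀) {x₀ : Γ} (hx₀ : x₀ * x₀ = 1) {w : X}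
    (hw0 : w ≠ 0) (hw : ∀ h, h * x₀ = x₀ * h → ρ h w = w) : RepIso ρ ρ.dual := by
  have : Fintype Γ := Fintype.ofFinite Γ
  obtain ⟨l, hl0, hl⟩ := D.exists_functional h0 hv₀
  have hl1 : l ≠ 0 := fun h => hl0 (by rw [h, LinearMap.zero_apply])
  have h1 : RepIso ρ (ρ.comp D.θinv) := by
    refine (D.repIso_comp_inv' hρ hl1 hl hx₀ hw0 hw).trans
      ⟨LinearEquiv.ofLinearMap (ρ D.d) (ρ D.d) ?_ ?_, fun g v => ?_⟩
    · rw [← Module.End.mul_eq_comp, ← _root_.map_mul, D.d_sq, _root_.map_one]; rfl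
    · rw [← Module.End.mul_eq_comp, ← _root_.map_mul, D.d_sq, _root_.map_one]; rfl
    · show ρ D.d (ρ (D.d * D.θ g⁻¹ * D.d) v) = ρ (D.θ g⁻¹) (ρ D.d v)
      rw [← Module.End.mul_apply, ← Module.End.mul_apply, ← _root_.map_mul, ← _root_.map_mul,
        ← mul_assoc, ← mul_assoc, D.d_sq, one_mul]
  exact (D.repIso_dual_comp_θinv hρ hl hv₀ hl0).trans h1.dual

end FlipDatum

end FlipDatum

section Layered

/-- A permutation descending only by unit steps reverses consecutive intervals, hence is an
involution; functions constant along the unit descents are invariant under it. -/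
theorem layered_involutive {n : ℕ} {β : Type*} (v : Equiv.Perm (Fin n)) (t : Fin n → β)
    (H : ∀ i j : Fin n, (i : ℕ) + 1 = j → v j < v i → (v i : ℕ) = v j + 1 ∧ t i = t j)
    (i : Fin n) : v (v i) = i ∧ t (v i) = t i := by
  have main : ∀ d a : ℕ, a + d = n → (∀ i : Fin n, (i : ℕ) < a ↔ (v i : ℕ) < a) →
      ∀ i : Fin n, a ≤ (i : ℕ) → v (v i) = i ∧ t (v i) = t i := by
    intro d
    induction d using Nat.strong_induction_on with
    | _ d ih =>
    intro a had ha i hai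
    have han : a < n := lt_of_le_of_lt hai i.2
    obtain ⟨p, hp⟩ : ∃ p, v p = (⟨a, han⟩ : Fin n) := ⟨v.symm ⟨a, han⟩, v.apply_symm_apply _⟩
    have hpa : (v p : ℕ) = a := by rw [hp]
    have hap : a ≤ (p : ℕ) := by
      by_contra! h
      have := (ha p).mp h
      omega
    have claim : ∀ s : ℕ, ∀ j : Fin n, (j : ℕ) + s = p → a ≤ (j : ℕ) →
        (v j : ℕ) = a + s ∧ t j = t p := by
      intro s
      induction s using Nat.strong_induction_on with
      | _ s ihs =>
      intro j hj haj
      rcases Nat.eq_zero_or_pos s with rfl | hs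
      · have : j = p := Fin.ext (by simpa using hj)
        subst this
        exact ⟨hpa, rfl⟩
      · have hpn := p.2
        obtain ⟨j', hj'⟩ : ∃ j' : Fin n, (j' : ℕ) = j + 1 := ⟨⟨j + 1, by omega⟩, rfl⟩
        obtain ⟨h1, h2⟩ := ihs (s - 1) (by omega) j' (by omega) (by omega)
        have hne : v j' ≠ v j := fun h => by
          have := congrArg Fin.val (v.injective h); omega
        rcases lt_or_gt_of_ne hne with h | h
        · obtain ⟨h3, h4⟩ := H j j' hj'.symm h
          exact ⟨by omega, h4.trans h2⟩
        · exfalso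
          have h5 : a ≤ (v j : ℕ) := by
            by_contra! h6
            have := (ha j).mpr h6
            omega
          have h7 : (v j : ℕ) < v j' := h
          obtain ⟨s', hs'⟩ : ∃ s', (v j : ℕ) = a + s' := ⟨v j - a, by omega⟩
          obtain ⟨j'', hj''⟩ : ∃ j'' : Fin n, (j'' : ℕ) + s' = p :=
            ⟨⟨p - s', by omega⟩, by simp only; omega⟩
          obtain ⟨h8, -⟩ := ihs s' (by omega) j'' hj'' (by omega)
          have h9 := v.injective (Fin.ext (h8.trans hs'.symm))
          rw [h9] at hj''
          omega
    have hrange : ∀ i : Fin n, a ≤ (i : ℕ) → (i : ℕ) ≤ p → (v i : ℕ) = a + (p - i) ∧ t i = t p :=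
      fun i h1 h2 => claim (p - i) i (by omega) h1
    by_cases hip : (i : ℕ) ≤ p
    · obtain ⟨h1, h2⟩ := hrange i hai hip
      obtain ⟨h3, h4⟩ := hrange (v i) (by omega) (by omega)
      exact ⟨Fin.ext (by omega), h4.trans h2.symm⟩
    · refine ih (n - (p + 1)) (by omega) (p + 1) (by omega) (fun j => ⟨fun hj => ?_, fun hj => ?_⟩)
        i (by omega)
      · by_cases hja : (j : ℕ) < a
        · have := (ha j).mp hja
          omega
        · have := (hrange j (by omega) (by omega)).1
          omega
      · by_cases hja : (v j : ℕ) < a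
        · have := (ha j).mpr hja
          omega
        · obtain ⟨j', hj'⟩ : ∃ j' : Fin n, (j' : ℕ) = a + (p - v j) := by
            have := p.2
            exact ⟨⟨a + (p - v j), by omega⟩, rfl⟩
          have h1 := (hrange j' (by omega) (by omega)).1
          have h2 := v.injective (a₁ := j') (a₂ := j) (Fin.ext (by omega))
          rw [← h2]
          omega
  exact main n 0 (by omega) (fun i => by simp) i (Nat.zero_le _)

end Layered

section Flip

variable {n : ℕ} {K : Type*} [Field K]

/-- Transposition along the antidiagonal. -/
def revT (M : Matrix (Fin n) (Fin n) K) : Matrix (Fin n) (Fin n) K :=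
  Mᵀ.submatrix Fin.rev Fin.rev

theorem revT_apply (M : Matrix (Fin n) (Fin n) K) (i j : Fin n) :
    revT M i j = M j.rev i.rev := rfl

theorem revT_mul (M N : Matrix (Fin n) (Fin n) K) : revT (M * N) = revT N * revT M := by
  rw [revT, Matrix.transpose_mul]
  exact (Matrix.submatrix_mul_equiv Nᵀ Mᵀ Fin.rev Fin.revPerm Fin.rev).symm

theorem revT_one : revT (1 : Matrix (Fin n) (Fin n) K) = 1 := by
  rw [revT, Matrix.transpose_one]
  exact Matrix.submatrix_one_equiv Fin.revPerm

/-- Transposition along the antidiagonal on invertible matrices. -/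
def revTGL (g : GL (Fin n) K) : GL (Fin n) K where
  val := revT (g : Matrix (Fin n) (Fin n) K)
  inv := revT ((g⁻¹ : GL (Fin n) K) : Matrix (Fin n) (Fin n) K)
  val_inv := by rw [← revT_mul, ← Units.val_mul, inv_mul_cancel, Units.val_one, revT_one]
  inv_val := by rw [← revT_mul, ← Units.val_mul, mul_inv_cancel, Units.val_one, revT_one]

theorem revTGL_val (g : GL (Fin n) K) :
    (revTGL g : Matrix (Fin n) (Fin n) K) = revT (g : Matrix (Fin n) (Fin n) K) := rfl

theorem revTGL_mul (g h : GL (Fin n) K) : revTGL (g * h) = revTGL h * revTGL g :=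
  Units.ext (revT_mul _ _)

theorem revTGL_revTGL (g : GL (Fin n) K) : revTGL (revTGL g) = g :=
  Units.ext (by ext i j; simp [revTGL_val, revT_apply])

theorem revTGL_mem {u : GL (Fin n) K} (hu : u ∈ bunip K (id : Fin n → Fin n)) :
    revTGL u ∈ bunip K (id : Fin n → Fin n) := by
  rw [mem_bunip_iff] at hu ⊢
  intro i j hij
  rw [revTGL_val, revT_apply, hu j.rev i.rev (by simpa [Fin.rev_lt_rev] using hij)]
  simp only [Matrix.one_apply, Fin.rev_inj, eq_comm]

theorem superSum_revT (M : Matrix (Fin n) (Fin n) K) : superSum (revT M) = superSum M := by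
  rw [superSum, superSum, Finset.sum_comm]
  refine Fintype.sum_equiv Fin.revPerm _ _ fun j => Fintype.sum_equiv Fin.revPerm _ _ fun i => ?_
  rw [revT_apply, Fin.revPerm_apply, Fin.revPerm_apply, Fin.val_rev, Fin.val_rev]
  have hi := i.2
  have hj := j.2
  by_cases h : (i : ℕ) + 1 = j
  · rw [if_pos h, if_pos (by omega)]
  · rw [if_neg h, if_neg (by omega)]

/-- The diagonal matrix of alternating signs. -/
def signGL (n : ℕ) (K : Type*) [Field K] : GL (Fin n) K where
  val := Matrix.diagonal fun i => (-1) ^ (i : ℕ)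
  inv := Matrix.diagonal fun i => (-1) ^ (i : ℕ)
  val_inv := by simp [Matrix.diagonal_mul_diagonal, ← mul_pow]
  inv_val := by simp [Matrix.diagonal_mul_diagonal, ← mul_pow]

theorem signGL_val : (signGL n K : Matrix (Fin n) (Fin n) K) =
    Matrix.diagonal fun i : Fin n => (-1) ^ (i : ℕ) := rfl

theorem signGL_sq : signGL n K * signGL n K = 1 :=
  Units.ext (signGL n K).val_inv

theorem signGL_conj_apply (g : GL (Fin n) K) (i j : Fin n) :
    ((signGL n K * g * signGL n K : GL (Fin n) K) : Matrix (Fin n) (Fin n) K) i j =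
      (-1) ^ (i : ℕ) * (g : Matrix (Fin n) (Fin n) K) i j * (-1) ^ (j : ℕ) := by
  rw [Units.val_mul, Units.val_mul, signGL_val, Matrix.mul_diagonal, Matrix.diagonal_mul]

/-- A central sign. -/
def centralSign (n : ℕ) (K : Type*) [Field K] : GL (Fin n) K := (-1) ^ (n - 1)

theorem revTGL_signGL : revTGL (signGL n K) = centralSign n K * signGL n K := by
  refine Units.ext (Matrix.ext fun i j => ?_)
  have hc : ((centralSign n K : GL (Fin n) K) : Matrix (Fin n) (Fin n) K) =
      Matrix.diagonal fun _ => (-1) ^ (n - 1) := by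
    rw [centralSign, Units.val_pow_eq_pow_val, Units.val_neg, Units.val_one,
      ← Matrix.diagonal_one, Matrix.diagonal_neg, Matrix.diagonal_pow]
    rfl
  rw [Units.val_mul, hc, revTGL_val, revT_apply, signGL_val, Matrix.diagonal_mul_diagonal,
    Matrix.diagonal_apply, Matrix.diagonal_apply]
  by_cases h : i = j
  · subst h
    rw [if_pos rfl, if_pos rfl, Fin.val_rev, ← pow_add]
    have hi := i.2
    rw [show n - 1 + (i : ℕ) = n - ((i : ℕ) + 1) + 2 * i by omega, pow_add, pow_mul]
    simp
  · rw [if_neg h, if_neg fun h' => h (Fin.rev_injective h').symm]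

theorem superSum_signGL_conj (u : GL (Fin n) K) :
    superSum ((signGL n K * u * signGL n K : GL (Fin n) K) : Matrix (Fin n) (Fin n) K) =
      - superSum (u : Matrix (Fin n) (Fin n) K) := by
  rw [eq_neg_iff_add_eq_zero, ← superSum_add]
  refine superSum_eq_zero fun i j hij => ?_
  rw [Matrix.add_apply, signGL_conj_apply, ← hij, pow_succ]
  have : ((-1 : K) ^ (i : ℕ)) * (-1) ^ (i : ℕ) = 1 := by rw [← mul_pow]; simp
  linear_combination (-(u : Matrix (Fin n) (Fin n) K) i j) * this

theorem signGL_conj_mem {u : GL (Fin n) K} (hu : u ∈ bunip K (id : Fin n → Fin n)) :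
    signGL n K * u * signGL n K ∈ bunip K (id : Fin n → Fin n) := by
  have hd : (signGL n K)⁻¹ = signGL n K := inv_eq_of_mul_eq_one_right signGL_sq
  have := conj_mem_bunip (p := signGL n K) (h := (id : Fin n → Fin n)) (by
    rw [mem_bpar, signGL_val]
    exact Matrix.blockTriangular_diagonal _) hu
  rwa [hd] at this

/-- The monomial part of an admissible double coset is symmetric. -/
theorem monomial_revT_eq {ψ : AddChar K ℂ} (hψ : ψ.IsPrimitive) {m : GL (Fin n) K}
    {w : Equiv.Perm (Fin n)} {t : Fin n → K} (ht : ∀ j, t j ≠ 0)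
    (hm : ∀ i j, (m : Matrix (Fin n) (Fin n) K) i j = if i = w j then t j else 0)
    (hadm : ∀ u ∈ bunip K (id : Fin n → Fin n), ∀ u' ∈ bunip K (id : Fin n → Fin n),
      u' * m = m * u → ψ (superSum (u' : Matrix (Fin n) (Fin n) K)) =
        ψ (superSum (u : Matrix (Fin n) (Fin n) K))) : revTGL m = m := by
  have hstep : ∀ i j : Fin n, (i : ℕ) + 1 = j → w i < w j → (w j : ℕ) = w i + 1 ∧ t i = t j := by
    intro i j hij hw
    have hsingle : ∀ (a b : Fin n) (x : K), a < b → StrictBlock id (Matrix.single a b x) := by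
      intro a b x hab a' b' h'
      refine Matrix.single_apply_of_ne _ _ _ _ _ fun h => h' ?_
      rw [← h.1, ← h.2]; exact hab
    have hsup : ∀ (a b : Fin n) (x : K), superSum (1 + Matrix.single a b x) =
        if (a : ℕ) + 1 = b then x else 0 := by
      intro a b x
      rw [superSum_add, superSum_one, zero_add, superSum, Finset.sum_eq_single a,
        Finset.sum_eq_single b, Matrix.single_apply_same]
      · intro c _ hc
        rw [Matrix.single_apply_of_ne _ _ _ _ _ fun h => hc h.2.symm, ite_self]
      · simp
      · intro c _ hc
        refine Finset.sum_eq_zero fun e _ => ?_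
        rw [Matrix.single_apply_of_ne _ _ _ _ _ fun h => hc h.1.symm, ite_self]
      · simp
    have hx : ∀ x : K, ψ (if (w i : ℕ) + 1 = w j then x * t i / t j else 0) = ψ x := by
      intro x
      have hij' : i < j := Fin.lt_def.mpr (by omega)
      obtain ⟨u, hu, huv⟩ := strictBlock_transvection_mem (hsingle i j x hij')
      obtain ⟨u', hu', huv'⟩ := strictBlock_transvection_mem
        (hsingle (w i) (w j) (x * t i / t j) hw)
      have := hadm u hu u' hu' (Units.ext (by
        rw [Units.val_mul, Units.val_mul, huv, huv', Matrix.add_mul, Matrix.mul_add,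
          Matrix.one_mul, Matrix.mul_one]
        congr 1
        ext a b
        by_cases ha : a = w i
        · subst ha
          rw [Matrix.single_mul_apply_same, hm]
          by_cases hb : b = j
          · subst hb
            rw [Matrix.mul_single_apply_same, hm, if_pos rfl, if_pos rfl,
              div_mul_cancel₀ _ (ht b), mul_comm]
          · rw [Matrix.mul_single_apply_of_ne _ _ _ _ _ hb, if_neg, mul_zero]
            exact fun h => hb (w.injective h).symm
        · rw [Matrix.single_mul_apply_of_ne _ _ _ _ _ ha]
          by_cases hb : b = j
          · subst hb
            rw [Matrix.mul_single_apply_same, hm, if_neg ha, zero_mul]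
          · rw [Matrix.mul_single_apply_of_ne _ _ _ _ _ hb]))
      rw [huv, huv', hsup, hsup, if_pos hij] at this
      exact this
    have hstep1 : (w i : ℕ) + 1 = w j := by
      by_contra hne
      refine hψ one_ne_zero (DFunLike.ext _ _ fun x => ?_)
      have := hx x
      rw [if_neg hne, AddChar.map_zero_eq_one] at this
      rw [AddChar.mulShift_apply, one_mul, ← this, AddChar.one_apply]
    refine ⟨hstep1.symm, ?_⟩
    by_contra hne
    refine hψ (a := t i / t j - 1) (fun h => hne ?_) (DFunLike.ext _ _ fun x => ?_)
    · rw [sub_eq_zero, div_eq_one_iff_eq (ht j)] at h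
      exact h
    · have := hx x
      rw [if_pos hstep1] at this
      rw [AddChar.mulShift_apply, show (t i / t j - 1) * x = x * t i / t j - x by ring,
        AddChar.map_sub_eq_div, this, AddChar.one_apply]
      exact div_self (ψ.val_isUnit x).ne_zero
  have hlay := layered_involutive (w.trans Fin.revPerm) t fun i j hij hv => by
    simp only [Equiv.trans_apply, Fin.revPerm_apply, Fin.rev_lt_rev] at hv ⊢
    obtain ⟨h1, h2⟩ := hstep i j hij hv
    refine ⟨?_, h2⟩
    have := (w i).2
    have := (w j).2
    rw [Fin.val_rev, Fin.val_rev]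
    omega
  simp only [Equiv.trans_apply, Fin.revPerm_apply] at hlay
  refine Units.ext (Matrix.ext fun i j => ?_)
  rw [revTGL_val, revT_apply, hm, hm]
  by_cases h : i = w j
  · subst h
    obtain ⟨h1, h2⟩ := hlay j
    rw [if_pos rfl, if_pos, h2]
    rw [← Fin.rev_inj, Fin.rev_rev, h1]
  · rw [if_neg h, if_neg fun h' => h ?_]
    have h1 := (hlay j).1
    rw [← Fin.rev_inj, Fin.rev_rev] at h1
    rw [← h1] at h'
    have := w.injective h'
    exact (Fin.rev_injective this).symm

theorem exists_flip_of_admissible {ψ : AddChar K ℂ} (hψ : ψ.IsPrimitive) {γ : GL (Fin n) K}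
    (hadm : ∀ u ∈ bunip K (id : Fin n → Fin n), ∀ u' ∈ bunip K (id : Fin n → Fin n),
      u' * γ = γ * u → ψ (superSum (u' : Matrix (Fin n) (Fin n) K)) =
        ψ (superSum (u : Matrix (Fin n) (Fin n) K))) :
    ∃ a ∈ bunip K (id : Fin n → Fin n), ∃ b ∈ bunip K (id : Fin n → Fin n),
      revTGL γ = a * γ * b ∧ ψ (superSum (a : Matrix (Fin n) (Fin n) K)) *
        ψ (superSum (b : Matrix (Fin n) (Fin n) K)) = 1 := by
  obtain ⟨u₁, hu₁, u₂, hu₂, m, w, t, ht, hm, rfl⟩ := bruhat γ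
  have hflip : revTGL m = m := monomial_revT_eq hψ ht hm fun u hu u' hu' huu => by
    have := hadm (u₂⁻¹ * u * u₂) (mul_mem (mul_mem (inv_mem hu₂) hu) hu₂) (u₁ * u' * u₁⁻¹)
      (mul_mem (mul_mem hu₁ hu') (inv_mem hu₁)) (by
        calc u₁ * u' * u₁⁻¹ * (u₁ * m * u₂) = u₁ * (u' * m) * u₂ := by group
          _ = _ := by rw [huu]; group)
    rw [superSum_mul (mul_mem hu₁ hu') (inv_mem hu₁), superSum_mul hu₁ hu', superSum_inv hu₁,
      superSum_mul (mul_mem (inv_mem hu₂) hu) hu₂, superSum_mul (inv_mem hu₂) hu,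
      superSum_inv hu₂] at this
    convert this using 2 <;> ring
  refine ⟨revTGL u₂ * u₁⁻¹, mul_mem (revTGL_mem hu₂) (inv_mem hu₁), u₂⁻¹ * revTGL u₁,
    mul_mem (inv_mem hu₂) (revTGL_mem hu₁), ?_, ?_⟩
  · rw [revTGL_mul, revTGL_mul, hflip]
    group
  · rw [superSum_mul (revTGL_mem hu₂) (inv_mem hu₁), superSum_mul (inv_mem hu₂) (revTGL_mem hu₁),
      superSum_inv hu₁, superSum_inv hu₂, revTGL_val, revTGL_val, superSum_revT, superSum_revT,
      ← AddChar.map_add_eq_mul]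
    rw [show ∀ x y : K, x + -y + (-x + y) = 0 by intros; ring, AddChar.map_zero_eq_one]

/-- The flip datum on the general linear group given by a primitive character. -/
def flipDatum {ψ : AddChar K ℂ} (hψ : ψ.IsPrimitive) (k : ℕ)
    (hk : ∀ u ∈ bunip K (id : Fin n → Fin n), u ^ (2 * k + 1) = 1) :
    FlipDatum (GL (Fin n) K) where
  U := bunip K (id : Fin n → Fin n)
  χ u := ψ (superSum (u : Matrix (Fin n) (Fin n) K))
  χ_mul u hu u' hu' := by rw [superSum_mul hu hu', AddChar.map_add_eq_mul]
  χ_one := by rw [Units.val_one, superSum_one, AddChar.map_zero_eq_one]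
  θ := revTGL
  θ_mul := revTGL_mul
  θ_θ := revTGL_revTGL
  flip_adm _ h := exists_flip_of_admissible hψ h
  d := signGL n K
  z := centralSign n K
  d_sq := signGL_sq
  z_sq := by rw [centralSign, ← pow_add, ← two_mul, pow_mul, neg_one_sq, one_pow]
  z_comm g := by
    have : Commute (-1 : GL (Fin n) K) g := (Commute.neg_one_left g)
    exact (this.pow_left (n - 1)).eq
  θ_d := revTGL_signGL
  d_mem _ hu := signGL_conj_mem hu
  χ_d u hu := by
    rw [superSum_signGL_conj, ← AddChar.map_add_eq_mul, neg_add_cancel, AddChar.map_zero_eq_one]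
  k := k
  pow_eq := hk

/-- A cuspidal representation distinguished by the centralizer of an involution is self-dual. -/
theorem IsCuspidal.repIso_dual {V : Type*} [AddCommGroup V] [Module ℂ V] [FiniteDimensional ℂ V]
    {K : Type*} [Field K] [Fintype K] [DecidableEq K] (hodd : Odd (Nat.card K))
    {ρ : Representation ℂ (GL (Fin n) K) V} (hρc : IsCuspidal ρ) (hρ : IsIrred ρ)
    {x₀ : GL (Fin n) K} (hx₀ : x₀ * x₀ = 1) {w : V} (hw0 : w ≠ 0)
    (hw : ∀ h, h * x₀ = x₀ * h → ρ h w = w) : RepIso ρ ρ.dual := by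
  obtain ⟨k, hk⟩ := exists_odd_pow_bunip hodd n
  have hψ := AddChar.FiniteField.primitiveChar_to_Complex_isPrimitive K
  obtain ⟨v₀, h0, hv₀⟩ := exists_generic_vector hρc hρ.1 hψ
  exact (flipDatum hψ k (hk id)).repIso_dual hρ h0 hv₀ hx₀ hw0 hw

end Flip

section Distinction

variable {c r : ℕ} {K : Type*} [Field K] {ι : Type*} [Fintype ι] [DecidableEq ι]
  {R : GL (Fin r) K →* Matrix ι ι ℂ}

/-- A vector fixed by the elements of the parabolic subgroup commuting with `A`. -/
def CentFixed (R : GL (Fin r) K →* Matrix ι ι ℂ) (A : GL (Fin c × Fin r) K)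
    (v : (Fin c → ι) → ℂ) : Prop :=
  ∀ p : pblk c r K, (p : GL (Fin c × Fin r) K) * A = A * p → sig R p *ᵥ v = v

theorem CentFixed.conj {A : GL (Fin c × Fin r) K} {v : (Fin c → ι) → ℂ} (hv : CentFixed R A v)
    (p : pblk c r K) :
    CentFixed R ((p : GL (Fin c × Fin r) K)⁻¹ * A * (p : GL (Fin c × Fin r) K)) (sig R p⁻¹ *ᵥ v) := by
  intro s hs
  have h := hv (p * s * p⁻¹) (by
    simp only [Subgroup.coe_mul, Subgroup.coe_inv]
    calc (p : GL (Fin c × Fin r) K) * s * (p : GL (Fin c × Fin r) K)⁻¹ * A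
        = p * (s * ((p : GL (Fin c × Fin r) K)⁻¹ * A * (p : GL (Fin c × Fin r) K))) * (p : GL (Fin c × Fin r) K)⁻¹ := by group
      _ = _ := by rw [hs]; group)
  conv_rhs => rw [← h]
  rw [mulVec_mulVec, mulVec_mulVec, ← _root_.map_mul, ← _root_.map_mul]
  congr 2
  group

theorem CentFixed.sig_sqrt {A : GL (Fin c × Fin r) K} {v : (Fin c → ι) → ℂ} (hA : A * A = 1)
    (hv : CentFixed R A v) {k : ℕ} {n n' : pblk c r K}
    (hn : (n : GL (Fin c × Fin r) K) * A = A * n') (hz : (n⁻¹ * n') ^ (2 * k + 1) = 1) :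
    sig R (n * (n⁻¹ * n') ^ (k + 1)) *ᵥ v = v := by
  refine hv _ ?_
  have := mul_pow_succ_comm_of_involution (k := k) hA hn (by
    have := congrArg (Subtype.val) hz
    simpa using this)
  simpa using this

theorem CentFixed.sig_of_conj_mem_ublk {A : GL (Fin c × Fin r) K} {v : (Fin c → ι) → ℂ}
    (hA : A * A = 1) (hv : CentFixed R A v) {k : ℕ}
    (hk : ∀ u ∈ ublk c r K, u ^ (2 * k + 1) = 1) {n n' : pblk c r K}
    (hn : (n : GL (Fin c × Fin r) K) * A = A * n') (hn' : (n' : GL (Fin c × Fin r) K) ∈ ublk c r K) :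
    sig R n *ᵥ v = v := by
  have hnk : n ^ (2 * k + 1) = 1 := by
    have h : (n : GL (Fin c × Fin r) K) = A * n' * A⁻¹ := by rw [← hn, mul_inv_cancel_right]
    refine Subtype.ext ?_
    rw [SubmonoidClass.coe_pow, h, conj_pow, hk _ hn']
    simp
  have hzk : (n⁻¹ * n') ^ (2 * k + 1) ∈ (ublk c r K).comap (pblk c r K).subtype := by
    rw [Subgroup.mem_comap, Subgroup.subtype_apply, mem_ublk_iff]
    intro a
    rw [map_pow, _root_.map_mul, dblk_of_mem_ublk hn', mul_one, _root_.map_inv, inv_pow, ← map_pow,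
      hnk, _root_.map_one, inv_one]
  have hz : (n⁻¹ * n') ^ (2 * (2 * k ^ 2 + 2 * k) + 1) = 1 := by
    rw [show 2 * (2 * k ^ 2 + 2 * k) + 1 = (2 * k + 1) * (2 * k + 1) by ring, pow_mul]
    exact Subtype.ext (hk _ hzk)
  have h := hv.sig_sqrt hA hn hz
  have hs : sig R (n * (n⁻¹ * n') ^ (2 * k ^ 2 + 2 * k + 1)) = sig R (n ^ (k + 1)) := by
    have h1 : sig R (n⁻¹ * n') = sig R n⁻¹ := by
      rw [_root_.map_mul, sig_of_mem_ublk R hn', mul_one]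
    rw [_root_.map_mul, map_pow, h1, ← map_pow, ← _root_.map_mul]
    congr 1
    rw [inv_pow, mul_inv_eq_iff_eq_mul, ← pow_add,
      show k + 1 + (2 * k ^ 2 + 2 * k + 1) = (2 * k + 1) * (k + 1) + 1 by ring, pow_succ, pow_mul,
      hnk, one_pow, one_mul]
  rw [hs] at h
  have h2 : sig R n = sig R (n ^ (k + 1)) * sig R (n ^ (k + 1)) := by
    rw [← _root_.map_mul, ← pow_add, show k + 1 + (k + 1) = 2 * k + 1 + 1 by ring, pow_succ, hnk,
      one_mul]
  rw [h2, ← mulVec_mulVec, h, h]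

/-- A vector fixed by the centralizer of an involution forces this involution into a cell indexed
by a permutation of the blocks. -/
theorem CentFixed.exists_bperm (hR : MatCuspidal R) {A : GL (Fin c × Fin r) K}
    {v : (Fin c → ι) → ℂ} (hA : A * A = 1) (hv : CentFixed R A v) (hv0 : v ≠ 0) {k : ℕ}
    (hk : ∀ u ∈ ublk c r K, u ^ (2 * k + 1) = 1) :
    ∃ (w : Equiv.Perm (Fin c)) (p : pblk c r K) (v' : (Fin c → ι) → ℂ),
      bpermGL c r K w * p * (bpermGL c r K w * p) = 1 ∧
      CentFixed R (bpermGL c r K w * (p : GL (Fin c × Fin r) K)) v' ∧ v' ≠ 0 := by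
  rcases cell_vanishing hR A with ⟨p, hp, p', hp', w, h⟩ | h
  · have hc := hv.conj ⟨p, hp⟩
    have hA' : p⁻¹ * A * p = bpermGL c r K w * ((⟨p', hp'⟩ * ⟨p, hp⟩ : pblk c r K) : GL (Fin c × Fin r) K) := by
      rw [h, Subgroup.coe_mul]
      group
    rw [show ((⟨p, hp⟩ : pblk c r K) : GL (Fin c × Fin r) K) = p from rfl, hA'] at hc
    refine ⟨w, _, _, ?_, hc, fun h0 => hv0 ?_⟩
    · rw [← hA']
      calc p⁻¹ * A * p * (p⁻¹ * A * p) = p⁻¹ * (A * A) * p := by group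
        _ = 1 := by rw [hA]; group
    · have := congrArg (sig R ⟨p, hp⟩ *ᵥ ·) h0
      simpa [mulVec_mulVec, ← _root_.map_mul] using this
  · refine absurd (h v fun n hn => ?_) hv0
    exact hv.sig_of_conj_mem_ublk hA hk (n' := ⟨A⁻¹ * n * A, bunip_le_bpar _ hn⟩) (by
      simp only [← mul_assoc, mul_inv_cancel, one_mul]) hn

theorem dblk_bperm_involution [NeZero r] {w : Equiv.Perm (Fin c)} {p : pblk c r K}
    (h : bpermGL c r K w * p * (bpermGL c r K w * p) = 1) :
    (∀ a, w (w a) = a) ∧ ∀ a, dblk (w a) p = (dblk a p)⁻¹ := by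
  have hp : (p : GL (Fin c × Fin r) K) = bpermGL c r K w⁻¹ * (p⁻¹ : pblk c r K) * bpermGL c r K w⁻¹ := by
    rw [_root_.map_inv, Subgroup.coe_inv]
    calc (p : GL (Fin c × Fin r) K)
        = (bpermGL c r K w)⁻¹ * (p : GL (Fin c × Fin r) K)⁻¹ * (bpermGL c r K w)⁻¹ *
          (bpermGL c r K w * p * (bpermGL c r K w * p)) := by group
      _ = _ := by rw [h, mul_one]
  have hent : ∀ (a : Fin c) (i j : Fin r), (dblk a p : Matrix (Fin r) (Fin r) K) i j =
      (((p⁻¹ : pblk c r K) : GL (Fin c × Fin r) K) : Matrix (Fin c × Fin r) (Fin c × Fin r) K)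
        (w a, i) (w⁻¹ a, j) := fun a i j => by
    rw [dblk_apply, hp, Units.val_mul, mul_bpermGL_apply, Units.val_mul, bpermGL_mul_apply, inv_inv]
  have hle : ∀ a, w a ≤ w⁻¹ a := fun a => by
    by_contra hlt
    rw [not_le] at hlt
    refine (dblk a p).ne_zero (Matrix.ext fun i j => ?_)
    rw [hent]
    exact mem_bpar.mp (p⁻¹).2 hlt
  have hle' : ∀ a, ((w (w a) : Fin c) : ℕ) ≤ a := fun a => by
    have := hle (w a)
    rwa [show w⁻¹ (w a) = a from w.symm_apply_apply a] at this
  have hww : ∀ a, w (w a) = a := fun a => by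
    have hs : ∑ a : Fin c, ((w (w a) : Fin c) : ℕ) = ∑ a : Fin c, (a : ℕ) :=
      Equiv.sum_comp (w.trans w) fun a : Fin c => (a : ℕ)
    exact Fin.ext ((Finset.sum_eq_sum_iff_of_le fun a _ => hle' a).mp hs a (Finset.mem_univ _))
  refine ⟨hww, fun a => ?_⟩
  rw [eq_inv_iff_mul_eq_one, ← inv_eq_iff_mul_eq_one, ← _root_.map_inv]
  ext i j
  rw [hent (a), show w⁻¹ a = w a from (Equiv.Perm.inv_eq_iff_eq).mpr (hww a).symm]
  rfl

theorem CentFixed.tens_mulVec {w : Equiv.Perm (Fin c)} {p : pblk c r K} {v : (Fin c → ι) → ℂ}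
    (hA : bpermGL c r K w * p * (bpermGL c r K w * p) = 1) (hw : ∀ a, w (w a) = a)
    (hv : CentFixed R (bpermGL c r K w * (p : GL (Fin c × Fin r) K)) v) {k : ℕ}
    (hk : ∀ u ∈ ublk c r K, u ^ (2 * k + 1) = 1) (m : Fin c → GL (Fin r) K)
    (hm : ∀ a, (dblk a p)⁻¹ * m a * dblk a p = m (w a)) :
    tens (fun a => R (m (w a))) *ᵥ v = v := by
  let n : pblk c r K := p⁻¹ * ⟨diagGL m, diagGL_mem m⟩ * p
  let n' : pblk c r K := ⟨diagGL (m ∘ w.symm), diagGL_mem _⟩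
  have hsymm : ∀ a, w.symm a = w a := fun a => by rw [Equiv.symm_apply_eq, hw]
  have hd : ∀ a, dblk a n = m (w a) := fun a => by
    rw [_root_.map_mul, _root_.map_mul, dblk_diagGL, _root_.map_inv, hm]
  have hd' : ∀ a, dblk a n' = m (w a) := fun a => by
    rw [dblk_diagGL, Function.comp_apply, hsymm]
  have hz : ((n⁻¹ * n' : pblk c r K) : GL (Fin c × Fin r) K) ∈ ublk c r K := by
    rw [mem_ublk_iff]
    intro a
    rw [_root_.map_mul, _root_.map_inv, hd, hd', inv_mul_cancel]
  have hn : (n : GL (Fin c × Fin r) K) * (bpermGL c r K w * p) = bpermGL c r K w * p * n' := by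
    have h1 : (p : GL (Fin c × Fin r) K) * (bpermGL c r K w * p) = (bpermGL c r K w)⁻¹ := by
      rw [eq_inv_iff_mul_eq_one, ← inv_eq_iff_mul_eq_one]
      rw [inv_eq_iff_mul_eq_one, ← hA]
      have := hA
      rw [mul_assoc, mul_eq_one_iff_eq_inv'] at this
      rw [this, hA, inv_mul_cancel]
    have h2 : bpermGL c r K w * p = (p : GL (Fin c × Fin r) K)⁻¹ * (bpermGL c r K w)⁻¹ := by
      rw [← h1, inv_mul_cancel_left]
    have h3 : diagGL m * (bpermGL c r K w)⁻¹ = (bpermGL c r K w)⁻¹ * diagGL (m ∘ w.symm) := by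
      rw [eq_inv_mul_iff_mul_eq, ← mul_assoc, diagGL_bperm, mul_inv_cancel_right]
    calc (n : GL (Fin c × Fin r) K) * (bpermGL c r K w * p)
        = (p : GL (Fin c × Fin r) K)⁻¹ * diagGL m * (p * (bpermGL c r K w * p)) := by
          simp only [n, Subgroup.coe_mul, Subgroup.coe_inv]
          group
      _ = (p : GL (Fin c × Fin r) K)⁻¹ * (bpermGL c r K w)⁻¹ * diagGL (m ∘ w.symm) := by
          rw [h1, mul_assoc, h3, mul_assoc]
      _ = _ := by rw [← h2]
  have h := hv.sig_sqrt hA hn (Subtype.ext (hk _ hz))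
  rw [_root_.map_mul, map_pow, sig_of_mem_ublk R hz, one_pow, mul_one, sig_apply] at h
  simpa only [hd] using h

theorem exists_invForm_of_tensor {Γ : Type*} [Group Γ] [Fintype Γ] {R : Γ →* Matrix ι ι ℂ}
    (hs : MatSchur R) {Y : Matrix ι ι ℂ} (hY0 : Y ≠ 0) (hY : ∀ h, R h * Y * (R h)ᵀ = Y) :
    ∃ B B', InvForm R B B' := by
  let C : Matrix ι ι ℂ → Matrix ι ι ℂ := fun N => ∑ h, (R h)ᵀ * N * R h
  have hC : ∀ N g, (R g)ᵀ * C N * R g = C N := fun N g => by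
    simp only [C, Finset.mul_sum, Finset.sum_mul]
    refine Fintype.sum_equiv (Equiv.mulRight g) _ _ fun h => ?_
    simp only [Equiv.coe_mulRight, _root_.map_mul, transpose_mul, Matrix.mul_assoc]
  have hinv : ∀ g, R g * R g⁻¹ = 1 := fun g => by
    rw [← _root_.map_mul, mul_inv_cancel, _root_.map_one]
  have hinv' : ∀ g, R g⁻¹ * R g = 1 := fun g => by
    rw [← _root_.map_mul, inv_mul_cancel, _root_.map_one]
  have hC' : ∀ N g, (R g)ᵀ * C N = C N * R g⁻¹ := fun N g => by
    conv_rhs => rw [← hC N g, Matrix.mul_assoc, hinv, Matrix.mul_one]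
  have hscal : ∀ N, ∃ z : ℂ, Y * C N = z • (1 : Matrix ι ι ℂ) := fun N => hs _ fun g => by
    have h1 : R g * Y = Y * (R g⁻¹)ᵀ := by
      conv_rhs => rw [← hY g, Matrix.mul_assoc, ← transpose_mul, hinv', transpose_one,
        Matrix.mul_one]
    rw [← Matrix.mul_assoc, h1, Matrix.mul_assoc, hC', inv_inv, Matrix.mul_assoc]
  have htr : ∀ N, (Y * C N).trace = Fintype.card Γ * (Y * N).trace := fun N => by
    simp only [C, Finset.mul_sum, trace_sum]
    have : ∀ h : Γ, (Y * ((R h)ᵀ * N * R h)).trace = (Y * N).trace := fun h => by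
      rw [← Matrix.mul_assoc, trace_mul_comm, ← Matrix.mul_assoc, ← Matrix.mul_assoc, hY]
    simp [this]
  obtain ⟨i, j, hij⟩ : ∃ i j, Y i j ≠ 0 := by
    by_contra! h
    exact hY0 (Matrix.ext h)
  obtain ⟨z, hz⟩ := hscal (Matrix.single j i 1)
  have hz0 : z ≠ 0 := by
    rintro rfl
    have h := htr (Matrix.single j i 1)
    rw [hz, zero_smul, trace_zero, trace_mul_single] at h
    simp [hij] at h
  have h1 : Y * (z⁻¹ • C (Matrix.single j i 1)) = 1 := by
    rw [Matrix.mul_smul, hz, smul_smul, inv_mul_cancel₀ hz0, one_smul]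
  refine ⟨z⁻¹ • C (Matrix.single j i 1), Y, mul_eq_one_comm.mp h1, h1, fun g => ?_⟩
  rw [Matrix.mul_smul, hC', Matrix.smul_mul]

/-- A `ρ`-primary representation with a vector fixed by the centralizer of an involution has a
self-dual `ρ`. -/
theorem exists_invForm [NeZero r] [Fintype K] [DecidableEq K] (hc : c ≠ 0) (hR : MatCuspidal R)
    (hs : MatSchur R)
    (hself : ∀ x₀ : GL (Fin r) K, x₀ * x₀ = 1 → ∀ u : ι → ℂ, u ≠ 0 →
      (∀ h, h * x₀ = x₀ * h → R h *ᵥ u = u) → ∃ B B', InvForm R B B')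
    {A : GL (Fin c × Fin r) K} {v : (Fin c → ι) → ℂ} (hA : A * A = 1) (hv : CentFixed R A v)
    (hv0 : v ≠ 0) {k : ℕ} (hk : ∀ u ∈ ublk c r K, u ^ (2 * k + 1) = 1) :
    ∃ B B', InvForm R B B' := by
  obtain ⟨w, p, v, hA, hv, hv0⟩ := hv.exists_bperm hR hA hv0 hk
  obtain ⟨hw, hd⟩ := dblk_bperm_involution hA
  have hfix := fun m => hv.tens_mulVec hA hw hk m
  obtain ⟨x, hx⟩ := Function.ne_iff.mp hv0
  by_cases hex : ∃ a, w a = a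
  · obtain ⟨a, ha⟩ := hex
    have hl := hd a
    rw [ha, eq_inv_iff_mul_eq_one] at hl
    refine hself _ hl (fun t => v (Function.update x a t)) (fun h0 => hx ?_) fun h hh => ?_
    · simpa using congrFun h0 (x a)
    · have hwa : ∀ b, b ≠ a → w b ≠ a := fun b hb h => hb (by rw [← hw b, h, ha])
      have h1 := hfix (Pi.mulSingle a h) fun b => by
        rcases eq_or_ne b a with rfl | hb
        · rw [ha, Pi.mulSingle_eq_same, mul_assoc, hh, inv_mul_cancel_left]
        · rw [Pi.mulSingle_eq_of_ne hb, Pi.mulSingle_eq_of_ne (hwa b hb)]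
          group
      have h2 : (fun b => R ((Pi.mulSingle a h : Fin c → GL (Fin r) K) (w b))) =
          Pi.mulSingle a (R h) := by
        funext b
        rcases eq_or_ne b a with rfl | hb
        · rw [ha, Pi.mulSingle_eq_same, Pi.mulSingle_eq_same]
        · rw [Pi.mulSingle_eq_of_ne (hwa b hb), Pi.mulSingle_eq_of_ne hb, _root_.map_one]
      rw [h2] at h1
      funext t
      have h3 := congrFun h1 (Function.update x a t)
      rw [tens_mulSingle_mulVec] at h3
      simpa using h3
  · push Not at hex
    obtain ⟨a⟩ : Nonempty (Fin c) := ⟨⟨0, Nat.pos_of_ne_zero hc⟩⟩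
    obtain ⟨b, hb⟩ : ∃ b, b = w a := ⟨_, rfl⟩
    have hba : b ≠ a := hb ▸ hex a
    have hwb : w b = a := by rw [hb, hw]
    have hdb : dblk b p = (dblk a p)⁻¹ := hb ▸ hd a
    have hwa : ∀ d, d ≠ b → w d ≠ a := fun d hd h => hd (by rw [← hw d, h, hb])
    have hwb' : ∀ d, d ≠ a → w d ≠ b := fun d hd h => hd (by rw [← hw d, h, hwb])
    obtain ⟨Y, hYv⟩ : ∃ Y : Matrix ι ι ℂ, ∀ s t,
        Y s t = v (Function.update (Function.update x a s) b t) :=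
      ⟨Matrix.of fun s t => v (Function.update (Function.update x a s) b t), fun _ _ => rfl⟩
    have hY : ∀ h, R ((dblk a p)⁻¹ * h * dblk a p) * Y * (R h)ᵀ = Y := fun h => by
      have h1 := hfix (Pi.mulSingle a h * Pi.mulSingle b ((dblk a p)⁻¹ * h * dblk a p)) fun d => by
        rw [Pi.mul_apply, Pi.mul_apply]
        rcases eq_or_ne d a with rfl | hda
        · rw [← hb, Pi.mulSingle_eq_same, Pi.mulSingle_eq_same, Pi.mulSingle_eq_of_ne hba,
            Pi.mulSingle_eq_of_ne hba.symm, mul_one, one_mul]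
        · rw [Pi.mulSingle_eq_of_ne hda, Pi.mulSingle_eq_of_ne (hwb' d hda), one_mul, mul_one]
          rcases eq_or_ne d b with rfl | hdb'
          · rw [hwb, Pi.mulSingle_eq_same, Pi.mulSingle_eq_same, hdb]
            group
          · rw [Pi.mulSingle_eq_of_ne hdb', Pi.mulSingle_eq_of_ne (hwa d hdb')]
            group
      have h2 : (fun d => R ((Pi.mulSingle a h * Pi.mulSingle b ((dblk a p)⁻¹ * h * dblk a p) :
          Fin c → GL (Fin r) K) (w d))) =
          Pi.mulSingle a (R ((dblk a p)⁻¹ * h * dblk a p)) * Pi.mulSingle b (R h) := by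
        funext d
        rw [Pi.mul_apply, Pi.mul_apply]
        rcases eq_or_ne d a with rfl | hda
        · rw [← hb, Pi.mulSingle_eq_same, Pi.mulSingle_eq_same, Pi.mulSingle_eq_of_ne hba,
            Pi.mulSingle_eq_of_ne hba.symm, mul_one, one_mul]
        · rw [Pi.mulSingle_eq_of_ne (hwb' d hda), Pi.mulSingle_eq_of_ne hda, one_mul, mul_one]
          rcases eq_or_ne d b with rfl | hdb'
          · rw [hwb, Pi.mulSingle_eq_same, Pi.mulSingle_eq_same]
          · rw [Pi.mulSingle_eq_of_ne hdb', Pi.mulSingle_eq_of_ne (hwa d hdb'), _root_.map_one]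
      rw [h2, tens_mul, ← mulVec_mulVec] at h1
      ext s t
      have h3 := congrFun h1 (Function.update (Function.update x a s) b t)
      rw [tens_mulSingle_mulVec] at h3
      simp only [tens_mulSingle_mulVec, Function.update_of_ne hba.symm,
        Function.update_self, Function.update_comm hba, Function.update_idem, ← hYv] at h3
      refine Eq.trans ?_ h3
      rw [Matrix.mul_assoc, Matrix.mul_apply]
      refine Finset.sum_congr rfl fun s' _ => ?_
      congr 1
      rw [Matrix.mul_apply]
      exact Finset.sum_congr rfl fun t' _ => mul_comm _ _
    have hinv : R (dblk a p)⁻¹ * R (dblk a p) = 1 := by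
      rw [← _root_.map_mul, inv_mul_cancel, _root_.map_one]
    have hinv' : R (dblk a p) * R (dblk a p)⁻¹ = 1 := by
      rw [← _root_.map_mul, mul_inv_cancel, _root_.map_one]
    refine exists_invForm_of_tensor hs (Y := R (dblk a p) * Y) (fun h0 => hx ?_) fun h => ?_
    · have h1 : Y = 0 := by
        rw [← Matrix.one_mul Y, ← hinv, Matrix.mul_assoc, h0, Matrix.mul_zero]
      simpa [hYv] using congrFun (congrFun h1 (x a)) (x b)
    · conv_rhs => rw [← hY h]
      simp only [_root_.map_mul, ← Matrix.mul_assoc]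
      rw [hinv', Matrix.one_mul]

end Distinction

section MatrixRepresentation

variable {Γ X : Type*} [Group Γ] [AddCommGroup X] [Module ℂ X] {ι : Type*} [Fintype ι]
  [DecidableEq ι] (b : Module.Basis ι ℂ X) (σ : Representation ℂ Γ X)

/-- The matrices of a representation in a basis. -/
def matRep : Γ →* Matrix ι ι ℂ :=
  ((LinearMap.toMatrixAlgEquiv b : Module.End ℂ X →* Matrix ι ι ℂ)).comp σ

theorem matRep_apply (g : Γ) : matRep b σ g = LinearMap.toMatrix b b (σ g) := rfl

theorem matRep_mulVec (g : Γ) (u : ι → ℂ) :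
    matRep b σ g *ᵥ u = b.equivFun (σ g (b.equivFun.symm u)) := by
  have h := LinearMap.toMatrix_mulVec_repr b b (σ g) (b.equivFun.symm u)
  rw [matRep_apply]
  rw [← b.equivFun_apply, b.equivFun.apply_symm_apply] at h
  rw [h, b.equivFun_apply]

theorem matRep_mulVec_eq_self {g : Γ} {u : ι → ℂ} :
    matRep b σ g *ᵥ u = u ↔ σ g (b.equivFun.symm u) = b.equivFun.symm u := by
  rw [matRep_mulVec, ← LinearEquiv.eq_symm_apply]

variable {b σ}

theorem IsIrred.matSchur [FiniteDimensional ℂ X] (hσ : IsIrred σ) : MatSchur (matRep b σ) := by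
  intro N hN
  obtain ⟨z, hz⟩ := hσ.schur (T := Matrix.toLin b b N) fun g v => by
    have h : Matrix.toLin b b N ∘ₗ σ g = σ g ∘ₗ Matrix.toLin b b N := by
      apply (LinearMap.toMatrix b b).injective
      rw [LinearMap.toMatrix_comp b b b, LinearMap.toMatrix_comp b b b, LinearMap.toMatrix_toLin,
        ← matRep_apply, hN]
    exact LinearMap.congr_fun h v
  refine ⟨z, ?_⟩
  rw [← LinearMap.toMatrix_toLin b b N, hz, _root_.map_smul, LinearMap.toMatrix_id]

theorem RepIso.exists_invForm (h : RepIso σ σ.dual) : ∃ B B', InvForm (matRep b σ) B B' := by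
  obtain ⟨e, he⟩ := h
  refine ⟨LinearMap.toMatrix b b.dualBasis e, LinearMap.toMatrix b.dualBasis b e.symm, ?_, ?_,
    fun g => ?_⟩
  · rw [← LinearMap.toMatrix_comp, LinearEquiv.comp_coe, e.symm_trans_self,
      LinearEquiv.refl_toLinearMap, LinearMap.toMatrix_id]
  · rw [← LinearMap.toMatrix_comp, LinearEquiv.comp_coe, e.self_trans_symm,
      LinearEquiv.refl_toLinearMap, LinearMap.toMatrix_id]
  · rw [matRep_apply, matRep_apply, ← LinearMap.toMatrix_transpose, ← LinearMap.toMatrix_comp,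
      ← LinearMap.toMatrix_comp]
    congr 1
    refine LinearMap.ext fun x => ?_
    have := he g⁻¹ x
    rw [LinearMap.comp_apply, LinearMap.comp_apply, LinearEquiv.coe_coe, this,
      Representation.dual_apply, inv_inv]

theorem IsCuspidal.matCuspidal {K : Type*} [Field K] {r : ℕ}
    {ρ : Representation ℂ (GL (Fin r) K) X} (hρ : IsCuspidal ρ) : MatCuspidal (matRep b ρ) := by
  intro f hf hf' u hu
  have h := hρ 2 f le_rfl hf hf' (b.equivFun.symm u) fun A hA =>
    (matRep_mulVec_eq_self b ρ).mp (hu A (mem_bunip_iff.mpr hA))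
  exact (LinearEquiv.map_eq_zero_iff _).mp h

theorem piTensorRep_repr {c : ℕ} (g : Fin c → Γ) (t : PiTensorProduct ℂ fun _ : Fin c => X)
    (s : Fin c → ι) :
    (Basis.piTensorProduct fun _ : Fin c => b).equivFun
      (piTensorRep (fun _ : Fin c => σ) g t) s =
      (tens (fun a => matRep b σ (g a)) *ᵥ
        (Basis.piTensorProduct fun _ : Fin c => b).equivFun t) s := by
  induction t using PiTensorProduct.induction_on with
  | smul_tprod z x =>
    simp only [_root_.map_smul, Pi.smul_apply, mulVec_smul]
    congr 1
    have h : piTensorRep (fun _ : Fin c => σ) g (PiTensorProduct.tprod ℂ x) =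
        PiTensorProduct.tprod ℂ fun a => σ (g a) (x a) := PiTensorProduct.map_tprod _ _
    rw [h]
    simp only [Module.Basis.equivFun_apply, mulVec, dotProduct, tens_apply,
      Basis.piTensorProduct_repr_tprod_apply, ← Finset.prod_mul_distrib]
    refine Eq.trans (Finset.prod_congr rfl fun a _ => ?_)
      (Fintype.prod_sum fun (a : Fin c) (t : ι) =>
        (matRep b σ (g a) : Matrix ι ι ℂ) (s a) t * b.repr (x a) t)
    rw [← LinearMap.toMatrix_mulVec_repr b b]
    rfl
  | add x y hx hy => simp only [_root_.map_add, Pi.add_apply, mulVec_add, hx, hy]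

end MatrixRepresentation

section Transport

theorem RepIso.dual_of_subsingleton {Γ X : Type*} [Group Γ] [Subsingleton Γ] [AddCommGroup X]
    [Module ℂ X] [FiniteDimensional ℂ X] (σ : Representation ℂ Γ X) : RepIso σ σ.dual := by
  refine ⟨LinearEquiv.ofFinrankEq X (Module.Dual ℂ X) Subspace.dual_finrank_eq.symm,
    fun g v => ?_⟩
  rw [Subsingleton.elim g 1, _root_.map_one, _root_.map_one]
  rfl

theorem IsIrred.comp_surjective {Γ Γ' X : Type*} [Group Γ] [Group Γ'] [AddCommGroup X]
    [Module ℂ X] {σ : Representation ℂ Γ X} (hσ : IsIrred σ) {φ : Γ' →* Γ}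
    (hφ : Function.Surjective φ) : IsIrred (σ.comp φ : Representation ℂ Γ' X) :=
  ⟨hσ.1, fun W hW => hσ.2 W fun g v hv => by
    obtain ⟨g, rfl⟩ := hφ g
    exact hW g v hv⟩

/-- Relabelling the rows and columns of invertible matrices. -/
def reindexGL {I J : Type*} [Fintype I] [DecidableEq I] [Fintype J] [DecidableEq J] (K : Type*)
    [Field K] (ε : I ≃ J) : GL I K ≃* GL J K :=
  Units.mapEquiv (Matrix.reindexAlgEquiv K K ε).toMulEquiv

theorem reindexGL_apply {I J : Type*} [Fintype I] [DecidableEq I] [Fintype J] [DecidableEq J]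
    {K : Type*} [Field K] (ε : I ≃ J) (g : GL I K) (x y : I) :
    (reindexGL K ε g : Matrix J J K) (ε x) (ε y) = g x y := by
  show (g : Matrix I I K) (ε.symm (ε x)) (ε.symm (ε y)) = g x y
  rw [ε.symm_apply_apply, ε.symm_apply_apply]

/-- Frobenius reciprocity in the form used here: the embedding of a `ρ`-primary representation into
the parabolic induction, evaluated at the identity and written in coordinates. -/
theorem IsPrimary.exists_sig_equivariant {K : Type*} [Field K] {r c : ℕ} {X Y : Type*}
    [AddCommGroup X] [Module ℂ X] [AddCommGroup Y] [Module ℂ Y]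
    {ρ : Representation ℂ (GL (Fin r) K) X} {π : Representation ℂ (GL (Fin (r * c)) K) Y}
    (h : IsPrimary ρ π) {ι : Type*} [Fintype ι] [DecidableEq ι] (b : Module.Basis ι ℂ X) :
    ∃ (ε : Fin c × Fin r ≃ Fin (r * c)) (T : Y →ₗ[ℂ] (Fin c → ι) → ℂ),
      (∀ w ≠ 0, ∃ g, T (π g w) ≠ 0) ∧
      ∀ (p : pblk c r K) w, T (π (reindexGL K ε p) w) = sig (matRep b ρ) p *ᵥ T w := by
  obtain ⟨f, e, -, he, hmem, hsurj, j, hj, hjπ⟩ := h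
  let ε : Fin c × Fin r ≃ Fin (r * c) := Equiv.ofBijective (fun x => e x.1 x.2)
    ⟨fun x y hxy => by
      have h1 : x.1 = y.1 := by rw [← hmem x.1 x.2, ← hmem y.1 y.2]; exact congrArg f hxy
      obtain ⟨x1, x2⟩ := x
      obtain ⟨y1, y2⟩ := y
      simp only at h1
      subst h1
      exact congrArg _ ((he x1).injective hxy),
     fun i => by
      obtain ⟨t, ht⟩ := hsurj (f i) i rfl
      exact ⟨(f i, t), ht⟩⟩
  have hε : ∀ a i, ε (a, i) = e a i := fun _ _ => rfl
  let ev : Y →ₗ[ℂ] PiTensorProduct ℂ fun _ : Fin c => X :=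
    { toFun := fun w => (j w : GL (Fin (r * c)) K → PiTensorProduct ℂ fun _ : Fin c => X) 1
      map_add' := fun w w' => by rw [_root_.map_add]; rfl
      map_smul' := fun z w => by rw [_root_.map_smul]; rfl }
  have hev : ∀ g w, ev (π g w) =
      (j w : GL (Fin (r * c)) K → PiTensorProduct ℂ fun _ : Fin c => X) g := fun g w => by
    show (j (π g w) : GL (Fin (r * c)) K → PiTensorProduct ℂ fun _ : Fin c => X) 1 = _
    rw [hjπ]
    show (j w : GL (Fin (r * c)) K → PiTensorProduct ℂ fun _ : Fin c => X) (1 * g) = _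
    rw [one_mul]
  let co := (Basis.piTensorProduct fun _ : Fin c => b).equivFun
  refine ⟨ε, co.toLinearMap ∘ₗ ev, fun w hw => ?_, fun p w => ?_⟩
  · by_contra! h
    refine hw (hj ?_)
    rw [_root_.map_zero]
    refine Subtype.ext (funext fun g => ?_)
    rw [← hev]
    exact (LinearEquiv.map_eq_zero_iff co).mp (h g)
  · have hp : reindexGL K ε p ∈ parabolic f := fun i i' hii => by
      obtain ⟨⟨a, s⟩, rfl⟩ := ε.surjective i
      obtain ⟨⟨a', s'⟩, rfl⟩ := ε.surjective i'
      rw [reindexGL_apply]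
      rw [hε, hε, hmem, hmem] at hii
      exact mem_bpar.mp p.2 hii
    have h1 : ev (π (reindexGL K ε p) w) = piTensorRep (fun _ : Fin c => ρ)
        (leviProjPi f e (fun a => (he a).injective) hmem hsurj ⟨_, hp⟩) (ev w) := by
      rw [hev]
      have := (j w).2 ⟨_, hp⟩ 1
      rw [mul_one] at this
      exact this
    have h2 : leviProjPi f e (fun a => (he a).injective) hmem hsurj ⟨_, hp⟩ =
        fun a => dblk a p := by
      funext a
      ext s s'
      exact reindexGL_apply ε (p : GL (Fin c × Fin r) K) (a, s) (a, s')
    funext s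
    show co (ev (π (reindexGL K ε p) w)) s = _
    rw [h1, h2]
    exact piTensorRep_repr _ _ _

/-- Self-duality of distinguished primary representations. -/
theorem IsPrimary.repIso_dual {K : Type} [Field K] [Fintype K] (hodd : Odd (Nat.card K)) {r c : ℕ}
    {X Y : Type*} [AddCommGroup X] [Module ℂ X] [FiniteDimensional ℂ X] [AddCommGroup Y]
    [Module ℂ Y] [FiniteDimensional ℂ Y] {ρ : Representation ℂ (GL (Fin r) K) X} (hρ : IsIrred ρ)
    (hρc : IsCuspidal ρ) {π : Representation ℂ (GL (Fin (r * c)) K) Y} (hπ : IsIrred π)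
    (h : IsPrimary ρ π) {A : GL (Fin (r * c)) K} (hA : A * A = 1) {y : Y} (hy0 : y ≠ 0)
    (hy : ∀ g, g * A = A * g → π g y = y) : RepIso π π.dual := by
  classical
  by_cases hrc : r * c = 0
  · have : IsEmpty (Fin (r * c)) := by rw [hrc]; infer_instance
    have : Subsingleton (GL (Fin (r * c)) K) := ⟨fun g g' => Units.ext (Subsingleton.elim _ _)⟩
    exact RepIso.dual_of_subsingleton π
  have hc : c ≠ 0 := right_ne_zero_of_mul hrc
  have : NeZero r := ⟨left_ne_zero_of_mul hrc⟩
  let b := Module.finBasis ℂ X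
  obtain ⟨ε, T, hT0, hT⟩ := h.exists_sig_equivariant b
  obtain ⟨Φ, hΦ⟩ : ∃ Φ : GL (Fin c × Fin r) K ≃* GL (Fin (r * c)) K, Φ = reindexGL K ε := ⟨_, rfl⟩
  rw [← hΦ] at hT
  obtain ⟨g, hg⟩ := hT0 y hy0
  obtain ⟨k, hk⟩ := exists_odd_pow_bunip hodd c
  have hv : CentFixed (matRep b ρ) (Φ.symm (g * A * g⁻¹)) (T (π g y)) := fun p hp => by
    have hp' : Φ p * (g * A * g⁻¹) = g * A * g⁻¹ * Φ p := by
      simpa using congrArg Φ hp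
    have h1 : π (g⁻¹ * Φ p * g) y = y := hy _ (by
      calc g⁻¹ * Φ p * g * A = g⁻¹ * (Φ p * (g * A * g⁻¹)) * g := by group
        _ = _ := by rw [hp']; group)
    rw [← hT, ← Module.End.mul_apply, ← _root_.map_mul]
    conv_rhs => rw [← h1]
    rw [← Module.End.mul_apply, ← _root_.map_mul]
    congr 3
    group
  have hA' : Φ.symm (g * A * g⁻¹) * Φ.symm (g * A * g⁻¹) = 1 := by
    rw [← _root_.map_mul, show g * A * g⁻¹ * (g * A * g⁻¹) = g * (A * A) * g⁻¹ by group, hA,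
      mul_one, mul_inv_cancel, _root_.map_one]
  obtain ⟨B, B', hB⟩ := Paper.exists_invForm hc (hρc.matCuspidal (b := b)) hρ.matSchur
    (fun x₀ hx₀ u hu hfix => (hρc.repIso_dual hodd hρ hx₀
      (w := b.equivFun.symm u) (fun h0 => hu ((LinearEquiv.map_eq_zero_iff _).mp h0))
      fun h hh => (matRep_mulVec_eq_self b ρ).mp (hfix h hh)).exists_invForm) hA' hv hg (hk _)
  obtain ⟨e, he⟩ := repIso_dual_of_invForm (π := π.comp Φ.toMonoidHom) (hρc.matCuspidal (b := b)) hρ.matSchur hB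
    (hπ.comp_surjective Φ.surjective) (T := T) (fun h0 => hg (by rw [h0]; rfl)) fun p w => hT p w
  refine ⟨e, fun g' w => ?_⟩
  obtain ⟨g', rfl⟩ := Φ.surjective g'
  have h1 := he g' w
  refine h1.trans ?_
  refine LinearMap.ext fun z => ?_
  show e w (π (Φ g'⁻¹) z) = e w (π (Φ g')⁻¹ z)
  rw [_root_.map_inv]

end Transport

/-- Let `ρ` be a cuspidal irreducible representation of `GL_r(𝔽_q)` and `π` a `ρ`-primary
irreducible representation of `GL_{rn}(𝔽_q)` (an irreducible constituent of `ρ × ⋯ × ρ`).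
If `A² = I` and `π` has a nonzero vector invariant under the centralizer `H_A`,
then `π ≅ π*`. -/
theorem statement8 (q : ℕ) (hq : IsPrimePow q) (hqodd : Odd q)
    (F : Type) [Field F] [Fintype F] (hF : Fintype.card F = q)
    (r c : ℕ)
    (V : Type) [AddCommGroup V] [Module ℂ V] [FiniteDimensional ℂ V]
    (ρ : Representation ℂ (GL (Fin r) F) V) (hρi : IsIrred ρ) (hρc : IsCuspidal ρ)
    (W : Type) [AddCommGroup W] [Module ℂ W] [FiniteDimensional ℂ W]
    (π : Representation ℂ (GL (Fin (r * c)) F) W) (hπi : IsIrred π)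
    (hπprim : IsPrimary ρ π)
    (A : GL (Fin (r * c)) F) (hA : A ^ 2 = 1)
    (hdist : HasInvVec π (Subgroup.centralizer {A} : Set (GL (Fin (r * c)) F))) :
    RepIso π π.dual := by
  obtain ⟨y, hy0, hy⟩ := hdist
  exact hπprim.repIso_dual (by rwa [Nat.card_eq_fintype_card, hF]) hρi hρc hπi
    (by rwa [sq] at hA) hy0 fun g hg => hy g (Subgroup.mem_centralizer_singleton_iff.mpr hg)

end Paper
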